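/- Let X be a compact Ptolemy space with properties (E) and (I), and suppose that the fibers of the canonical fibrations π_ω are homeomorphic to ℝ (the case p = 1). Then there exists an integer k ≥ 2 such that for every ω ∈ X there are a metric d ∈ 𝓜 with infinitely remote point ω and a bijection Φ : X∖{ω} → ℂ^{k−1} × ℝ with the property that for all x, x' ∈ X∖{ω}, writing Φ(x) = (z,h) and Φ(x') = (z',h'), one has d(x,x')⁴ = ‖z−z'‖⁴ + 16·(h − h' − ½·Im⟨z,z'⟩)², where ⟨z,z'⟩ = Σ_{i=1}^{k−1} z_i·conj(z'_i) is the standard Hermitian product on ℂ^{k−1} and ‖·‖ the associated norm. In other words, X∖{ω} with a suitably normalized metric of 𝓜 is isometric to the Heisenberg group ℂ^{k−1} × ℝ equipped with the Korányi gauge, so that X is Möbius equivalent to the boundary at infinity of the complex hyperbolic space ℂHᵏ with its canonical Möbius structure, and n = dim X = 2k−1. -/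

import Mathlib

open scoped ENNReal

namespace Mobius

/-- An extended metric on `X`, allowed to have (at most) one infinitely remote point,
which is recorded in the field `rem`.  Distances take values in `ℝ≥0∞`, and the value `⊤`
occurs exactly on pairs of distinct points one of which is the remote point. -/
structure ExtMetric (X : Type*) where
  d : X → X → ℝ≥0∞
  rem : Option X
  symm : ∀ x y, d x y = d y x
  d_self : ∀ x, d x x = 0
  pos : ∀ x y, x ≠ y → 0 < d x y
  triangle : ∀ x y z, d x z ≤ d x y + d y z
  d_eq_top_iff : ∀ x y, d x y = ⊤ ↔ (x ≠ y ∧ (rem = some x ∨ rem = some y))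

/-- The finite factor of a distance used in cross-ratio triples: infinite factors are
dropped (replaced by `1`), in accordance with the standard conventions for cross-ratio
triples of quadruples containing the infinitely remote point. -/
noncomputable def ExtMetric.fd {X : Type*} (d : ExtMetric X) (x y : X) : ℝ :=
  if d.d x y = ⊤ then 1 else (d.d x y).toReal

/-- A representative in `ℝ³` of the cross-ratio triple
`crt(x,y,z,u) = (d(x,y)d(z,u) : d(x,z)d(y,u) : d(x,u)d(y,z)) ∈ ℝP²`,
with the standard conventions when the infinitely remote point occurs among the points. -/
noncomputable def crtVec {X : Type*} (d : ExtMetric X) (x y z u : X) : ℝ × ℝ × ℝ :=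
  (d.fd x y * d.fd z u, d.fd x z * d.fd y u, d.fd x u * d.fd y z)

/-- A quadruple is admissible if no entry occurs three or four times in it. -/
def Admissible {X : Type*} (x y z u : X) : Prop :=
  ¬(x = y ∧ y = z) ∧ ¬(x = y ∧ y = u) ∧ ¬(x = z ∧ z = u) ∧ ¬(y = z ∧ z = u)

/-- Two vectors in `ℝ³` represent the same point of the projective plane (they are
positively proportional). -/
def ProjEq (v w : ℝ × ℝ × ℝ) : Prop :=
  ∃ lam : ℝ, 0 < lam ∧ w = lam • v

theorem ProjEq.refl (v : ℝ × ℝ × ℝ) : ProjEq v v :=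
  ⟨1, one_pos, (one_smul ℝ v).symm⟩

theorem ProjEq.symm {v w : ℝ × ℝ × ℝ} (h : ProjEq v w) : ProjEq w v := by
  obtain ⟨l, hl, rfl⟩ := h
  exact ⟨l⁻¹, inv_pos.mpr hl, by rw [smul_smul, inv_mul_cancel₀ hl.ne', one_smul]⟩

theorem ProjEq.trans' {v w u : ℝ × ℝ × ℝ} (h1 : ProjEq v w) (h2 : ProjEq v u) :
    ProjEq w u := by
  obtain ⟨l, hl, rfl⟩ := h1
  obtain ⟨m, hm, rfl⟩ := h2
  refine ⟨m * l⁻¹, by positivity, ?_⟩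
  rw [smul_smul, mul_assoc, inv_mul_cancel₀ hl.ne', mul_one]

/-- A Möbius structure on a set `X`: a (maximal) class of pairwise Möbius-equivalent
extended metrics on `X`, i.e. metrics defining the same cross-ratio triples on all
admissible quadruples. -/
structure MobiusStructure (X : Type*) where
  M : Set (ExtMetric X)
  nonempty : M.Nonempty
  compat : ∀ d ∈ M, ∀ d' ∈ M, ∀ x y z u : X, Admissible x y z u →
    ProjEq (crtVec d x y z u) (crtVec d' x y z u)
  maximal : ∀ d' : ExtMetric X,
    (∀ d ∈ M, ∀ x y z u : X, Admissible x y z u →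
      ProjEq (crtVec d x y z u) (crtVec d' x y z u)) → d' ∈ M

/-- The Möbius structure generated by a single extended metric. -/
def MobiusStructure.ofMetric {X : Type*} (d₀ : ExtMetric X) : MobiusStructure X where
  M := {d | ∀ x y z u : X, Admissible x y z u →
    ProjEq (crtVec d₀ x y z u) (crtVec d x y z u)}
  nonempty := ⟨d₀, fun _ _ _ _ _ => ProjEq.refl _⟩
  compat := fun _ hd _ hd' x y z u ha => (hd x y z u ha).trans' (hd' x y z u ha)
  maximal := fun _ h => h d₀ (fun _ _ _ _ _ => ProjEq.refl _)

/-- A Möbius structure is Ptolemy if the entries of every cross-ratio triple of every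
admissible quadruple satisfy the triangle inequality. -/
def IsPtolemyStructure {X : Type*} (S : MobiusStructure X) : Prop :=
  ∀ d ∈ S.M, ∀ x y z u : X, Admissible x y z u →
    (crtVec d x y z u).1 ≤ (crtVec d x y z u).2.1 + (crtVec d x y z u).2.2 ∧
    (crtVec d x y z u).2.1 ≤ (crtVec d x y z u).1 + (crtVec d x y z u).2.2 ∧
    (crtVec d x y z u).2.2 ≤ (crtVec d x y z u).1 + (crtVec d x y z u).2.1

/-- The topology of a Möbius space: generated by the open balls of the metrics of the
structure (centered at points distinct from the respective remote points) together with
the complements of the closed balls. -/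
def mobiusTop {X : Type*} (S : MobiusStructure X) : TopologicalSpace X :=
  TopologicalSpace.generateFrom
    {s | ∃ d ∈ S.M, ∃ x : X, d.rem ≠ some x ∧ ∃ r : ℝ≥0∞, 0 < r ∧ r ≠ ⊤ ∧
      (s = {y | d.d y x < r} ∨ s = {y | r < d.d y x})}

/-- Connected components of subsets with respect to the Möbius topology. -/
def mobiusCCIn {X : Type*} (S : MobiusStructure X) (F : Set X) (x : X) : Set X :=
  @connectedComponentIn X (mobiusTop S) F x

/-- The pair `(x,z)` separates the pair `(y,u)` in `σ`:  `y` and `u` lie in different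
connected components of `σ \ {x,z}`. -/
def SeparatesIn {X : Type*} (S : MobiusStructure X) (σ : Set X) (x z y u : X) : Prop :=
  u ∉ mobiusCCIn S (σ \ {x, z}) y

/-- `σ` is homeomorphic to the circle `S¹` (with respect to the Möbius topology). -/
def HomeoToCircle {X : Type*} (S : MobiusStructure X) (σ : Set X) : Prop :=
  letI : TopologicalSpace X := mobiusTop S
  Nonempty (σ ≃ₜ Metric.sphere (0 : ℂ) 1)

/-- `X` is homeomorphic to the sphere `Sⁿ ⊆ ℝ^{n+1}` (w.r.t. the Möbius topology). -/
def HomeoToSphere {X : Type*} (S : MobiusStructure X) (n : ℕ) : Prop :=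
  letI : TopologicalSpace X := mobiusTop S
  Nonempty (X ≃ₜ Metric.sphere (0 : EuclideanSpace ℝ (Fin (n + 1))) 1)

/-- The subset `A ⊆ X` is homeomorphic to `ℝᵖ` (w.r.t. the Möbius topology). -/
def SubsetHomeoToEuclidean {X : Type*} (S : MobiusStructure X) (A : Set X) (p : ℕ) : Prop :=
  letI : TopologicalSpace X := mobiusTop S
  Nonempty (A ≃ₜ EuclideanSpace ℝ (Fin p))

/-- The subset `A ⊆ X` is homeomorphic to `ℝ` (w.r.t. the Möbius topology). -/
def SubsetHomeoToReal {X : Type*} (S : MobiusStructure X) (A : Set X) : Prop :=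
  letI : TopologicalSpace X := mobiusTop S
  Nonempty (A ≃ₜ ℝ)

/-- A Ptolemy circle: a subset homeomorphic to `S¹` on which the Ptolemy equality holds
for every quadruple of distinct points `(x,y,z,u)` such that `(x,z)` separates `(y,u)`. -/
def IsPtolemyCircle {X : Type*} (S : MobiusStructure X) (σ : Set X) : Prop :=
  HomeoToCircle S σ ∧
  ∀ d ∈ S.M, ∀ x ∈ σ, ∀ y ∈ σ, ∀ z ∈ σ, ∀ u ∈ σ,
    x ≠ y → x ≠ z → x ≠ u → y ≠ z → y ≠ u → z ≠ u →
    SeparatesIn S σ x z y u →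
    d.d x z * d.d y u = d.d x y * d.d z u + d.d x u * d.d y z

/-- A Möbius automorphism of `X`: a bijection preserving all cross-ratio triples. -/
def IsMobiusAuto {X : Type*} (S : MobiusStructure X) (f : X → X) : Prop :=
  Function.Bijective f ∧ ∀ d ∈ S.M, ∀ x y z u : X, Admissible x y z u →
    ProjEq (crtVec d x y z u) (crtVec d (f x) (f y) (f z) (f u))

/-- A metric sphere between two distinct points `ω`, `ω'`. -/
def IsMetricSphere {X : Type*} (S : MobiusStructure X) (ω ω' : X) (Sp : Set X) : Prop :=
  ∃ d ∈ S.M, d.rem = some ω' ∧ ∃ r : ℝ≥0∞, 0 < r ∧ r ≠ ⊤ ∧ Sp = {x | d.d x ω = r}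

/-- A space inversion with respect to `ω`, `ω'` and a metric sphere `Sp` between them. -/
def IsSpaceInversion {X : Type*} (S : MobiusStructure X) (ω ω' : X) (Sp : Set X)
    (φ : X → X) : Prop :=
  IsMobiusAuto S φ ∧ Function.Involutive φ ∧ (∀ x, φ x ≠ x) ∧ φ ω = ω' ∧
  φ '' Sp = Sp ∧ ∀ σ : Set X, IsPtolemyCircle S σ → ω ∈ σ → ω' ∈ σ → φ '' σ = σ

/-- Property (E): existence of at least one Ptolemy circle. -/
def PropertyE {X : Type*} (S : MobiusStructure X) : Prop :=
  ∃ σ : Set X, IsPtolemyCircle S σ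

/-- Property (I): existence and uniqueness of space inversions. -/
def PropertyI {X : Type*} (S : MobiusStructure X) : Prop :=
  ∀ ω ω' : X, ω ≠ ω' → ∀ Sp : Set X, IsMetricSphere S ω ω' Sp →
    ∃! φ : X → X, IsSpaceInversion S ω ω' Sp φ

/-- The Möbius space is compact. -/
def MobiusCompact {X : Type*} (S : MobiusStructure X) : Prop :=
  letI : TopologicalSpace X := mobiusTop S
  CompactSpace X

/-- Property (H), the homothety property. -/
def PropertyH {X : Type*} (S : MobiusStructure X) : Prop :=
  ∀ ω ω' : X, ω ≠ ω' → ∀ σ : Set X, IsPtolemyCircle S σ → ω ∈ σ → ω' ∈ σ →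
    ∀ x x' : X, x ∈ σ \ {ω, ω'} → x' ∈ mobiusCCIn S (σ \ {ω, ω'}) x →
    ∃ γ : X → X, IsMobiusAuto S γ ∧ γ ω = ω ∧ γ ω' = ω' ∧
      (∀ σ' : Set X, IsPtolemyCircle S σ' → ω ∈ σ' → ω' ∈ σ' →
        γ '' σ' = σ' ∧ ∀ y ∈ σ' \ {ω, ω'}, γ y ∈ mobiusCCIn S (σ' \ {ω, ω'}) y) ∧
      γ x = x'

/-- A Ptolemy line in `X_ω`: a Ptolemy circle through `ω` with `ω` removed. -/
def IsPtolemyLine {X : Type*} (S : MobiusStructure X) (ω : X) (l : Set X) : Prop :=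
  ∃ σ : Set X, IsPtolemyCircle S σ ∧ ω ∈ σ ∧ l = σ \ {ω}

/-- `c : ℝ → X` is a unit-speed parameterization of `l ⊆ X` w.r.t. the metric `d`. -/
def IsUnitSpeed {X : Type*} (d : ExtMetric X) (l : Set X) (c : ℝ → X) : Prop :=
  Set.range c = l ∧ ∀ s t : ℝ, d.d (c s) (c t) = ENNReal.ofReal |s - t|

/-- `b` is a Busemann function of the Ptolemy line `l ⊆ X_ω`:  up to an additive constant,
`b x = lim_{t→∞} (d(x,c(t)) − t)` for a unit-speed parameterization `c` of `l`. -/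
def IsBusemannOf {X : Type*} (S : MobiusStructure X) (d : ExtMetric X) (ω : X)
    (l : Set X) (b : X → ℝ) : Prop :=
  IsPtolemyLine S ω l ∧ ∃ c : ℝ → X, IsUnitSpeed d l c ∧ ∃ C : ℝ, ∀ x : X, x ≠ ω →
    Filter.Tendsto (fun t => (d.d x (c t)).toReal - t) Filter.atTop (nhds (b x + C))

/-- The fiber through `x` of the canonical fibration `π_ω`: the set of points on which
every Busemann function of every Ptolemy line of `X_ω` takes the same value as at `x`. -/
def mobiusFiber {X : Type*} (S : MobiusStructure X) (d : ExtMetric X) (ω : X) (x : X) :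
    Set X :=
  {y | y ≠ ω ∧ ∀ (l : Set X) (b : X → ℝ), IsBusemannOf S d ω l b → b y = b x}

/-- The base `B_ω` of the canonical fibration: the set of all fibers. -/
def mobiusBase {X : Type*} (S : MobiusStructure X) (d : ExtMetric X) (ω : X) :
    Set (Set X) :=
  {F | ∃ x : X, x ≠ ω ∧ F = mobiusFiber S d ω x}

/-- The distance between two fibers. -/
noncomputable def fiberDist {X : Type*} (d : ExtMetric X) (F F' : Set X) : ℝ :=
  sInf {r : ℝ | ∃ x ∈ F, ∃ x' ∈ F', r = (d.d x x').toReal}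

/-- Two Möbius spaces are Möbius equivalent: there is a bijection between them
preserving all cross-ratio triples. -/
def MobiusEquiv {X Y : Type*} (S : MobiusStructure X) (S' : MobiusStructure Y) : Prop :=
  ∃ f : X → Y, Function.Bijective f ∧ ∀ d ∈ S.M, ∀ d' ∈ S'.M, ∀ x y z u : X,
    Admissible x y z u → ProjEq (crtVec d x y z u) (crtVec d' (f x) (f y) (f z) (f u))

/-- The standard extended Euclidean metric on the one-point extension
`ℝ̂ⁿ = ℝⁿ ∪ {∞}`, where `∞` is encoded by `none`. -/
noncomputable def stdExtMetric (n : ℕ) : ExtMetric (Option (EuclideanSpace ℝ (Fin n))) where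
  d x y :=
    match x, y with
    | none, none => 0
    | none, some _ => ⊤
    | some _, none => ⊤
    | some a, some b => ENNReal.ofReal (dist a b)
  rem := some none
  symm := by intro x y; cases x <;> cases y <;> simp [dist_comm]
  d_self := by intro x; cases x <;> simp
  pos := by
    intro x y h
    cases x <;> cases y
    · exact absurd rfl h
    · simp
    · simp
    · simp only [ne_eq, Option.some.injEq] at h
      exact ENNReal.ofReal_pos.mpr (dist_pos.mpr h)
  triangle := by
    intro x y z
    cases x <;> cases y <;> cases z <;>
      simp only [le_refl, le_top, zero_le, zero_add, add_zero, top_add, add_top,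
        top_le_iff]
    rw [← ENNReal.ofReal_add dist_nonneg dist_nonneg]
    exact ENNReal.ofReal_le_ofReal (dist_triangle _ _ _)
  d_eq_top_iff := by
    intro x y
    cases x <;> cases y <;>
      simp [ENNReal.ofReal_ne_top]

section Proof

open Filter Topology

set_option linter.unusedSectionVars false

/-- An inversion of radius `r` centred at `o`, extended by `φ o = o`. -/
structure IsInv {Y : Type*} [MetricSpace Y] (o : Y) (r : ℝ) (φ : Y → Y) : Prop where
  map_center : φ o = o
  invol : ∀ x, φ (φ x) = x
  ne_self : ∀ x, x ≠ o → φ x ≠ x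
  dist_mul : ∀ x y, x ≠ o → y ≠ o →
    dist (φ x) (φ y) * (dist x o * dist y o) = r ^ 2 * dist x y
  dist_center : ∀ x, x ≠ o → dist (φ x) o * dist x o = r ^ 2
  map_line : ∀ c : ℝ → Y, Isometry c → c 0 = o → ∀ t, t ≠ 0 → φ (c t) = c (-r ^ 2 / t)

/-- A proper Ptolemaic metric space covered by lines, with inversions of every radius
at every point. -/
class InvSpace (Y : Type*) [MetricSpace Y] : Prop extends ProperSpace Y where
  ptolemy : ∀ x y z u : Y, dist x z * dist y u ≤ dist x y * dist z u + dist x u * dist y z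
  exists_line : ∀ o : Y, ∃ c : ℝ → Y, Isometry c ∧ c 0 = o
  exists_inv : ∀ (o : Y) (r : ℝ), 0 < r → ∃ φ : Y → Y, IsInv o r φ

section InvBasic

variable {Y : Type*} [MetricSpace Y]

theorem IsInv.ne_center {o : Y} {r : ℝ} {φ : Y → Y} (h : IsInv o r φ) {x : Y} (hx : x ≠ o) :
    φ x ≠ o := by
  intro h1
  apply hx
  rw [← h.invol x, h1, h.map_center]

/-- A homothety fixing `o` and every line through `o`. -/
structure IsHom (o : Y) (lam : ℝ) (h : Y ≃ Y) : Prop where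
  dist_map : ∀ x y, dist (h x) (h y) = lam * dist x y
  map_center : h o = o
  map_line : ∀ c : ℝ → Y, Isometry c → c 0 = o → ∀ t, h (c t) = c (lam * t)

theorem IsInv.exists_hom [InvSpace Y] {o : Y} {φ : Y → Y} (hφ : IsInv o 1 φ) {lam : ℝ}
    (hl : 0 < lam) : ∃ h : Y ≃ Y, IsHom o lam h ∧ ∀ x, φ (h (φ x)) = h.symm x := by
  obtain ⟨ψ, hψ⟩ := InvSpace.exists_inv o (Real.sqrt lam) (Real.sqrt_pos.mpr hl)
  have hs : Real.sqrt lam ^ 2 = lam := Real.sq_sqrt hl.le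
  refine ⟨⟨fun x => ψ (φ x), fun x => φ (ψ x), fun x => ?_, fun x => ?_⟩, ⟨?_, ?_, ?_⟩, ?_⟩
  · simp only [hψ.invol, hφ.invol]
  · simp only [hψ.invol, hφ.invol]
  · have key : ∀ x, x ≠ o → dist (ψ (φ x)) o = lam * dist x o := by
      intro x hx
      have h1 := hφ.dist_center x hx
      have h2 := hψ.dist_center (φ x) (hφ.ne_center hx)
      have h3 : 0 < dist (φ x) o := dist_pos.mpr (hφ.ne_center hx)
      rw [hs] at h2
      apply mul_right_cancel₀ h3.ne'
      rw [h2, mul_assoc, mul_comm (dist x o), h1]; ring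
    intro x y
    simp only [Equiv.coe_fn_mk]
    by_cases hx : x = o
    · by_cases hy : y = o
      · simp [hx, hy]
      · rw [hx, hφ.map_center, hψ.map_center, dist_comm, key y hy, dist_comm]
    · by_cases hy : y = o
      · rw [hy, hφ.map_center, hψ.map_center, key x hx]
      · have h1 := hφ.dist_mul x y hx hy
        have h2 := hψ.dist_mul _ _ (hφ.ne_center hx) (hφ.ne_center hy)
        have h3 : 0 < dist (φ x) o := dist_pos.mpr (hφ.ne_center hx)
        have h4 : 0 < dist (φ y) o := dist_pos.mpr (hφ.ne_center hy)
        have h5 := hφ.dist_center x hx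
        have h6 := hφ.dist_center y hy
        rw [hs] at h2
        apply mul_right_cancel₀ (mul_pos h3 h4).ne'
        rw [h2]
        have h7 : dist (φ x) (φ y) = dist x y * (dist (φ x) o * dist (φ y) o) := by
          calc dist (φ x) (φ y) = dist (φ x) (φ y) * ((dist (φ x) o * dist x o) *
                (dist (φ y) o * dist y o)) := by rw [h5, h6]; ring
            _ = (dist (φ x) (φ y) * (dist x o * dist y o)) * (dist (φ x) o * dist (φ y) o) := by
                ring
            _ = _ := by rw [h1]; ring
        rw [h7]; ring
  · simp only [Equiv.coe_fn_mk, hφ.map_center, hψ.map_center]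
  · intro c hc h0 t
    simp only [Equiv.coe_fn_mk]
    by_cases ht : t = 0
    · rw [ht, mul_zero, h0, hφ.map_center, hψ.map_center]
    · rw [hφ.map_line c hc h0 t ht, hψ.map_line c hc h0 _ (by simpa using ht), hs]
      congr 1
      field_simp
  · intro x
    simp only [Equiv.coe_fn_mk, Equiv.coe_fn_symm_mk, hφ.invol]

theorem exists_hom [InvSpace Y] (o : Y) {lam : ℝ} (hl : 0 < lam) : ∃ h : Y ≃ Y, IsHom o lam h := by
  obtain ⟨φ, hφ⟩ := InvSpace.exists_inv o 1 one_pos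
  obtain ⟨h, hh, -⟩ := hφ.exists_hom hl
  exact ⟨h, hh⟩

theorem isometry_shift {c : ℝ → Y} (hc : Isometry c) (a : ℝ) : Isometry fun t => c (t + a) :=
  hc.comp (Isometry.of_dist_eq fun s t => by simp)

theorem isometry_rev {c : ℝ → Y} (hc : Isometry c) : Isometry fun t => c (-t) :=
  hc.comp (Isometry.of_dist_eq fun s t => by simp)

theorem isometry_scale {c : ℝ → Y} (hc : Isometry c) {lam : ℝ} (hl : 0 < lam) {g : Y → Y}
    (hg : ∀ x y, dist (g x) (g y) = lam * dist x y) : Isometry fun t => g (c (t / lam)) := by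
  refine Isometry.of_dist_eq fun s t => ?_
  rw [hg, hc.dist_eq, Real.dist_eq, Real.dist_eq, ← sub_div, abs_div, abs_of_pos hl]
  field_simp

theorem exists_translation [InvSpace Y] {c : ℝ → Y} (hc : Isometry c) (a : ℝ) :
    ∃ g : Y ≃ Y, Isometry g ∧ ∀ t, g (c t) = c (t + a) := by
  obtain ⟨h1, hh1⟩ := exists_hom (c 0) (lam := 2) two_pos
  obtain ⟨h2, hh2⟩ := exists_hom (c (2 * a)) (lam := 2⁻¹) (by norm_num)
  refine ⟨h1.trans h2, Isometry.of_dist_eq fun x y => ?_, fun t => ?_⟩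
  · simp only [Equiv.trans_apply, hh2.dist_map, hh1.dist_map]; ring
  · have e := hh2.map_line (fun t => c (t + 2 * a)) (isometry_shift hc _) (by simp) (2 * t - 2 * a)
    simp only [sub_add_cancel] at e
    rw [Equiv.trans_apply, hh1.map_line c hc rfl, e]
    congr 1; ring

theorem convexOn_dist_line [InvSpace Y] {c : ℝ → Y} (hc : Isometry c) (x : Y) :
    ConvexOn ℝ Set.univ fun t => dist x (c t) := by
  refine LinearOrder.convexOn_of_lt convex_univ fun s _ t _ hst a b ha hb hab => ?_
  have h := InvSpace.ptolemy x (c s) (c (a • s + b • t)) (c t)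
  simp only [smul_eq_mul] at *
  rw [hc.dist_eq, hc.dist_eq, hc.dist_eq, Real.dist_eq, Real.dist_eq, Real.dist_eq] at h
  have e1 : |s - t| = t - s := by rw [abs_sub_comm, abs_of_pos (by linarith)]
  have e2 : |a * s + b * t - t| = a * (t - s) := by
    have : a * s + b * t - t = -(a * (t - s)) := by
      rw [← eq_sub_iff_add_eq'] at hab; subst hab; ring
    rw [this, abs_neg, abs_of_pos (mul_pos ha (by linarith))]
  have e3 : |s - (a * s + b * t)| = b * (t - s) := by
    have : s - (a * s + b * t) = -(b * (t - s)) := by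
      rw [← eq_sub_iff_add_eq] at hab; subst hab; ring
    rw [this, abs_neg, abs_of_pos (mul_pos hb (by linarith))]
  rw [e1, e2, e3] at h
  have hp : 0 < t - s := by linarith
  apply le_of_mul_le_mul_right _ hp
  linarith

/-- Busemann function (with sign reversed) of the ray `c|[0,∞)`. -/
noncomputable def bus (c : ℝ → Y) (x : Y) : ℝ := ⨆ t : ℝ, (t - dist x (c t))

theorem bus_mono {c : ℝ → Y} (hc : Isometry c) (x : Y) : Monotone fun t => t - dist x (c t) := by
  intro s t hst
  have := dist_triangle x (c s) (c t)
  rw [hc.dist_eq, Real.dist_eq, abs_sub_comm, abs_of_nonneg (by linarith)] at this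
  simp only
  linarith

theorem bus_bdd {c : ℝ → Y} (hc : Isometry c) (x : Y) : BddAbove
    (Set.range fun t => t - dist x (c t)) := by
  refine ⟨dist x (c 0), ?_⟩
  rintro _ ⟨t, rfl⟩
  have := dist_triangle (c 0) x (c t)
  rw [hc.dist_eq, Real.dist_eq, dist_comm (c 0)] at this
  have h2 := neg_abs_le (0 - t)
  simp only
  linarith

theorem le_bus {c : ℝ → Y} (hc : Isometry c) (x : Y) (t : ℝ) : t - dist x (c t) ≤ bus c x :=
    le_ciSup (bus_bdd hc x) t

theorem tendsto_bus {c : ℝ → Y} (hc : Isometry c) (x : Y) : Tendsto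
    (fun t => t - dist x (c t)) atTop (𝓝 (bus c x)) :=
  tendsto_atTop_ciSup (bus_mono hc x) (bus_bdd hc x)

theorem bus_sub_le {c : ℝ → Y} (hc : Isometry c) (x y : Y) : bus c x - bus c y ≤ dist x y := by
  rw [sub_le_iff_le_add]
  refine ciSup_le fun t => ?_
  have := le_bus hc y t
  have := dist_triangle y x (c t)
  rw [dist_comm y x] at this
  linarith

theorem abs_bus_sub_le {c : ℝ → Y} (hc : Isometry c) (x y : Y) :
    |bus c x - bus c y| ≤ dist x y := by
  rw [abs_le]
  have h1 := bus_sub_le hc x y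
  have h2 := bus_sub_le hc y x
  rw [dist_comm] at h2
  constructor <;> linarith

theorem continuous_bus {c : ℝ → Y} (hc : Isometry c) : Continuous (bus c) :=
  (LipschitzWith.of_dist_le_mul (K := 1) fun x y => by
    simpa [Real.dist_eq] using abs_bus_sub_le hc x y).continuous

theorem bus_line {c : ℝ → Y} (hc : Isometry c) (t : ℝ) : bus c (c t) = t := by
  refine tendsto_nhds_unique (tendsto_bus hc (c t)) ?_
  refine tendsto_const_nhds.congr' ?_
  filter_upwards [eventually_ge_atTop t] with s hs
  rw [hc.dist_eq, Real.dist_eq, abs_sub_comm, abs_of_nonneg (by linarith)]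
  ring

theorem bus_scale {c : ℝ → Y} (hc : Isometry c) {lam : ℝ} (hl : 0 < lam) {g : Y → Y}
    (hg : ∀ x y, dist (g x) (g y) = lam * dist x y) (x : Y) :
    bus (fun t => g (c (t / lam))) (g x) = lam * bus c x := by
  refine tendsto_nhds_unique (tendsto_bus (isometry_scale hc hl hg) _) ?_
  have h := ((tendsto_bus hc x).comp (tendsto_id.atTop_div_const hl)).const_mul lam
  refine h.congr fun t => ?_
  simp only [Function.comp, id, hg]
  field_simp

theorem IsInv.dist_line {c : ℝ → Y} (hc : Isometry c) {φ : Y → Y} (hφ : IsInv (c 0) 1 φ) {x : Y}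
    (hx : x ≠ c 0) {s : ℝ}
    (hs : s ≠ 0) : dist (φ x) (c (-1 / s)) = dist x (c s) / (dist x (c 0) * |s|) := by
  have h1 := hφ.map_line c hc rfl s hs
  rw [one_pow] at h1
  have hcs : c s ≠ c 0 := fun h => hs (hc.injective h)
  have h2 := hφ.dist_mul x (c s) hx hcs
  rw [h1, hc.dist_eq s 0, Real.dist_eq, sub_zero] at h2
  have : 0 < dist x (c 0) := dist_pos.mpr hx
  have h3 : 0 < |s| := abs_pos.mpr hs
  rw [eq_div_iff (by positivity), h2]; ring

theorem IsInv.bus_of_hasDerivAt {c : ℝ → Y} (hc : Isometry c) {φ : Y → Y} (hφ : IsInv (c 0) 1 φ)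
    {x : Y} (hx : x ≠ c 0)
    {f' : ℝ} (hf : HasDerivAt (fun t => dist x (c t)) f' 0) :
    bus c (φ x) = f' / dist x (c 0) ∧ bus (fun t => c (-t)) (φ x) = -(f' / dist x (c 0)) := by
  have h0 : 0 < dist x (c 0) := dist_pos.mpr hx
  have hs := hasDerivAt_iff_tendsto_slope_zero.mp hf
  simp only [zero_add, smul_eq_mul] at hs
  constructor
  · refine tendsto_nhds_unique (tendsto_bus hc (φ x)) ?_
    have h1 : Tendsto (fun t : ℝ => -t⁻¹) atTop (𝓝[≠] 0) := by
      refine tendsto_nhdsWithin_iff.mpr ⟨?_, ?_⟩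
      · simpa using (tendsto_inv_atTop_zero (𝕜 := ℝ)).neg
      · filter_upwards [eventually_gt_atTop 0] with t ht
        simpa using ht.ne'
    refine ((hs.comp h1).div_const (dist x (c 0))).congr' ?_
    filter_upwards [eventually_gt_atTop 0] with t ht
    have e := hφ.dist_line hc hx (s := -t⁻¹) (by simpa using ht.ne')
    have e1 : -1 / -t⁻¹ = t := by field_simp
    rw [e1] at e
    rw [e, abs_neg, abs_of_pos (by positivity)]
    simp only [Function.comp]
    field_simp
    ring
  · refine tendsto_nhds_unique (tendsto_bus (isometry_rev hc) (φ x)) ?_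
    have h1 : Tendsto (fun t : ℝ => t⁻¹) atTop (𝓝[≠] 0) := by
      refine tendsto_nhdsWithin_iff.mpr ⟨tendsto_inv_atTop_zero, ?_⟩
      · filter_upwards [eventually_gt_atTop 0] with t ht
        simpa using ht.ne'
    refine ((hs.comp h1).div_const (dist x (c 0))).neg.congr' ?_
    filter_upwards [eventually_gt_atTop 0] with t ht
    have e := hφ.dist_line hc hx (s := t⁻¹) (by simpa using ht.ne')
    have e1 : -1 / t⁻¹ = -t := by field_simp
    rw [e1] at e
    rw [e, abs_of_pos (by positivity)]
    simp only [Function.comp]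
    field_simp
    ring

theorem IsInv.continuousOn {o : Y} {φ : Y → Y} (hφ : IsInv o 1 φ) : ContinuousOn φ {o}ᶜ := by
  intro x hx
  apply ContinuousAt.continuousWithinAt
  rw [ContinuousAt, tendsto_iff_dist_tendsto_zero]
  have hx : x ≠ o := hx
  have h1 : Tendsto (fun y => dist y x / (dist y o * dist x o)) (𝓝 x) (𝓝 0) := by
    have : ContinuousAt (fun y => dist y x / (dist y o * dist x o)) x := by
      refine ContinuousAt.div (by fun_prop) (by fun_prop) ?_
      have := dist_pos.mpr hx
      positivity
    simpa [ContinuousAt] using this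
  refine h1.congr' ?_
  filter_upwards [isOpen_compl_singleton.mem_nhds hx] with y hy
  have h2 := hφ.dist_mul y x hy hx
  have h3 : 0 < dist y o := dist_pos.mpr hy
  have h4 : 0 < dist x o := dist_pos.mpr hx
  rw [div_eq_iff (by positivity), h2]; ring

/-- Flatness: the Busemann functions of opposite rays are opposite. -/
theorem bus_rev {c : ℝ → Y} (hc : Isometry c) [InvSpace Y] (x : Y) : bus (fun t => c (-t)) x =
    -bus c x := by
  classical
  obtain ⟨φ, hφ⟩ := InvSpace.exists_inv (c 0) 1 one_pos
  have hlip : ∀ y, LipschitzWith 1 fun t => dist y (c t) := fun y =>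
    LipschitzWith.of_dist_le_mul fun s t => by
      have := abs_dist_sub_le (c s) (c t) y
      rw [dist_comm (c s) y, dist_comm (c t) y, hc.dist_eq] at this
      simpa [Real.dist_eq] using this
  obtain ⟨q, hq⟩ : ∃ q : ℕ → Y, DenseRange q := by
    have : Nonempty Y := ⟨c 0⟩
    exact TopologicalSpace.exists_dense_seq Y
  obtain ⟨a, ha⟩ : ∃ a : ℝ, ∀ i, DifferentiableAt ℝ (fun t => dist (q i) (c t)) a := by
    have : ∀ᵐ a : ℝ, ∀ i, DifferentiableAt ℝ (fun t => dist (q i) (c t)) a :=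
      MeasureTheory.ae_all_iff.mpr fun i => (hlip (q i)).ae_differentiableAt
    exact this.exists
  obtain ⟨g, hg, hgc⟩ := exists_translation hc a
  have hz : ∀ i, g.symm (q i) ≠ c 0 →
      bus c (φ (g.symm (q i))) + bus (fun t => c (-t)) (φ (g.symm (q i))) = 0 := by
    intro i hi
    have h1 : DifferentiableAt ℝ (fun t => dist (g.symm (q i)) (c t)) 0 := by
      have h2 : (fun t => dist (g.symm (q i)) (c t)) = (fun t => dist (q i) (c t)) ∘ (· + a) := by
        funext t
        simp only [Function.comp]
        rw [← hgc, ← hg.dist_eq, Equiv.apply_symm_apply]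
      rw [h2]
      refine DifferentiableAt.comp _ ?_ (by fun_prop)
      simpa using ha i
    obtain ⟨e1, e2⟩ := hφ.bus_of_hasDerivAt hc hi h1.hasDerivAt
    rw [e1, e2]; ring
  have hdense : DenseRange fun i => g.symm (q i) := by
    have hgs : Isometry g.symm := Isometry.of_dist_eq fun x y => by
      rw [← hg.dist_eq]; simp
    exact g.symm.surjective.denseRange.comp hq hgs.continuous
  have hall : ∀ z, z ≠ c 0 → bus c (φ z) + bus (fun t => c (-t)) (φ z) = 0 := by
    intro z hzc
    have hcont : ContinuousOn (fun z => bus c (φ z) + bus (fun t => c (-t)) (φ z)) {c 0}ᶜ :=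
      ((continuous_bus hc).comp_continuousOn hφ.continuousOn).add
        ((continuous_bus (isometry_rev hc)).comp_continuousOn hφ.continuousOn)
    by_contra hne
    have hopen := hcont.isOpen_inter_preimage isOpen_compl_singleton
      (isOpen_compl_singleton (x := (0 : ℝ)))
    obtain ⟨_, ⟨h1, h2⟩, i, rfl⟩ := hdense.inter_open_nonempty _ hopen ⟨z, hzc, hne⟩
    exact h2 (hz i h1)
  by_cases hx : x = c 0
  · have h1 := bus_line hc 0
    have h2 := bus_line (isometry_rev hc) 0
    simp only [neg_zero] at h2
    rw [hx, h1, h2, neg_zero]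
  · have := hall (φ x) (hφ.ne_center hx)
    rw [hφ.invol] at this
    linarith

end InvBasic

section Lines

theorem exists_ultralimit {Y : Type*} [MetricSpace Y] [ProperSpace Y] {ι A : Type*}
    (U : Ultrafilter ι) (f : ι → A → Y) (o : Y) (R : A → ℝ)
    (h : ∀ a, ∀ᶠ n in (U : Filter ι), dist (f n a) o ≤ R a) :
    ∃ F : A → Y, ∀ a, Tendsto (fun n => f n a) U (𝓝 (F a)) := by
  have : ∀ a, ∃ y, Tendsto (fun n => f n a) U (𝓝 y) := by
    intro a
    have hc := isCompact_closedBall o (R a)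
    have hle : ((U.map fun n => f n a : Ultrafilter Y) : Filter Y) ≤
        𝓟 (Metric.closedBall o (R a)) := by
      rw [le_principal_iff]
      exact h a
    obtain ⟨y, -, hy⟩ := isCompact_iff_ultrafilter_le_nhds.mp hc _ hle
    exact ⟨y, hy⟩
  choose F hF using this
  exact ⟨F, hF⟩

theorem affine_of_convexOn_of_concaveOn {f : ℝ → ℝ} (h1 : ConvexOn ℝ Set.univ f)
    (h2 : ConcaveOn ℝ Set.univ f) (t : ℝ) : f t = f 0 + t * (f 1 - f 0) := by
  have key : ∀ x y a b : ℝ, 0 ≤ a → 0 ≤ b → a + b = 1 → f (a * x + b * y) = a * f x + b * f y :=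
    fun x y a b ha hb hab => le_antisymm (h1.2 trivial trivial ha hb hab)
      (h2.2 trivial trivial ha hb hab)
  rcases lt_or_ge t 0 with ht | ht
  · have hp : 0 < 1 - t := by linarith
    have := key t 1 (1 / (1 - t)) (-t / (1 - t)) (by positivity)
      (div_nonneg (by linarith) hp.le) (by field_simp; ring)
    have e : 1 / (1 - t) * t + -t / (1 - t) * 1 = 0 := by field_simp; ring
    rw [e] at this
    field_simp at this
    linarith
  · rcases le_or_gt t 1 with h | h
    · have := key 0 1 (1 - t) t (by linarith) ht (by ring)
      rw [mul_zero, mul_one, zero_add] at this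
      rw [this]; ring
    · have hp : 0 < t := by linarith
      have := key 0 t (1 - 1 / t) (1 / t) (by rw [sub_nonneg, div_le_one hp]; exact h.le)
        (by positivity) (by ring)
      have e : (1 - 1 / t) * 0 + 1 / t * t = 1 := by field_simp; ring
      rw [e] at this
      field_simp at this
      linarith

variable {Y : Type*} [MetricSpace Y] [InvSpace Y]

theorem concaveOn_bus {c c' : ℝ → Y} (hc : Isometry c) (hc' : Isometry c') :
    ConcaveOn ℝ Set.univ fun t => bus c (c' t) := by
  refine ⟨convex_univ, fun s _ t _ a b ha hb hab => ?_⟩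
  refine le_of_tendsto_of_tendsto (((tendsto_bus hc (c' s)).const_mul a).add
    ((tendsto_bus hc (c' t)).const_mul b)) (tendsto_bus hc (c' (a • s + b • t))) ?_
  refine Eventually.of_forall fun T => ?_
  have := (convexOn_dist_line hc' (c T)).2 (x := s) (y := t) trivial trivial ha hb hab
  simp only [dist_comm (c T), smul_eq_mul] at this ⊢
  have e : T = a * T + b * T := by rw [← add_mul, hab, one_mul]
  linarith

/-- The slope of the Busemann function of `c` along `c'`. -/
noncomputable def slope (c c' : ℝ → Y) : ℝ := bus c (c' 1) - bus c (c' 0)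

theorem bus_along {c c' : ℝ → Y} (hc : Isometry c) (hc' : Isometry c') (t : ℝ) :
    bus c (c' t) = bus c (c' 0) + t * slope c c' := by
  refine affine_of_convexOn_of_concaveOn (f := fun t => bus c (c' t)) ?_ (concaveOn_bus hc hc') t
  have h := (concaveOn_bus (isometry_rev hc) hc').neg
  refine h.congr fun s _ => ?_
  simp [bus_rev hc]

theorem bus_of_slope_one {c c' : ℝ → Y} (hc : Isometry c) (hc' : Isometry c')
    (h : slope c c' = 1) (x : Y) : bus c x = bus c' x + bus c (c' 0) := by
  have key : ∀ {e e' : ℝ → Y} (he : Isometry e) (he' : Isometry e') (b : ℝ)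
      (h : ∀ t, bus e (e' t) = t + b), bus e' x ≤ bus e x - b := by
    intro e e' he he' b h
    refine ciSup_le fun t => ?_
    have := bus_sub_le he (e' t) x
    rw [h, dist_comm] at this
    linarith
  have e1 : ∀ t, bus c (c' t) = t + bus c (c' 0) := fun t => by
    rw [bus_along hc hc' t, h]; ring
  have h1 := key hc hc' _ e1
  have h2 := key (isometry_rev hc) (isometry_rev hc') (-bus c (c' 0)) fun t => by
    rw [bus_rev hc, e1]; ring
  rw [bus_rev hc, bus_rev hc'] at h2
  linarith

theorem slope_hom {o : Y} {lam : ℝ} (hl : 0 < lam) {h : Y ≃ Y} (hh : IsHom o lam h)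
    {c e : ℝ → Y} (hc : Isometry c) (he : Isometry e) (he0 : e 0 = o) :
    slope (fun t => h (c (t / lam))) e = slope c e := by
  have h1 : ∀ t, bus (fun t => h (c (t / lam))) (e t) = lam * bus c (e (t / lam)) := fun t => by
    rw [← bus_scale hc hl hh.dist_map, hh.map_line e he he0, mul_div_cancel₀ _ hl.ne']
  change bus _ _ - bus _ _ = slope c e
  rw [h1, h1, zero_div, bus_along hc he (1 / lam)]
  field_simp
  ring

theorem bus_of_tendsto {ι : Type*} {U : Ultrafilter ι} {f : ι → ℝ → Y} (hf : ∀ n, Isometry (f n))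
    {c : ℝ → Y} (hc : Isometry c) (hlim : ∀ t, Tendsto (fun n => f n t) U (𝓝 (c t))) (x : Y) :
    Tendsto (fun n => bus (f n) x) U (𝓝 (bus c x)) := by
  rw [Metric.tendsto_nhds]
  intro ε hε
  have key : ∀ {f : ι → ℝ → Y} (hf : ∀ n, Isometry (f n)) {c : ℝ → Y} (hc : Isometry c)
      (hlim : ∀ t, Tendsto (fun n => f n t) U (𝓝 (c t))),
      ∀ᶠ n in (U : Filter ι), bus c x - ε < bus (f n) x := by
    intro f hf c hc hlim
    have h1 : bus c x - ε < bus c x := by linarith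
    obtain ⟨t, ht⟩ := ((tendsto_bus hc x).eventually (lt_mem_nhds h1)).exists
    have h2 : Tendsto (fun n => t - dist x (f n t)) U (𝓝 (t - dist x (c t))) :=
      (tendsto_const_nhds).sub (tendsto_const_nhds.dist (hlim t))
    filter_upwards [h2.eventually (lt_mem_nhds ht)] with n hn
    exact hn.trans_le (le_bus (hf n) x t)
  filter_upwards [key hf hc hlim, key (fun n => isometry_rev (hf n)) (isometry_rev hc)
    (fun t => hlim (-t))] with n h1 h2
  rw [bus_rev hc, bus_rev (hf n)] at h2
  rw [Real.dist_eq, abs_lt]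
  constructor <;> linarith

theorem isometry_of_tendsto {Y : Type*} [MetricSpace Y] {ι A : Type*} [MetricSpace A]
    {U : Ultrafilter ι} {f : ι → A → Y}
    (hf : ∀ n, Isometry (f n)) {c : A → Y}
    (hlim : ∀ t, Tendsto (fun n => f n t) U (𝓝 (c t))) : Isometry c := by
  refine Isometry.of_dist_eq fun s t => ?_
  refine tendsto_nhds_unique ((hlim s).dist (hlim t)) ?_
  simp only [(hf _).dist_eq]
  exact tendsto_const_nhds

theorem exists_parallel {c : ℝ → Y} (hc : Isometry c) (o : Y) :
    ∃ c' : ℝ → Y, Isometry c' ∧ c' 0 = o ∧ ∀ x, bus c x = bus c' x + bus c o := by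
  have hl : ∀ n : ℕ, (0 : ℝ) < 1 / (n + 1) := fun n => by positivity
  choose h hh using fun n : ℕ => exists_hom o (hl n)
  set f : ℕ → ℝ → Y := fun n t => h n (c (t / (1 / (n + 1)))) with hfdef
  have hf : ∀ n, Isometry (f n) := fun n => isometry_scale hc (hl n) (hh n).dist_map
  have hf0 : ∀ n, dist (f n 0) o = 1 / (n + 1) * dist (c 0) o := fun n => by
    have := (hh n).dist_map (c 0) o
    rw [(hh n).map_center] at this
    simpa [hfdef] using this
  let U := hyperfilter ℕ
  have hlim0 : Tendsto (fun n => f n 0) U (𝓝 o) := by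
    rw [tendsto_iff_dist_tendsto_zero]
    simp only [hf0]
    have : Tendsto (fun n : ℕ => (1 : ℝ) / (n + 1)) U (𝓝 0) :=
      tendsto_one_div_add_atTop_nhds_zero_nat.mono_left Nat.hyperfilter_le_atTop
    simpa using this.mul_const (dist (c 0) o)
  obtain ⟨c', hc'⟩ := exists_ultralimit U f o (fun t => |t| + dist (c 0) o) fun t =>
    Eventually.of_forall fun n => by
      have h1 := dist_triangle (f n t) (f n 0) o
      rw [(hf n).dist_eq, hf0, Real.dist_eq, sub_zero] at h1
      have h2 : (1 : ℝ) / (n + 1) * dist (c 0) o ≤ 1 * dist (c 0) o := by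
        gcongr
        rw [div_le_one (by positivity)]
        have : (0 : ℝ) ≤ n := n.cast_nonneg
        linarith
      linarith
  have hiso : Isometry c' := isometry_of_tendsto hf hc'
  have h0 : c' 0 = o := tendsto_nhds_unique (hc' 0) hlim0
  have hs : slope c c' = 1 := by
    have h1 : Tendsto (fun n => slope (f n) c') U (𝓝 (slope c' c')) :=
      (bus_of_tendsto hf hiso hc' _).sub (bus_of_tendsto hf hiso hc' _)
    have h2 : slope c' c' = 1 := by simp [slope, bus_line hiso]
    rw [h2] at h1
    refine tendsto_nhds_unique ?_ h1
    have : ∀ n, slope (f n) c' = slope c c' := fun n => slope_hom (hl n) (hh n) hc hiso h0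
    simp only [this]
    exact tendsto_const_nhds
  refine ⟨c', hiso, h0, fun x => ?_⟩
  rw [← h0]
  exact bus_of_slope_one hc hiso hs x

theorem line_eq_of_slope_one {c c' : ℝ → Y} (hc : Isometry c) (hc' : Isometry c')
    (h0 : c 0 = c' 0) (h : slope c c' = 1) : c = c' := by
  have key : ∀ {c c' : ℝ → Y} (hc : Isometry c) (hc' : Isometry c') (h0 : c 0 = c' 0)
      (h : ∀ x, bus c x = bus c' x), ∀ t < 0, c t = c' t := by
    intro c c' hc hc' h0 hb
    have hd : ∀ s t, 0 ≤ s → t ≤ 0 → dist (c s) (c' t) = s - t := by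
      intro s t hs ht
      apply le_antisymm
      · have := dist_triangle (c s) (c 0) (c' t)
        rw [hc.dist_eq] at this
        rw [h0, hc'.dist_eq, Real.dist_eq, Real.dist_eq, sub_zero, zero_sub, abs_of_nonneg hs,
          abs_of_nonneg (by linarith)] at this
        linarith
      · have := bus_sub_le hc (c s) (c' t)
        rwa [bus_line hc, hb, bus_line hc'] at this
    let e : ℝ → Y := fun t => if 0 ≤ t then c t else c' t
    have he : Isometry e := by
      refine Isometry.of_dist_eq fun s t => ?_
      simp only [e]
      split_ifs with h1 h2 h2
      · exact hc.dist_eq s t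
      · rw [hd s t h1 (by linarith), Real.dist_eq, abs_of_nonneg (by linarith)]
      · rw [dist_comm, hd t s h2 (by linarith), Real.dist_eq, abs_of_nonpos (by linarith)]
        ring
      · exact hc'.dist_eq s t
    obtain ⟨φ, hφ⟩ := InvSpace.exists_inv (c 0) 1 one_pos
    intro t ht
    have hp : 0 < -1 ^ 2 / t := div_pos_of_neg_of_neg (by norm_num) ht
    have h1 := hφ.map_line c hc rfl _ hp.ne'
    have h2 := hφ.map_line e he (by simp [e]) _ hp.ne'
    have e1 : -1 ^ 2 / (-1 ^ 2 / t) = t := by field_simp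
    rw [e1] at h1 h2
    simp only [e, hp.le, if_true, not_le.mpr ht, if_false] at h2
    rw [← h1, h2]
  have hb : ∀ x, bus c x = bus c' x := fun x => by
    rw [bus_of_slope_one hc hc' h, ← h0, bus_line hc, add_zero]
  funext t
  rcases lt_trichotomy t 0 with ht | ht | ht
  · exact key hc hc' h0 hb t ht
  · rw [ht, h0]
  · have := key (isometry_rev hc) (isometry_rev hc') (by simpa using h0) (fun x => by
      rw [bus_rev hc, bus_rev hc', hb]) (-t) (by linarith)
    simpa using this

theorem slope_comm {c c' : ℝ → Y} (hc : Isometry c) (hc' : Isometry c')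
    (h0 : c 0 = c' 0) : slope c c' = slope c' c := by
  obtain ⟨φ, hφ⟩ := InvSpace.exists_inv (c 0) 1 one_pos
  have hd : ∀ s, 0 < s → dist (c' 1) (c s) = dist (c (-1)) (c' (-s)) := by
    intro s hs
    obtain ⟨h, hh⟩ := exists_hom (c 0) hs
    have h1 := hφ.dist_mul (c s) (c' 1) (fun e => hs.ne' (hc.injective e))
      (fun e => one_ne_zero (hc'.injective (e.trans h0)))
    rw [hφ.map_line c hc rfl s hs.ne', hφ.map_line c' hc' h0.symm 1 one_ne_zero, hc.dist_eq] at h1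
    rw [h0, hc'.dist_eq, Real.dist_eq, Real.dist_eq, sub_zero, sub_zero, abs_of_pos hs,
      abs_one] at h1
    have h2 := hh.dist_map (c (-1 ^ 2 / s)) (c' (-1 ^ 2 / 1))
    rw [hh.map_line c hc rfl, hh.map_line c' hc' h0.symm] at h2
    have e1 : s * (-1 ^ 2 / s) = -1 := by field_simp
    have e2 : s * (-1 ^ 2 / 1) = -s := by ring
    rw [e1, e2] at h2
    rw [h2, dist_comm (c' 1)]
    linarith
  have h1 := tendsto_bus hc (c' 1)
  have h2 := tendsto_bus (isometry_rev hc') (c (-1))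
  have h3 : bus c (c' 1) = bus (fun t => c' (-t)) (c (-1)) := by
    refine tendsto_nhds_unique h1 (h2.congr' ?_)
    filter_upwards [eventually_gt_atTop 0] with s hs
    rw [hd s hs]
  rw [bus_rev hc', bus_along hc' hc, bus_along hc hc', ← h0, bus_line hc, h0, bus_line hc'] at h3
  linarith

end Lines

section Similarities

variable {Y : Type*} [MetricSpace Y] [InvSpace Y]

/-- A similarity acting on all Busemann functions by scaling and adding constants. -/
structure IsSim (lam : ℝ) (g : Y ≃ Y) : Prop where
  dist_map : ∀ x y, dist (g x) (g y) = lam * dist x y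
  bus_map : ∀ c : ℝ → Y, Isometry c → ∃ C, ∀ x, bus c (g x) = lam * bus c x + C

theorem IsHom.isSim {o : Y} {lam : ℝ} (hl : 0 < lam) {h : Y ≃ Y} (hh : IsHom o lam h) :
    IsSim lam h := by
  refine ⟨hh.dist_map, fun c hc => ?_⟩
  obtain ⟨c', hc', h0, hb⟩ := exists_parallel hc o
  refine ⟨bus c o - lam * bus c o, fun x => ?_⟩
  have e := bus_scale hc' hl hh.dist_map x
  have : (fun t => h (c' (t / lam))) = c' := by
    funext t
    rw [hh.map_line c' hc' h0, mul_div_cancel₀ _ hl.ne']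
  rw [this] at e
  rw [hb, hb x, e]; ring

theorem IsSim.trans {l m : ℝ} {g h : Y ≃ Y} (hg : IsSim l g) (hh : IsSim m h) :
    IsSim (m * l) (g.trans h) := by
  refine ⟨fun x y => ?_, fun c hc => ?_⟩
  · rw [Equiv.trans_apply, Equiv.trans_apply, hh.dist_map, hg.dist_map]; ring
  · obtain ⟨C, hC⟩ := hg.bus_map c hc
    obtain ⟨D, hD⟩ := hh.bus_map c hc
    refine ⟨m * C + D, fun x => ?_⟩
    rw [Equiv.trans_apply, hD, hC]; ring

theorem IsSim.symm {l : ℝ} (hl : 0 < l) {g : Y ≃ Y} (hg : IsSim l g) : IsSim l⁻¹ g.symm := by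
  refine ⟨fun x y => ?_, fun c hc => ?_⟩
  · have := hg.dist_map (g.symm x) (g.symm y)
    simp only [Equiv.apply_symm_apply] at this
    rw [this]; field_simp
  · obtain ⟨C, hC⟩ := hg.bus_map c hc
    refine ⟨-l⁻¹ * C, fun x => ?_⟩
    have := hC (g.symm x)
    rw [Equiv.apply_symm_apply] at this
    rw [this]; field_simp; ring

theorem IsSim.isometry {g : Y ≃ Y} (hg : IsSim 1 g) : Isometry g :=
  Isometry.of_dist_eq fun x y => by rw [hg.dist_map, one_mul]

theorem IsSim.one_symm {g : Y ≃ Y} (hg : IsSim 1 g) : IsSim 1 g.symm := by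
  simpa using hg.symm one_pos

theorem exists_shift (o o' : Y) : ∃ g : Y ≃ Y, IsSim 1 g ∧ g o = o' := by
  have hl : ∀ n : ℕ, (0 : ℝ) < n + 1 := fun n => by positivity
  choose h hh using fun n : ℕ => exists_hom o (hl n)
  choose k hk using fun n : ℕ => exists_hom o' (inv_pos.mpr (hl n))
  let f : ℕ → (Y ≃ Y) := fun n => (h n).trans (k n)
  have hf : ∀ n, IsSim 1 (f n) := fun n => by
    have := ((hh n).isSim (hl n)).trans ((hk n).isSim (inv_pos.mpr (hl n)))
    rwa [inv_mul_cancel₀ (hl n).ne'] at this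
  have hd : ∀ n, dist (f n o) o' = ((n : ℝ) + 1)⁻¹ * dist o o' := fun n => by
    have := (hk n).dist_map o o'
    rw [(hk n).map_center] at this
    simp only [f, Equiv.trans_apply, (hh n).map_center, this]
  let U := hyperfilter ℕ
  have hlim0 : Tendsto (fun n => f n o) U (𝓝 o') := by
    rw [tendsto_iff_dist_tendsto_zero]
    simp only [hd]
    have : Tendsto (fun n : ℕ => (1 : ℝ) / (n + 1)) U (𝓝 0) :=
      tendsto_one_div_add_atTop_nhds_zero_nat.mono_left Nat.hyperfilter_le_atTop
    simpa using this.mul_const (dist o o')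
  have hle : ∀ n, dist (f n o) o' ≤ dist o o' := fun n => by
    rw [hd]
    have h1 : ((n : ℝ) + 1)⁻¹ ≤ 1 := inv_le_one_of_one_le₀ (by simp)
    nlinarith [dist_nonneg (x := o) (y := o')]
  obtain ⟨F, hF⟩ := exists_ultralimit U (fun n x => f n x) o' (fun x => dist x o + dist o o')
    fun x => Eventually.of_forall fun n => by
      have h1 := dist_triangle (f n x) (f n o) o'
      rw [(hf n).isometry.dist_eq] at h1
      linarith [hle n]
  obtain ⟨G, hG⟩ := exists_ultralimit U (fun n x => (f n).symm x) o
    (fun x => dist x o' + dist o o') fun x => Eventually.of_forall fun n => by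
      have h1 := dist_triangle x o' (f n o)
      have h2 := (hf n).isometry.dist_eq ((f n).symm x) o
      rw [Equiv.apply_symm_apply] at h2
      rw [dist_comm o'] at h1
      linarith [hle n]
  have hFiso : Isometry F := isometry_of_tendsto (fun n => (hf n).isometry) hF
  have hGiso : Isometry G := isometry_of_tendsto (fun n => (hf n).one_symm.isometry) hG
  have key : ∀ {a b : ℕ → Y → Y} {A B : Y → Y} (_ : ∀ n, Isometry (a n))
      (_ : ∀ x, Tendsto (fun n => a n x) U (𝓝 (A x)))
      (_ : ∀ x, Tendsto (fun n => b n x) U (𝓝 (B x))) (_ : ∀ n x, a n (b n x) = x) (x : Y),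
      A (B x) = x := by
    intro a b A B ha hA hB hab x
    have h1 := hA (B x)
    have h2 : Tendsto (fun n => dist (a n (B x)) x) U (𝓝 0) := by
      have h3 := tendsto_iff_dist_tendsto_zero.mp (hB x)
      refine h3.congr fun n => ?_
      rw [← (ha n).dist_eq, hab, dist_comm]
    exact tendsto_nhds_unique h1 (tendsto_iff_dist_tendsto_zero.mpr h2)
  have hFG := key (fun n => (hf n).isometry) hF hG (fun n x => (f n).apply_symm_apply x)
  have hGF := key (fun n => (hf n).one_symm.isometry) hG hF (fun n x => (f n).symm_apply_apply x)
  refine ⟨⟨F, G, hGF, hFG⟩, ⟨fun x y => ?_, fun c hc => ?_⟩, ?_⟩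
  · simp [hFiso.dist_eq]
  · choose C hC using fun n => (hf n).bus_map c hc
    refine ⟨bus c o' - bus c o, fun x => ?_⟩
    have h1 : Tendsto (fun n => bus c (f n x)) U (𝓝 (bus c (F x))) :=
      ((continuous_bus hc).tendsto _).comp (hF x)
    have h2 : Tendsto (fun n => bus c (f n o)) U (𝓝 (bus c o')) :=
      ((continuous_bus hc).tendsto _).comp hlim0
    have h3 : Tendsto (fun n => bus c (f n x)) U (𝓝 (1 * bus c x + (bus c o' - bus c o))) := by
      refine ((h2.sub_const (bus c o)).const_add (1 * bus c x)).congr fun n => ?_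
      rw [hC n x, hC n o]; ring
    exact tendsto_nhds_unique h1 h3
  · exact tendsto_nhds_unique (hF o) hlim0

/-- Lines through `o`. -/
abbrev Dir (o : Y) : Type _ := {c : ℝ → Y // Isometry c ∧ c 0 = o}

/-- All values of Busemann functions of lines through `o`. -/
noncomputable def evalBus (o x : Y) : Dir o → ℝ := fun c => bus c.1 x

theorem evalBus_base (o : Y) : evalBus o o = 0 := by
  funext c
  have := bus_line c.2.1 0
  rwa [c.2.2] at this

theorem IsSim.evalBus {o : Y} {lam : ℝ} {g : Y ≃ Y} (hg : IsSim lam g) (y : Y) :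
    evalBus o (g y) = lam • evalBus o y + evalBus o (g o) := by
  funext c
  obtain ⟨C, hC⟩ := hg.bus_map c.1 c.2.1
  have h1 := congrFun (evalBus_base o) c
  simp only [Mobius.evalBus, Pi.add_apply, Pi.smul_apply, smul_eq_mul, Pi.zero_apply] at h1 ⊢
  rw [hC, hC, h1]; ring

theorem IsSim.one_evalBus {o : Y} {g : Y ≃ Y} (hg : IsSim 1 g) (y : Y) :
    Mobius.evalBus o (g y) = Mobius.evalBus o y + Mobius.evalBus o (g o) := by
  rw [hg.evalBus, one_smul]

theorem evalBus_line {o : Y} (c : Dir o) (t : ℝ) : evalBus o (c.1 t) = t • evalBus o (c.1 1) := by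
  funext e
  have h0 := congrFun (evalBus_base o) e
  have h1 := bus_along e.2.1 c.2.1 t
  have h2 := bus_along e.2.1 c.2.1 1
  rw [c.2.2] at h1 h2
  simp only [evalBus, Pi.smul_apply, smul_eq_mul, Pi.zero_apply] at h0 ⊢
  rw [h1, h2, h0]; ring

theorem tendsto_floor_div (s : ℝ) :
    Tendsto (fun n : ℕ => (⌊((n : ℝ) + 1) * s⌋ : ℝ) / (n + 1)) atTop (𝓝 s) := by
  rw [tendsto_iff_dist_tendsto_zero]
  refine squeeze_zero (fun _ => dist_nonneg) (fun n => ?_)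
    tendsto_one_div_add_atTop_nhds_zero_nat
  have hn : (0 : ℝ) < n + 1 := by positivity
  have e : (⌊((n : ℝ) + 1) * s⌋ : ℝ) / (n + 1) - s = (⌊((n : ℝ) + 1) * s⌋ - (n + 1) * s) /
    (n + 1) := by
    field_simp
  rw [Real.dist_eq, e, abs_div, abs_of_pos hn]
  gcongr
  have h1 := Int.floor_le (((n : ℝ) + 1) * s)
  have h2 := Int.lt_floor_add_one (((n : ℝ) + 1) * s)
  rw [abs_le]; constructor <;> linarith

theorem exists_evalBus_eq (o x : Y) :
    ∃ c : Dir o, ∃ t : ℝ, 0 ≤ t ∧ evalBus o x = evalBus o (c.1 t) := by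
  obtain ⟨γ, hγ, hγo⟩ := exists_shift o x
  have hiso : ∀ n : ℕ, Isometry ((γ ^ n : Equiv.Perm Y) : Y → Y) := fun n => by
    induction n with
    | zero => exact isometry_id
    | succ n ih => rw [pow_succ]; exact ih.comp hγ.isometry
  have hev : ∀ n : ℕ, evalBus o ((γ ^ n : Equiv.Perm Y) o) = (n : ℝ) • evalBus o x := fun n => by
    induction n with
    | zero => simp [evalBus_base]
    | succ n ih =>
      rw [pow_succ', Equiv.Perm.mul_apply, hγ.one_evalBus, ih, hγo, Nat.cast_succ, add_smul,
        one_smul]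
  let u : ℕ → ℝ := fun n => dist o ((γ ^ n : Equiv.Perm Y) o)
  have hu : Subadditive u := fun m n => by
    have := dist_triangle o ((γ ^ m : Equiv.Perm Y) o) ((γ ^ (m + n) : Equiv.Perm Y) o)
    rw [pow_add, Equiv.Perm.mul_apply, (hiso m).dist_eq] at this
    simpa [u, pow_add] using this
  have hbdd : BddBelow (Set.range fun n => u n / n) :=
    ⟨0, by rintro _ ⟨n, rfl⟩; exact div_nonneg dist_nonneg n.cast_nonneg⟩
  set L := hu.lim with hL
  have hlim := hu.tendsto_lim hbdd
  have hLnn : 0 ≤ L := ge_of_tendsto' hlim fun n => div_nonneg dist_nonneg n.cast_nonneg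
  have hbusle : ∀ (c : Dir o) (n : ℕ), |(n : ℝ) * evalBus o x c| ≤ u n := fun c n => by
    have h1 := congrFun (hev n) c
    have h2 := abs_bus_sub_le c.2.1 ((γ ^ n : Equiv.Perm Y) o) o
    have h3 := congrFun (evalBus_base o) c
    simp only [evalBus, Pi.smul_apply, smul_eq_mul, Pi.zero_apply] at h1 h3 ⊢
    rw [← h1]
    rw [h3, sub_zero, dist_comm] at h2
    exact h2
  rcases hLnn.eq_or_lt with hL0 | hLpos
  · obtain ⟨c, hc, hc0⟩ := InvSpace.exists_line o
    refine ⟨⟨c, hc, hc0⟩, 0, le_rfl, ?_⟩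
    simp only [hc0, evalBus_base]
    funext e
    have h1 : |evalBus o x e| ≤ 0 := by
      rw [hL0]
      refine ge_of_tendsto hlim ?_
      filter_upwards [eventually_gt_atTop 0] with n hn
      have hn' : (0 : ℝ) < n := Nat.cast_pos.mpr hn
      rw [le_div_iff₀ hn']
      have := hbusle e n
      rw [abs_mul, abs_of_pos hn'] at this
      linarith
    exact abs_nonpos_iff.mp h1
  have hl : ∀ n : ℕ, (0 : ℝ) < (n + 1 : ℝ)⁻¹ := fun n => by positivity
  choose h hh using fun n : ℕ => exists_hom o (hl n)
  let f : ℕ → ℝ → Y := fun n t => h n ((γ ^ ⌊((n : ℝ) + 1) * t⌋ : Equiv.Perm Y) o)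
  have hdz : ∀ i j : ℤ, dist ((γ ^ i : Equiv.Perm Y) o) ((γ ^ j : Equiv.Perm Y) o) =
      u (i - j).natAbs := by
    have key : ∀ (j : ℤ) (n : ℕ), dist ((γ ^ (j + n) : Equiv.Perm Y) o) ((γ ^ j : Equiv.Perm Y) o)
        = u n := by
      intro j n
      have hj : Isometry ((γ ^ j : Equiv.Perm Y) : Y → Y) := by
        obtain ⟨m, rfl | rfl⟩ := j.eq_nat_or_neg
        · simpa using hiso m
        · refine Isometry.of_dist_eq fun a b => ?_
          rw [← (hiso m).dist_eq, ← Equiv.Perm.mul_apply, ← Equiv.Perm.mul_apply, zpow_neg,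
            zpow_natCast, mul_inv_cancel]
          simp
      rw [zpow_add, Equiv.Perm.mul_apply, hj.dist_eq, dist_comm]
      simp [u]
    intro i j
    rcases le_total j i with hij | hij
    · have := key j (i - j).natAbs
      rwa [Int.natAbs_of_nonneg (by linarith), add_sub_cancel] at this
    · have := key i (j - i).natAbs
      rw [Int.natAbs_of_nonneg (by linarith), add_sub_cancel, dist_comm] at this
      rw [this, ← Int.natAbs_neg]; simp
  have hfd : ∀ n s t, dist (f n s) (f n t) =
      ((n : ℝ) + 1)⁻¹ * u (⌊((n : ℝ) + 1) * s⌋ - ⌊((n : ℝ) + 1) * t⌋).natAbs := fun n s t => by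
    simp only [f, (hh n).dist_map, hdz]
  have hfdlim : ∀ s t, Tendsto (fun n => dist (f n s) (f n t)) atTop (𝓝 (L * |s - t|)) := by
    intro s t
    by_cases hst : s = t
    · simp [hst]
    have h1 : Tendsto (fun n : ℕ =>
        ((⌊((n : ℝ) + 1) * s⌋ - ⌊((n : ℝ) + 1) * t⌋).natAbs : ℝ) / (n + 1)) atTop
        (𝓝 |s - t|) := by
      refine (((tendsto_floor_div s).sub (tendsto_floor_div t)).abs).congr fun n => ?_
      have hn : (0 : ℝ) < n + 1 := by positivity
      rw [← sub_div, abs_div, abs_of_pos hn, Nat.cast_natAbs]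
      push_cast
      rfl
    have h2 : Tendsto (fun n : ℕ => (⌊((n : ℝ) + 1) * s⌋ - ⌊((n : ℝ) + 1) * t⌋).natAbs) atTop
        atTop := by
      rw [← tendsto_natCast_atTop_iff (R := ℝ)]
      have h3 : Tendsto (fun n : ℕ => (n : ℝ) + 1) atTop atTop :=
        tendsto_atTop_add_const_right _ _ tendsto_natCast_atTop_atTop
      refine (h1.pos_mul_atTop (abs_pos.mpr (sub_ne_zero.mpr hst)) h3).congr fun n => ?_
      have hn : (0 : ℝ) < n + 1 := by positivity
      field_simp
    refine ((hlim.comp h2).mul h1).congr' ?_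
    filter_upwards [h2.eventually_gt_atTop 0] with n hn
    rw [hfd]
    have hn' : (0 : ℝ) < (⌊((n : ℝ) + 1) * s⌋ - ⌊((n : ℝ) + 1) * t⌋).natAbs := Nat.cast_pos.mpr hn
    simp only [Function.comp]
    field_simp
  have hf0 : ∀ n, f n 0 = o := fun n => by simp [f, (hh n).map_center]
  let U := hyperfilter ℕ
  obtain ⟨c, hc⟩ := exists_ultralimit U f o (fun t => L * |t| + 1) fun t => by
    have h1 := (hfdlim t 0).mono_left (Nat.hyperfilter_le_atTop)
    rw [sub_zero] at h1
    filter_upwards [h1.eventually (gt_mem_nhds (lt_add_one _))] with n hn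
    rw [hf0] at hn
    exact hn.le
  have hcd : ∀ s t, dist (c s) (c t) = L * |s - t| := fun s t =>
    tendsto_nhds_unique ((hc s).dist (hc t)) ((hfdlim s t).mono_left Nat.hyperfilter_le_atTop)
  have hc0 : c 0 = o := tendsto_nhds_unique (hc 0) (by simp only [hf0]; exact tendsto_const_nhds)
  refine ⟨⟨fun t => c (t / L), Isometry.of_dist_eq fun s t => ?_, by simp [hc0]⟩, L, hLnn, ?_⟩
  · rw [hcd, ← sub_div, abs_div, abs_of_pos hLpos, Real.dist_eq]; field_simp
  · simp only [div_self hLpos.ne']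
    funext e
    have h1 : Tendsto (fun n => bus e.1 (f n 1)) U (𝓝 (bus e.1 (c 1))) :=
      ((continuous_bus e.2.1).tendsto _).comp (hc 1)
    refine tendsto_nhds_unique ?_ h1
    refine tendsto_const_nhds.congr fun n => ?_
    have hn : (0 : ℝ) < n + 1 := by positivity
    have h2 : ⌊((n : ℝ) + 1) * 1⌋ = ((n + 1 : ℕ) : ℤ) := by
      rw [mul_one]; exact_mod_cast Int.floor_natCast (R := ℝ) (n + 1)
    have h3 := congrFun (((hh n).isSim (hl n)).evalBus (o := o) ((γ ^ (n + 1) : Equiv.Perm Y) o)) e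
    rw [hev, (hh n).map_center, evalBus_base, add_zero, smul_smul] at h3
    push_cast at h3
    rw [inv_mul_cancel₀ hn.ne', one_smul] at h3
    simp only [f, h2, zpow_natCast]
    exact h3.symm

end Similarities

section Base

variable {Y : Type*} [MetricSpace Y] [InvSpace Y]

theorem evalBus_line_apply {o : Y} (c e : Dir o) (t : ℝ) :
    evalBus o (c.1 t) e = t * slope e.1 c.1 := by
  have h0 := bus_line e.2.1 0
  have h1 := bus_along e.2.1 c.2.1 t
  rw [c.2.2] at h1
  rw [e.2.2] at h0
  simp only [evalBus]
  rw [h1, h0, zero_add]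

theorem abs_slope_le {c c' : ℝ → Y} (hc : Isometry c) (hc' : Isometry c') : |slope c c'| ≤ 1 := by
  have := abs_bus_sub_le hc (c' 1) (c' 0)
  rwa [hc'.dist_eq, Real.dist_eq, sub_zero, abs_one] at this

theorem slope_self {c : ℝ → Y} (hc : Isometry c) : slope c c = 1 := by
  simp [slope, bus_line hc]

theorem Dir.slope_comm {o : Y} (c c' : Dir o) : slope c.1 c'.1 = slope c'.1 c.1 :=
  Mobius.slope_comm c.2.1 c'.2.1 (c.2.2.trans c'.2.2.symm)

theorem evalBus_line_inj {o : Y} (c c' : Dir o) {t t' : ℝ}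
    (h : evalBus o (c.1 t) = evalBus o (c'.1 t')) : c.1 t = c'.1 t' := by
  have key : ∀ (c c' : Dir o) {t t' : ℝ} (_ : 0 ≤ t) (_ : 0 ≤ t')
      (_ : evalBus o (c.1 t) = evalBus o (c'.1 t')), c.1 t = c'.1 t' := by
    intro c c' t t' ht ht' h
    have h1 := congrFun h c
    have h2 := congrFun h c'
    rw [evalBus_line_apply, evalBus_line_apply, slope_self c.2.1] at h1
    rw [evalBus_line_apply, evalBus_line_apply, slope_self c'.2.1] at h2
    have h3 := (abs_le.mp (abs_slope_le c.2.1 c'.2.1)).2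
    have h4 := (abs_le.mp (abs_slope_le c'.2.1 c.2.1)).2
    have h5 : t = t' := le_antisymm (by nlinarith) (by nlinarith)
    subst h5
    rcases ht.eq_or_lt with h0 | h0
    · rw [← h0, c.2.2, c'.2.2]
    · have h6 : slope c.1 c'.1 = 1 := by
        apply mul_left_cancel₀ h0.ne'
        rw [← h1]
      rw [line_eq_of_slope_one c.2.1 c'.2.1 (c.2.2.trans c'.2.2.symm) h6]
  have key2 : ∀ (c c' : Dir o) {t t' : ℝ} (_ : 0 ≤ t)
      (_ : evalBus o (c.1 t) = evalBus o (c'.1 t')), c.1 t = c'.1 t' := by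
    intro c c' t t' ht h
    rcases le_total 0 t' with h0 | h0
    · exact key c c' ht h0 h
    · have := key c ⟨fun t => c'.1 (-t), isometry_rev c'.2.1, by simp [c'.2.2]⟩ (t' := -t') ht
        (by linarith) (by simpa using h)
      simpa using this
  rcases le_total 0 t with h0 | h0
  · exact key2 c c' h0 h
  · have := key2 ⟨fun t => c.1 (-t), isometry_rev c.2.1, by simp [c.2.2]⟩ c' (t := -t)
      (by linarith) (by simpa using h)
    simpa using this

/-- The vector space of values of Busemann functions. -/
noncomputable def dirSpan (o : Y) : Submodule ℝ (Dir o → ℝ) where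
  carrier := Set.range (evalBus o)
  zero_mem' := ⟨o, evalBus_base o⟩
  add_mem' := by
    rintro _ _ ⟨x, rfl⟩ ⟨y, rfl⟩
    obtain ⟨g, hg, hgo⟩ := exists_shift o y
    exact ⟨g x, by rw [hg.one_evalBus, hgo]⟩
  smul_mem' := by
    rintro s _ ⟨x, rfl⟩
    obtain ⟨c, t, -, h⟩ := exists_evalBus_eq o x
    exact ⟨c.1 (s * t), by rw [h, evalBus_line, evalBus_line c t, smul_smul]⟩

/-- The base of the fibration, as a vector space. -/
def DirV (o : Y) : Type _ := dirSpan o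

noncomputable instance (o : Y) : AddCommGroup (DirV o) := inferInstanceAs (AddCommGroup (dirSpan o))
noncomputable instance (o : Y) : Module ℝ (DirV o) := inferInstanceAs (Module ℝ (dirSpan o))

/-- The coordinates of an element of the base. -/
def DirV.val {o : Y} (w : DirV o) : Dir o → ℝ := Subtype.val (p := (· ∈ dirSpan o)) w

theorem DirV.ext {o : Y} {v w : DirV o} (h : v.val = w.val) : v = w := Subtype.ext h

theorem DirV.val_add {o : Y} (v w : DirV o) : (v + w).val = v.val + w.val := rfl

theorem DirV.val_smul {o : Y} (s : ℝ) (w : DirV o) : (s • w).val = s • w.val := rfl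

theorem DirV.exists_rep {o : Y} (w : DirV o) :
    ∃ (c : Dir o) (t : ℝ), 0 ≤ t ∧ w.val = evalBus o (c.1 t) := by
  obtain ⟨x, hx⟩ : w.val ∈ Set.range (evalBus o) := Subtype.property (p := (· ∈ dirSpan o)) w
  obtain ⟨c, t, ht, h⟩ := exists_evalBus_eq o x
  exact ⟨c, t, ht, hx ▸ h⟩

/-- A direction representing a vector. -/
noncomputable def DirV.dir {o : Y} (w : DirV o) : Dir o := w.exists_rep.choose

/-- The length of a vector. -/
noncomputable def DirV.len {o : Y} (w : DirV o) : ℝ := w.exists_rep.choose_spec.choose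

theorem DirV.len_nonneg {o : Y} (w : DirV o) : 0 ≤ w.len := w.exists_rep.choose_spec.choose_spec.1

theorem DirV.val_eq {o : Y} (w : DirV o) : w.val = evalBus o (w.dir.1 w.len) :=
  w.exists_rep.choose_spec.choose_spec.2

/-- The inner product on the base. -/
@[reducible] noncomputable def dirCore (o : Y) : InnerProductSpace.Core ℝ (DirV o) where
  inner w v := v.len * w.val v.dir
  conj_inner_symm w v := by
    simp only [conj_trivial]
    rw [w.val_eq, v.val_eq, evalBus_line_apply, evalBus_line_apply, Dir.slope_comm]; ring
  re_inner_nonneg w := by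
    simp only [RCLike.re_to_real]
    rw [w.val_eq, evalBus_line_apply, slope_self w.dir.2.1]
    nlinarith [w.len_nonneg]
  add_left v w u := by
    simp only [DirV.val_add, Pi.add_apply]; ring
  smul_left v w s := by
    simp only [DirV.val_smul, Pi.smul_apply, conj_trivial, smul_eq_mul]; ring
  definite w h := by
    rw [w.val_eq, evalBus_line_apply, slope_self w.dir.2.1] at h
    have h0 : w.len = 0 := by nlinarith
    refine DirV.ext ?_
    rw [w.val_eq, h0, w.dir.2.2, evalBus_base]
    rfl

noncomputable instance (o : Y) : NormedAddCommGroup (DirV o) :=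
  (dirCore o).toNormedAddCommGroup

noncomputable instance (o : Y) : InnerProductSpace ℝ (DirV o) :=
  InnerProductSpace.ofCore (dirCore o).toCore

theorem DirV.inner_def {o : Y} (w v : DirV o) : inner ℝ w v = v.len * w.val v.dir := rfl

theorem DirV.norm_eq {o : Y} (w : DirV o) : ‖w‖ = w.len := by
  have h1 : ‖w‖ ^ 2 = w.len ^ 2 := by
    rw [← real_inner_self_eq_norm_sq, DirV.inner_def, w.val_eq, evalBus_line_apply,
      slope_self w.dir.2.1]
    ring
  exact (pow_left_inj₀ (norm_nonneg _) w.len_nonneg two_ne_zero).mp h1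

/-- The projection to the base. -/
noncomputable def dirProj (o : Y) (x : Y) : DirV o := ⟨evalBus o x, x, rfl⟩

theorem dirProj_val (o x : Y) : (dirProj o x).val = evalBus o x := rfl

/-- A flat affine structure transverse to the fibres: `proj` is the projection to the base,
and `tr w x` moves `x` along the line through `x` in direction `w`. -/
structure Chart (o : Y) (V : Type*) [NormedAddCommGroup V] [InnerProductSpace ℝ V] where
  proj : Y → V
  tr : V → Y → Y
  proj_base : proj o = 0
  proj_tr : ∀ w x, proj (tr w x) = proj x + w
  isometry_tr : ∀ u : V, ‖u‖ = 1 → ∀ x, Isometry fun t : ℝ => tr (t • u) x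
  exists_dir : ∀ c : ℝ → Y, Isometry c → ∃ u : V, ‖u‖ = 1 ∧ ∀ t, c t = tr (t • u) (c 0)
  bus_tr : ∀ u : V, ‖u‖ = 1 → ∀ x y, bus (fun t : ℝ => tr (t • u) x) y = inner ℝ u (proj y - proj x)

theorem dirProj_line {o : Y} (c : Dir o) (t : ℝ) : dirProj o (c.1 t) = t • dirProj o (c.1 1) :=
  DirV.ext (evalBus_line c t)

theorem norm_dirProj_line {o : Y} (c : Dir o) (t : ℝ) : ‖dirProj o (c.1 t)‖ = |t| := by
  set w := dirProj o (c.1 t)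
  have h : w.dir.1 w.len = c.1 t := evalBus_line_inj _ _ (w.val_eq.symm.trans (dirProj_val o _))
  have h1 := w.dir.2.1.dist_eq w.len 0
  rw [w.dir.2.2, h] at h1
  have h2 := c.2.1.dist_eq t 0
  rw [c.2.2, Real.dist_eq, sub_zero] at h2
  rw [Real.dist_eq, sub_zero, abs_of_nonneg w.len_nonneg] at h1
  rw [w.norm_eq, ← h1, h2]

theorem IsSim.dirProj {o : Y} {g : Y ≃ Y} (hg : IsSim 1 g) (y : Y) :
    dirProj o (g y) = dirProj o y + dirProj o (g o) :=
  DirV.ext (hg.one_evalBus y)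

theorem norm_dirProj_le (o x : Y) : ‖dirProj o x‖ ≤ dist x o := by
  set w := dirProj o x with hw
  have h := congrFun w.val_eq w.dir
  rw [evalBus_line_apply, slope_self w.dir.2.1, mul_one, hw, dirProj_val] at h
  have h1 := bus_sub_le w.dir.2.1 x o
  have h2 := bus_line w.dir.2.1 0
  rw [w.dir.2.2] at h2
  rw [h2, sub_zero] at h1
  rw [w.norm_eq, ← h]
  exact h1

theorem lipschitz_dirProj (o : Y) : LipschitzWith 1 (dirProj o) := by
  refine LipschitzWith.of_dist_le_mul fun x y => ?_
  obtain ⟨g, hg, hgo⟩ := exists_shift o y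
  have h1 := hg.dirProj (o := o) (g.symm x)
  rw [Equiv.apply_symm_apply, hgo] at h1
  have h2 := norm_dirProj_le o (g.symm x)
  rw [← hg.isometry.dist_eq, Equiv.apply_symm_apply, hgo] at h2
  rw [dist_eq_norm, h1, add_sub_cancel_right]
  simpa using h2

theorem finiteDimensional_dirV (o : Y) : FiniteDimensional ℝ (DirV o) := by
  refine FiniteDimensional.of_isCompact_closedBall ℝ one_pos (c := (0 : DirV o)) ?_
  have h := (isCompact_closedBall o 1).image (lipschitz_dirProj o).continuous
  convert h using 1
  ext w
  simp only [Set.mem_image, Metric.mem_closedBall, dist_zero_right]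
  constructor
  · intro hw
    refine ⟨w.dir.1 w.len, ?_, ?_⟩
    · have h1 := w.dir.2.1.dist_eq w.len 0
      rw [w.dir.2.2, Real.dist_eq, sub_zero, abs_of_nonneg w.len_nonneg] at h1
      rwa [h1, ← w.norm_eq]
    · exact DirV.ext w.val_eq.symm
  · rintro ⟨x, hx, rfl⟩
    exact (norm_dirProj_le o x).trans hx

theorem exists_chart (o : Y) : Nonempty (Chart o (DirV o)) := by
  choose g hg hgo using exists_shift o
  have hline : ∀ (c : Dir o) (t : ℝ) (x : Y),
      g x ((t • dirProj o (c.1 1)).dir.1 (t • dirProj o (c.1 1)).len) = g x (c.1 t) := by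
    intro c t x
    congr 1
    refine evalBus_line_inj _ _ ?_
    rw [← DirV.val_eq, ← dirProj_line, dirProj_val]
  have hunit : ∀ u : DirV o, ‖u‖ = 1 → u = dirProj o (u.dir.1 1) := by
    intro u hu
    have := u.val_eq
    rw [← u.norm_eq, hu] at this
    exact DirV.ext this
  have htr : ∀ u : DirV o, ‖u‖ = 1 → ∀ x, (fun t : ℝ => g x ((t • u).dir.1 (t • u).len)) =
      fun t => g x (u.dir.1 t) := by
    intro u hu x
    funext t
    have := hline u.dir t x
    rwa [← hunit u hu] at this
  refine ⟨⟨dirProj o, fun w x => g x (w.dir.1 w.len), ?_, fun w x => ?_, fun u hu x => ?_,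
    fun c hc => ?_, fun u hu x y => ?_⟩⟩
  · exact DirV.ext (evalBus_base o)
  · rw [(hg x).dirProj, hgo, add_comm]
    congr 1
    exact DirV.ext w.val_eq.symm
  · rw [htr u hu x]
    exact (hg x).isometry.comp u.dir.2.1
  · let e : Dir o := ⟨fun t => (g (c 0)).symm (c t), (hg _).one_symm.isometry.comp hc, by
      rw [Equiv.symm_apply_eq, hgo]⟩
    refine ⟨dirProj o (e.1 1), by simpa using norm_dirProj_line e 1, fun t => ?_⟩
    change c t = g (c 0) ((t • dirProj o (e.1 1)).dir.1 (t • dirProj o (e.1 1)).len)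
    rw [hline]
    simp [e]
  · rw [htr u hu x]
    have h1 := bus_scale u.dir.2.1 one_pos (hg x).dist_map ((g x).symm y)
    simp only [div_one, Equiv.apply_symm_apply, one_mul] at h1
    rw [h1]
    have h2 := (hg x).dirProj (o := o) ((g x).symm y)
    rw [Equiv.apply_symm_apply, hgo] at h2
    rw [h2, add_sub_cancel_right, real_inner_comm, DirV.inner_def, ← u.norm_eq, hu, one_mul,
      dirProj_val]
    rfl

end Base

section ChartLemmas

variable {Y : Type*} [MetricSpace Y] [InvSpace Y] {o : Y} {V : Type*} [NormedAddCommGroup V]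
  [InnerProductSpace ℝ V]

theorem Chart.tr_zero (C : Chart o V) (x : Y) : C.tr 0 x = x := by
  obtain ⟨c, hc, h0⟩ := InvSpace.exists_line x
  obtain ⟨u, -, h⟩ := C.exists_dir c hc
  have := h 0
  rw [zero_smul, h0] at this
  exact this.symm

theorem Chart.line_eq (C : Chart o V) {c : ℝ → Y} (hc : Isometry c) {u : V}
    (hu : C.proj (c 1) = C.proj (c 0) + u) (t : ℝ) : c t = C.tr (t • u) (c 0) := by
  obtain ⟨v, -, h⟩ := C.exists_dir c hc
  have h1 := h 1
  rw [one_smul] at h1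
  rw [h1, C.proj_tr] at hu
  rw [h t, add_left_cancel hu]

theorem Chart.tr_smul_unit (C : Chart o V) {u : V} (hu : ‖u‖ = 1) (s t : ℝ) (x : Y) :
    C.tr (s • u) (C.tr (t • u) x) = C.tr ((s + t) • u) x := by
  have h := C.line_eq (isometry_shift (C.isometry_tr u hu x) t) (u := u) (by
    simp only [C.proj_tr, add_smul, zero_smul, one_smul]; abel) s
  simp only [zero_add] at h
  rw [h]

theorem Chart.tr_smul (C : Chart o V) (w : V) (s t : ℝ) (x : Y) :
    C.tr (s • w) (C.tr (t • w) x) = C.tr ((s + t) • w) x := by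
  by_cases hw : w = 0
  · simp [hw, C.tr_zero]
  · have h0 : ‖w‖ ≠ 0 := norm_ne_zero_iff.mpr hw
    have h1 : ‖‖w‖⁻¹ • w‖ = 1 := norm_smul_inv_norm (𝕜 := ℝ) hw
    have h2 := C.tr_smul_unit h1 (s * ‖w‖) (t * ‖w‖) x
    simp only [smul_smul, mul_assoc, mul_inv_cancel₀ h0, mul_one, ← add_mul] at h2
    exact h2

theorem Chart.tr_neg_tr (C : Chart o V) (w : V) (x : Y) : C.tr (-w) (C.tr w x) = x := by
  have := C.tr_smul w (-1) 1 x
  simpa [C.tr_zero] using this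

theorem Chart.tr_tr_neg (C : Chart o V) (w : V) (x : Y) : C.tr w (C.tr (-w) x) = x := by
  simpa using C.tr_neg_tr (-w) x

theorem Chart.dist_tr_smul (C : Chart o V) (w : V) (s t : ℝ) (x : Y) :
    dist (C.tr (s • w) x) (C.tr (t • w) x) = |s - t| * ‖w‖ := by
  by_cases hw : w = 0
  · simp [hw, C.tr_zero]
  · have h0 : ‖w‖ ≠ 0 := norm_ne_zero_iff.mpr hw
    have h1 : ‖‖w‖⁻¹ • w‖ = 1 := norm_smul_inv_norm (𝕜 := ℝ) hw
    have h2 := (C.isometry_tr _ h1 x).dist_eq (s * ‖w‖) (t * ‖w‖)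
    simp only [smul_smul, mul_assoc, mul_inv_cancel₀ h0, mul_one] at h2
    rw [h2, Real.dist_eq, ← sub_mul, abs_mul, abs_norm]

theorem Chart.dist_tr (C : Chart o V) (w : V) (x : Y) : dist x (C.tr w x) = ‖w‖ := by
  have := C.dist_tr_smul w 0 1 x
  simpa [C.tr_zero] using this

theorem Chart.norm_proj_sub_le (C : Chart o V) (x y : Y) : ‖C.proj x - C.proj y‖ ≤ dist x y := by
  by_cases h : C.proj x - C.proj y = 0
  · simp [h]
  · have h1 : ‖‖C.proj x - C.proj y‖⁻¹ • (C.proj x - C.proj y)‖ = 1 :=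
      norm_smul_inv_norm (𝕜 := ℝ) h
    have h2 := bus_sub_le (C.isometry_tr _ h1 y) x y
    rw [C.bus_tr _ h1, C.bus_tr _ h1, sub_self, inner_zero_right, sub_zero, real_inner_smul_left,
      real_inner_self_eq_norm_sq] at h2
    have h0 : ‖C.proj x - C.proj y‖ ≠ 0 := norm_ne_zero_iff.mpr h
    field_simp at h2
    exact h2

theorem Chart.continuous_proj (C : Chart o V) : Continuous C.proj :=
  (LipschitzWith.of_dist_le_mul (K := 1) fun x y => by
    simpa [dist_eq_norm] using C.norm_proj_sub_le x y).continuous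

theorem eq_of_inner_unit {x y : V} (h : ∀ u : V, ‖u‖ = 1 → inner ℝ u x = inner ℝ u y) : x = y := by
  rw [← sub_eq_zero]
  by_contra hne
  have h1 : ‖‖x - y‖⁻¹ • (x - y)‖ = 1 := norm_smul_inv_norm (𝕜 := ℝ) hne
  have h2 := h _ h1
  rw [← sub_eq_zero, ← inner_sub_right, real_inner_smul_left, real_inner_self_eq_norm_sq] at h2
  have h0 : ‖x - y‖ ≠ 0 := norm_ne_zero_iff.mpr hne
  simp at h2
  exact hne h2

theorem Chart.proj_sim (C : Chart o V) {lam : ℝ} {g : Y ≃ Y} (hg : IsSim lam g) (x : Y) :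
    C.proj (g x) = lam • C.proj x + C.proj (g o) := by
  refine eq_of_inner_unit fun u hu => ?_
  obtain ⟨K, hK⟩ := hg.bus_map _ (C.isometry_tr u hu o)
  have h1 := hK x
  have h2 := hK o
  simp only [C.bus_tr u hu, C.proj_base, sub_zero, inner_zero_right] at h1 h2
  rw [inner_add_right, real_inner_smul_right, h1, h2]; ring

theorem Chart.sim_tr (C : Chart o V) {lam : ℝ} (hl : 0 < lam) {g : Y ≃ Y} (hg : IsSim lam g)
    (w : V) (x : Y) : g (C.tr w x) = C.tr (lam • w) (g x) := by
  by_cases hw : w = 0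
  · simp [hw, C.tr_zero]
  · have h0 : ‖w‖ ≠ 0 := norm_ne_zero_iff.mpr hw
    have h1 : ‖‖w‖⁻¹ • w‖ = 1 := norm_smul_inv_norm (𝕜 := ℝ) hw
    have h2 := C.line_eq (isometry_scale (C.isometry_tr _ h1 x) hl hg.dist_map)
      (u := ‖w‖⁻¹ • w) (by
        rw [C.proj_sim hg, C.proj_sim hg (C.tr _ _), C.proj_tr, C.proj_tr, zero_div, zero_smul,
          smul_add, smul_add, smul_zero, smul_smul lam, mul_one_div_cancel hl.ne', one_smul]
        abel) (lam * ‖w‖)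
    simp only [mul_div_cancel_left₀ _ hl.ne', zero_div, zero_mul, zero_smul, C.tr_zero, smul_smul,
      mul_assoc, mul_inv_cancel₀ h0, mul_one] at h2
    rwa [one_smul] at h2

theorem Chart.continuous_tr (C : Chart o V) : Continuous fun p : V × Y => C.tr p.1 p.2 := by
  rw [continuous_iff_continuousAt]
  rintro ⟨w, x⟩
  rw [ContinuousAt, tendsto_iff_ultrafilter]
  intro U hU
  have hw : Tendsto (fun p : V × Y => p.1) U (𝓝 w) := (continuous_fst.tendsto (w, x)).mono_left hU
  have hx : Tendsto (fun p : V × Y => p.2) U (𝓝 x) := (continuous_snd.tendsto (w, x)).mono_left hU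
  obtain ⟨e, he⟩ := exists_ultralimit U (fun (p : V × Y) (t : ℝ) => C.tr (t • p.1) p.2) x
    (fun t => 1 + |t| * (‖w‖ + 1)) fun t => by
      filter_upwards [hw.norm.eventually (gt_mem_nhds (lt_add_one ‖w‖)),
        (tendsto_iff_dist_tendsto_zero.mp hx).eventually (gt_mem_nhds one_pos)] with p h1 h2
      have h3 := dist_triangle (C.tr (t • p.1) p.2) p.2 x
      rw [dist_comm _ p.2, C.dist_tr, norm_smul, Real.norm_eq_abs] at h3
      have h4 : |t| * ‖p.1‖ ≤ |t| * (‖w‖ + 1) := by gcongr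
      linarith
  have he0 : e 0 = x := tendsto_nhds_unique (he 0) (by simpa [C.tr_zero] using hx)
  have hed : ∀ s t, dist (e s) (e t) = |s - t| * ‖w‖ := fun s t => by
    refine tendsto_nhds_unique ((he s).dist (he t)) ?_
    simp only [C.dist_tr_smul]
    exact hw.norm.const_mul _
  have heproj : ∀ t, C.proj (e t) = C.proj x + t • w := fun t => by
    have h1 := (C.continuous_proj.tendsto _).comp (he t)
    refine tendsto_nhds_unique h1 ?_
    simp only [Function.comp_def, C.proj_tr]
    exact ((C.continuous_proj.tendsto _).comp hx).add (hw.const_smul t)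
  have hlim : Tendsto (fun p : V × Y => C.tr p.1 p.2) U (𝓝 (e 1)) := by simpa using he 1
  suffices h : e 1 = C.tr w x by rwa [h] at hlim
  by_cases hw0 : w = 0
  · have := hed 1 0
    rw [he0, hw0, norm_zero, mul_zero] at this
    rw [hw0, C.tr_zero, dist_eq_zero.mp this]
  · have h0 : ‖w‖ ≠ 0 := norm_ne_zero_iff.mpr hw0
    have hiso : Isometry fun t => e (t / ‖w‖) := Isometry.of_dist_eq fun s t => by
      rw [hed, ← sub_div, abs_div, abs_norm, Real.dist_eq]; field_simp
    have h1 := C.line_eq hiso (u := ‖w‖⁻¹ • w) (by simp [heproj, he0]) ‖w‖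
    simp only [div_self h0, zero_div, he0, smul_smul, mul_inv_cancel₀ h0, one_smul] at h1
    exact h1

theorem IsInv.hasDerivAt_dist {c : ℝ → Y} (hc : Isometry c) {φ : Y → Y} (hφ : IsInv (c 0) 1 φ)
    {x : Y} (hx : x ≠ c 0) :
    HasDerivAt (fun s => dist x (c s)) (dist x (c 0) * bus c (φ x)) 0 := by
  have h0 : 0 < dist x (c 0) := dist_pos.mpr hx
  have hd : ∀ s, s ≠ 0 → dist x (c s) = dist x (c 0) * |s| * dist (φ x) (c (-1 / s)) := by
    intro s hs
    have h1 : 0 < |s| := abs_pos.mpr hs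
    rw [hφ.dist_line hc hx hs]; field_simp
  rw [hasDerivAt_iff_tendsto_slope_zero, ← nhdsLT_sup_nhdsGT, tendsto_sup]
  simp only [zero_add, smul_eq_mul]
  constructor
  · have h1 : Tendsto (fun s : ℝ => -s⁻¹) (𝓝[<] 0) atTop :=
      tendsto_neg_atBot_atTop.comp tendsto_inv_nhdsLT_zero
    refine (((tendsto_bus hc (φ x)).comp h1).const_mul (dist x (c 0))).congr' ?_
    filter_upwards [self_mem_nhdsWithin] with s hs
    have hs : s < 0 := hs
    rw [hd s hs.ne, abs_of_neg hs]
    simp only [Function.comp, neg_div, one_div]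
    have hs0 : s ≠ 0 := hs.ne
    generalize dist (φ x) (c (-s⁻¹)) = D
    field_simp
    ring
  · have h1 : Tendsto (fun s : ℝ => s⁻¹) (𝓝[>] 0) atTop := tendsto_inv_nhdsGT_zero
    have h2 := ((tendsto_bus (isometry_rev hc) (φ x)).comp h1).const_mul (-dist x (c 0))
    rw [bus_rev hc, neg_mul_neg] at h2
    refine h2.congr' ?_
    filter_upwards [self_mem_nhdsWithin] with s hs
    have hs : 0 < s := hs
    rw [hd s hs.ne', abs_of_pos hs]
    simp only [Function.comp, neg_div, one_div]
    field_simp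
    ring

theorem Chart.hasDerivAt_dist (C : Chart o V) {y : Y} {φ : Y → Y} (hφ : IsInv y 1 φ) {x : Y}
    (hx : x ≠ y) {u : V} (hu : ‖u‖ = 1) :
    HasDerivAt (fun s : ℝ => dist x (C.tr (s • u) y))
      (dist x y * inner ℝ u (C.proj (φ x) - C.proj y)) 0 := by
  have h0 : C.tr ((0 : ℝ) • u) y = y := by rw [zero_smul, C.tr_zero]
  have h := IsInv.hasDerivAt_dist (C.isometry_tr u hu y) (φ := φ) (by rwa [h0]) (x := x)
    (by rwa [h0])
  rwa [C.bus_tr u hu, h0] at h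

end ChartLemmas

section LineMetric

/-- A proper metric on the real line, inducing its usual topology, with transitive isometries and
homotheties centred at `0`. -/
structure LineMetric (ρ : ℝ → ℝ → ℝ) : Prop where
  cont : Continuous fun p : ℝ × ℝ => ρ p.1 p.2
  symm : ∀ x y, ρ x y = ρ y x
  self : ∀ x, ρ x x = 0
  pos : ∀ x y, x ≠ y → 0 < ρ x y
  tri : ∀ x y z, ρ x z ≤ ρ x y + ρ y z
  proper : ∀ r, ∃ B, ∀ x, ρ 0 x ≤ r → |x| ≤ B
  trans : ∀ x y, ∃ g : ℝ ≃ₜ ℝ, (∀ a b, ρ (g a) (g b) = ρ a b) ∧ g x = y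
  homo : ∀ c, 0 < c → ∃ g : ℝ ≃ₜ ℝ, (∀ a b, ρ (g a) (g b) = c * ρ a b) ∧ g 0 = 0

/-- Increasing similarities. -/
structure IncSim (ρ : ℝ → ℝ → ℝ) (c : ℝ) (g : ℝ ≃ₜ ℝ) : Prop where
  map : ∀ a b, ρ (g a) (g b) = c * ρ a b
  mono : StrictMono g

variable {ρ : ℝ → ℝ → ℝ}

theorem strictMono_symm {g : ℝ ≃ₜ ℝ} (hg : StrictMono g) : StrictMono g.symm := fun x y h => by
  rw [← hg.lt_iff_lt]; simpa using h

theorem strictAnti_symm {g : ℝ ≃ₜ ℝ} (hg : StrictAnti g) : StrictAnti g.symm := fun x y h => by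
  rw [← hg.lt_iff_gt]; simpa using h

theorem strictMono_or_strictAnti (g : ℝ ≃ₜ ℝ) : StrictMono g ∨ StrictAnti g :=
  g.continuous.strictMono_of_inj g.injective

theorem IncSim.trans {c d : ℝ} {g h : ℝ ≃ₜ ℝ} (hg : IncSim ρ c g) (hh : IncSim ρ d h) :
    IncSim ρ (d * c) (g.trans h) :=
  ⟨fun a b => by simp [hg.map, hh.map, mul_assoc], hh.mono.comp hg.mono⟩

theorem IncSim.symm {c : ℝ} (hc : c ≠ 0) {g : ℝ ≃ₜ ℝ} (hg : IncSim ρ c g) :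
    IncSim ρ c⁻¹ g.symm :=
  ⟨fun a b => by
    have := hg.map (g.symm a) (g.symm b)
    simp only [Homeomorph.apply_symm_apply] at this
    rw [this, inv_mul_cancel_left₀ hc], strictMono_symm hg.mono⟩

theorem LineMetric.neg (h : LineMetric ρ) : LineMetric fun x y => ρ (-x) (-y) where
  cont := h.cont.comp (by fun_prop : Continuous fun p : ℝ × ℝ => (-p.1, -p.2))
  symm _ _ := h.symm _ _
  self _ := h.self _
  pos _ _ hxy := h.pos _ _ (by simpa using hxy)
  tri _ _ _ := h.tri _ _ _
  proper r := by
    obtain ⟨B, hB⟩ := h.proper r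
    exact ⟨B, fun x hx => by simpa using hB (-x) (by simpa using hx)⟩
  trans x y := by
    obtain ⟨g, hg, hxy⟩ := h.trans (-x) (-y)
    exact ⟨((Homeomorph.neg ℝ).trans g).trans (Homeomorph.neg ℝ), by simp [hg], by simp [hxy]⟩
  homo c hc := by
    obtain ⟨g, hg, h0⟩ := h.homo c hc
    exact ⟨((Homeomorph.neg ℝ).trans g).trans (Homeomorph.neg ℝ), by simp [hg], by simp [h0]⟩

theorem LineMetric.exists_homo (h : LineMetric ρ) {c : ℝ} (hc : 0 < c) :
    ∃ g : ℝ ≃ₜ ℝ, IncSim ρ c g ∧ g 0 = 0 := by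
  obtain ⟨k, hk, k0⟩ := h.homo (Real.sqrt c) (Real.sqrt_pos.mpr hc)
  refine ⟨k.trans k, ⟨fun a b => ?_, ?_⟩, by simp [k0]⟩
  · simp only [Homeomorph.trans_apply, hk]
    rw [← mul_assoc, Real.mul_self_sqrt hc.le]
  · rcases strictMono_or_strictAnti k with h | h
    · exact h.comp h
    · exact h.comp h

theorem LineMetric.continuous_zero (h : LineMetric ρ) : Continuous (ρ 0) :=
  h.cont.comp (by fun_prop : Continuous fun x : ℝ => ((0 : ℝ), x))

theorem LineMetric.exists_gauge (h : LineMetric ρ) :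
    ∃ M : ℝ → ℝ, (∀ r, 0 ≤ r → 0 ≤ M r) ∧ (∀ r, 0 ≤ r → ρ 0 (M r) = r) ∧
      (∀ x, 0 ≤ x → M (ρ 0 x) = x) ∧ ContinuousOn M (Set.Ioi 0) ∧ MonotoneOn M (Set.Ici 0) := by
  have hf := h.continuous_zero
  have hf0 : ∀ x, 0 ≤ ρ 0 x := fun x => by
    by_cases hx : x = 0
    · rw [hx, h.self]
    · exact (h.pos _ _ (Ne.symm hx)).le
  set A : ℝ → Set ℝ := fun r => {x | 0 ≤ x ∧ ρ 0 x ≤ r} with hA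
  set M : ℝ → ℝ := fun r => sSup (A r) with hM
  have hclosed : ∀ r, IsClosed (A r) := fun r =>
    (isClosed_le continuous_const continuous_id).inter (isClosed_le hf continuous_const)
  have hbdd : ∀ r, BddAbove (A r) := fun r => by
    obtain ⟨B, hB⟩ := h.proper r
    exact ⟨B, fun x hx => (le_abs_self x).trans (hB x hx.2)⟩
  have hzero : ∀ r, 0 ≤ r → (0 : ℝ) ∈ A r := fun r hr => ⟨le_rfl, by rwa [h.self]⟩
  have hmem : ∀ r, 0 ≤ r → M r ∈ A r := fun r hr =>
    (hclosed r).csSup_mem ⟨0, hzero r hr⟩ (hbdd r)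
  have hle : ∀ r x, 0 ≤ x → ρ 0 x ≤ r → x ≤ M r := fun r x hx hr => le_csSup (hbdd r) ⟨hx, hr⟩
  have hval : ∀ r, 0 ≤ r → ρ 0 (M r) = r := fun r hr => by
    refine le_antisymm (hmem r hr).2 ?_
    by_contra hlt
    have h1 : ∀ᶠ x in 𝓝[>] (M r), ρ 0 x < r :=
      ((hf.tendsto (M r)).eventually (gt_mem_nhds (not_le.mp hlt))).filter_mono nhdsWithin_le_nhds
    obtain ⟨x, hx1, hx2⟩ := (h1.and self_mem_nhdsWithin).exists
    have hx2 : M r < x := hx2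
    exact absurd (hle r x ((hmem r hr).1.trans hx2.le) hx1.le) (not_le.mpr hx2)
  have hmono : MonotoneOn M (Set.Ici 0) := fun r hr s hs hrs =>
    hle s _ (hmem r hr).1 ((hmem r hr).2.trans hrs)
  have hscale : ∀ c r, 0 < c → 0 ≤ r → ∀ g : ℝ ≃ₜ ℝ, IncSim ρ c g → g 0 = 0 →
      M (c * r) = g (M r) := by
    intro c r hc hr g hg g0
    have hcr : 0 ≤ c * r := mul_nonneg hc.le hr
    refine le_antisymm ?_ ?_
    · have h1 : g.symm (M (c * r)) ≤ M r := by
        refine hle r _ ?_ ?_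
        · rw [← hg.mono.le_iff_le, g0]; simpa using (hmem _ hcr).1
        · have h2 := hg.map 0 (g.symm (M (c * r)))
          rw [g0, g.apply_symm_apply, hval _ hcr] at h2
          exact (mul_left_cancel₀ hc.ne' h2).ge
      have h3 := hg.mono.monotone h1
      rwa [g.apply_symm_apply] at h3
    · refine hle _ _ ?_ ?_
      · rw [← g0]; exact hg.mono.monotone (hmem r hr).1
      · have h2 := hg.map 0 (M r)
        rw [g0, hval r hr] at h2
        exact h2.le
  have hcont : ContinuousOn M (Set.Ioi 0) := by
    have hmono' : Monotone fun r => M (max r 0) := fun r s hrs =>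
      hmono (show (0 : ℝ) ≤ _ from le_max_right _ _) (show (0 : ℝ) ≤ _ from le_max_right _ _)
        (max_le_max_right 0 hrs)
    obtain ⟨r, hr0, hr⟩ : ∃ r : ℝ, 0 < r ∧ ContinuousAt (fun r => M (max r 0)) r := by
      by_contra! hcon
      have h1 : (Set.Ioi (0 : ℝ)).Countable := hmono'.countable_not_continuousAt.mono hcon
      rw [← Cardinal.le_aleph0_iff_set_countable, Cardinal.mk_Ioi_real] at h1
      exact (not_le.mpr Cardinal.aleph0_lt_continuum) h1
    have hr' : ContinuousAt M r := hr.congr (by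
      filter_upwards [lt_mem_nhds hr0] with s hs
      rw [max_eq_left hs.le])
    intro s hs
    have hs : 0 < s := hs
    refine ContinuousAt.continuousWithinAt ?_
    obtain ⟨g, hg, g0⟩ := h.exists_homo (div_pos hs hr0)
    have h2 : ContinuousAt (fun x => g (M (r / s * x))) s := by
      refine g.continuous.continuousAt.comp (ContinuousAt.comp (g := M) ?_ (by fun_prop))
      rwa [div_mul_cancel₀ _ hs.ne']
    refine h2.congr ?_
    filter_upwards [lt_mem_nhds hs] with x hx
    rw [← hscale _ _ (div_pos hs hr0) (by positivity) g hg g0]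
    congr 1
    field_simp
  refine ⟨M, fun r hr => (hmem r hr).1, hval, fun x hx => ?_, hcont, hmono⟩
  rcases hx.eq_or_lt with rfl | hx
  · rw [h.self]
    by_contra hne
    exact (h.pos _ _ (Ne.symm hne)).ne' (hval 0 le_rfl)
  obtain ⟨r, hr0, hr⟩ : ∃ r, 0 ≤ r ∧ M r = x := by
    obtain ⟨r₁, h1, h1'⟩ : ∃ r, 0 < r ∧ M r ≤ x := by
      by_contra! hcon
      obtain ⟨z, hz, hzmin⟩ := (isCompact_Icc (a := x) (b := M 1)).exists_isMinOn
        ⟨x, le_rfl, (hcon 1 one_pos).le⟩ hf.continuousOn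
      have hz0 : 0 < ρ 0 z := h.pos _ _ (hx.trans_le hz.1).ne
      have hm : 0 < min (ρ 0 z / 2) 1 := lt_min (half_pos hz0) one_pos
      have h3 := hzmin (a := M (min (ρ 0 z / 2) 1))
        ⟨(hcon _ hm).le, hmono hm.le (zero_le_one' ℝ) (min_le_right _ _)⟩
      simp only [Set.mem_ofPred_eq] at h3
      rw [hval _ hm.le] at h3
      linarith [min_le_left (ρ 0 z / 2) 1]
    have h2 : x ≤ M (ρ 0 x) := hle _ _ hx.le le_rfl
    have hle' : r₁ ≤ max r₁ (ρ 0 x) := le_max_left _ _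
    obtain ⟨r, hr, hr'⟩ := intermediate_value_Icc hle'
      (hcont.mono fun s hs => h1.trans_le hs.1) (show x ∈ _ from ⟨h1', h2.trans
        (hmono (hf0 x) (h1.le.trans hle') (le_max_right _ _))⟩)
    exact ⟨r, h1.le.trans hr.1, hr'⟩
  rw [← hr, hval r hr0]

theorem LineMetric.injOn_nonneg (h : LineMetric ρ) : Set.InjOn (ρ 0) (Set.Ici 0) := by
  obtain ⟨M, -, -, hM, -⟩ := h.exists_gauge
  intro x hx y hy hxy
  rw [← hM x hx, ← hM y hy, hxy]

theorem LineMetric.injOn_nonpos (h : LineMetric ρ) : Set.InjOn (ρ 0) (Set.Iic 0) := by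
  intro x hx y hy hxy
  have := h.neg.injOn_nonneg (show -x ∈ Set.Ici 0 by simpa using hx)
    (show -y ∈ Set.Ici 0 by simpa using hy) (by simpa using hxy)
  exact neg_injective this

theorem LineMetric.inc_eq_refl_of_zero (h : LineMetric ρ) {j : ℝ ≃ₜ ℝ} (hj : IncSim ρ 1 j)
    (h0 : j 0 = 0) (x : ℝ) : j x = x := by
  have h1 := hj.map 0 x
  rw [h0, one_mul] at h1
  rcases le_total 0 x with hx | hx
  · exact h.injOn_nonneg (by simpa [h0] using hj.mono.monotone hx) hx h1
  · exact h.injOn_nonpos (by simpa [h0] using hj.mono.monotone hx) hx h1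

theorem LineMetric.exists_inc_zero (h : LineMetric ρ) (z : ℝ) :
    ∃ g : ℝ ≃ₜ ℝ, IncSim ρ 1 g ∧ g 0 = z := by
  obtain ⟨g, hg, gz⟩ := h.trans 0 z
  rcases strictMono_or_strictAnti g with hm | ha
  · exact ⟨g, ⟨by simpa using hg, hm⟩, gz⟩
  obtain ⟨y, hy⟩ : ∃ y, g y = y := by
    have hcont : Continuous fun x => g x - x := g.continuous.sub continuous_id
    rcases le_total 0 z with hz | hz
    · have h1 : g z ≤ z := by rw [← gz]; nth_rw 2 [gz]; simpa [gz] using ha.antitone hz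
      obtain ⟨y, -, hy⟩ := intermediate_value_Icc' hz hcont.continuousOn
        (show (0 : ℝ) ∈ _ from ⟨by linarith, by rw [gz]; linarith⟩)
      exact ⟨y, by linarith [hy]⟩
    · have h1 : z ≤ g z := by simpa [gz] using ha.antitone hz
      obtain ⟨y, -, hy⟩ := intermediate_value_Icc' hz hcont.continuousOn
        (show (0 : ℝ) ∈ _ from ⟨by rw [gz]; linarith, by linarith⟩)
      exact ⟨y, by linarith [hy]⟩
  obtain ⟨t, ht, t0⟩ := h.trans 0 y
  have ht' : ∀ a b, ρ (t.symm a) (t.symm b) = ρ a b := fun a b => by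
    have := ht (t.symm a) (t.symm b)
    simpa using this.symm
  refine ⟨((t.trans g).trans t.symm).trans g, ⟨fun a b => by simp [ht, hg, ht'], ?_⟩, ?_⟩
  · rcases strictMono_or_strictAnti t with h1 | h1
    · exact ha.comp ((strictMono_symm h1).comp_strictAnti (ha.comp_strictMono h1))
    · exact ha.comp ((strictAnti_symm h1).comp_strictMono (ha.comp h1))
  · simp only [Homeomorph.trans_apply, t0, hy]
    rw [← t0, t.symm_apply_apply, gz]

end LineMetric

section LineParam

variable {ρ : ℝ → ℝ → ℝ}

theorem eq_rpow_of_mul {c : ℕ → ℝ} (h1 : c 1 = 1) (hmono : StrictMono c)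
    (hmul : ∀ m n, c (m * n) = c m * c n) :
    ∃ β : ℝ, 0 < β ∧ ∀ n : ℕ, 1 ≤ n → c n = (n : ℝ) ^ β := by
  have hpos : ∀ n : ℕ, 1 ≤ n → 0 < c n := fun n hn => by
    have := hmono.monotone hn
    rw [h1] at this
    linarith
  have hpow : ∀ n k : ℕ, c (n ^ k) = c n ^ k := fun n k => by
    induction k with
    | zero => simpa using h1
    | succ k ih => rw [pow_succ, hmul, ih, pow_succ]
  have hc2 : 0 < Real.log (c 2) := Real.log_pos (by rw [← h1]; exact hmono (by norm_num))
  have hl2 : 0 < Real.log 2 := Real.log_pos (by norm_num)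
  have key : ∀ n : ℕ, 1 ≤ n → Real.log (c n) * Real.log 2 = Real.log n * Real.log (c 2) := by
    intro n hn
    have hb : ∀ k : ℕ, k * |Real.log (c n) * Real.log 2 - Real.log n * Real.log (c 2)| ≤
        Real.log (c 2) * Real.log 2 := by
      intro k
      set m := Nat.log 2 (n ^ k) with hm
      have hnk : 1 ≤ n ^ k := Nat.one_le_pow _ _ hn
      have e1 : 2 ^ m ≤ n ^ k := Nat.pow_log_le_self 2 (by omega)
      have e2 : n ^ k ≤ 2 ^ (m + 1) := (Nat.lt_pow_succ_log_self (by norm_num) _).le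
      have f1 := Real.log_le_log (hpos _ Nat.one_le_two_pow) (hmono.monotone e1)
      have f2 := Real.log_le_log (hpos _ hnk) (hmono.monotone e2)
      have g1 : Real.log ((2 ^ m : ℕ) : ℝ) ≤ Real.log ((n ^ k : ℕ) : ℝ) :=
        Real.log_le_log (by positivity) (by exact_mod_cast e1)
      have g2 : Real.log ((n ^ k : ℕ) : ℝ) ≤ Real.log ((2 ^ (m + 1) : ℕ) : ℝ) :=
        Real.log_le_log (by exact_mod_cast hnk) (by exact_mod_cast e2)
      simp only [hpow, Real.log_pow, Nat.cast_pow, Nat.cast_add, Nat.cast_one,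
        Nat.cast_ofNat] at f1 f2 g1 g2
      rw [← Nat.abs_cast k, ← abs_mul, abs_le]
      constructor <;> nlinarith
    by_contra hne
    have hd : 0 < |Real.log (c n) * Real.log 2 - Real.log n * Real.log (c 2)| :=
      abs_pos.mpr (sub_ne_zero.mpr hne)
    obtain ⟨k, hk⟩ := exists_nat_gt
      (Real.log (c 2) * Real.log 2 / |Real.log (c n) * Real.log 2 - Real.log n * Real.log (c 2)|)
    rw [div_lt_iff₀ hd] at hk
    exact absurd (hb k) (not_le.mpr hk)
  refine ⟨Real.log (c 2) / Real.log 2, div_pos hc2 hl2, fun n hn => ?_⟩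
  have hn0 : (0 : ℝ) < n := by exact_mod_cast hn
  rw [← Real.exp_log (hpos n hn), Real.rpow_def_of_pos hn0, ← mul_div_assoc, ← key n hn,
    mul_div_cancel_right₀ _ hl2.ne']

theorem IncSim.mul {c d : ℝ} {g h : ℝ ≃ₜ ℝ} (hg : IncSim ρ c g) (hh : IncSim ρ d h) :
    IncSim ρ (c * d) (g * h) := hh.trans hg

theorem IncSim.inv {g : ℝ ≃ₜ ℝ} (hg : IncSim ρ 1 g) : IncSim ρ 1 g⁻¹ := by
  have := hg.symm one_ne_zero
  rwa [inv_one] at this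

theorem IncSim.pow {g : ℝ ≃ₜ ℝ} (hg : IncSim ρ 1 g) (n : ℕ) : IncSim ρ 1 (g ^ n) := by
  induction n with
  | zero => exact ⟨fun a b => by simp, fun a b h => by simpa using h⟩
  | succ n ih => simpa [pow_succ] using ih.mul hg

theorem LineMetric.inc_unique (h : LineMetric ρ) {g g' : ℝ ≃ₜ ℝ} (hg : IncSim ρ 1 g)
    (hg' : IncSim ρ 1 g') {x : ℝ} (hx : g x = g' x) : g = g' := by
  obtain ⟨t, ht, t0⟩ := h.exists_inc_zero x
  have h1 : IncSim ρ 1 (t⁻¹ * (g'⁻¹ * g) * t) := by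
    simpa using (ht.inv.mul (hg'.inv.mul hg)).mul ht
  have h2 : ∀ y, (t⁻¹ * (g'⁻¹ * g) * t) y = y := h.inc_eq_refl_of_zero h1 (by
    change t.symm (g'.symm (g (t 0))) = 0
    rw [t0, hx, g'.symm_apply_apply, ← t0, t.symm_apply_apply])
  have h3 : t⁻¹ * (g'⁻¹ * g) * t = 1 := by ext y; exact h2 y
  rw [mul_assoc, inv_mul_eq_one, eq_comm] at h3
  rw [mul_eq_right, inv_mul_eq_one] at h3
  exact h3.symm

theorem LineMetric.exists_param (h : LineMetric ρ) :
    ∃ (β : ℝ) (p : ℝ → ℝ), 0 < β ∧ β ≤ 1 ∧ Function.Bijective p ∧ p 0 = 0 ∧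
      ∀ a b, ρ (p a) (p b) = |a - b| ^ β := by
  obtain ⟨M, hM0, hM1, hM2, hMc, hMm⟩ := h.exists_gauge
  choose T hT T0 using h.exists_inc_zero
  have hinj := h.injOn_nonneg
  have hM00 : M 0 = 0 := by simpa [h.self] using hM2 0 le_rfl
  have hstrict : ∀ x y, 0 ≤ x → x < y → ρ 0 x < ρ 0 y := fun x y hx hxy => by
    by_contra hcon
    have h0 : 0 ≤ ρ 0 y := (h.pos _ _ (hx.trans_lt hxy).ne).le
    have h1 := hMm h0 (h0.trans (not_lt.mp hcon)) (not_lt.mp hcon)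
    rw [hM2 x hx, hM2 y (hx.trans hxy.le)] at h1
    linarith
  have hx1 : 0 < M 1 := lt_of_le_of_ne (hM0 1 zero_le_one) fun he => by
    have := hM1 1 zero_le_one
    rw [← he, h.self] at this
    exact zero_ne_one this
  set τ := T (M 1) with hτ
  have hτp := fun n : ℕ => (hT (M 1)).pow n
  set x : ℕ → ℝ := fun n => (τ ^ n) 0 with hx
  have x0 : x 0 = 0 := by simp [hx]
  have x1 : x 1 = M 1 := by simp [hx, hτ, T0]
  have hxm : StrictMono x := strictMono_nat_of_lt_succ fun n => by
    simp only [hx, pow_succ, Homeomorph.mul_apply]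
    exact (hτp n).mono (by rw [hτ, T0]; exact hx1)
  have hxn : ∀ n, 0 ≤ x n := fun n => by rw [← x0]; exact hxm.monotone (Nat.zero_le n)
  set c : ℕ → ℝ := fun n => ρ 0 (x n) with hc
  have hcm : StrictMono c := fun m n hmn => hstrict _ _ (hxn m) (hxm hmn)
  have hc0 : c 0 = 0 := by simp [hc, x0, h.self]
  have hc1 : c 1 = 1 := by simp [hc, x1, hM1]
  have hscale : ∀ (l : ℝ) (g : ℝ ≃ₜ ℝ), IncSim ρ l g → g 0 = 0 → ∀ y, 0 ≤ y → ∀ z, 0 ≤ z →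
      ρ 0 z = l * ρ 0 y → g y = z := fun l g hg g0 y hy z hz hyz => by
    refine hinj (by simpa [g0] using hg.mono.monotone hy) hz ?_
    rw [hyz, ← hg.map, g0]
  have hmul : ∀ m n, c (m * n) = c m * c n := fun m n => by
    rcases Nat.eq_zero_or_pos m with rfl | hm
    · simp [hc0]
    have hcp : 0 < c m := by rw [← hc0]; exact hcm hm
    obtain ⟨g, hg, g0⟩ := h.exists_homo hcp
    have e1 : g (M 1) = x m := hscale _ g hg g0 _ hx1.le _ (hxn m) (by simp [hc, hM1])
    have e2 : IncSim ρ 1 (g * τ * g⁻¹) := by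
      have := (hg.mul (hT (M 1))).mul (hg.symm hcp.ne')
      rwa [mul_one, mul_inv_cancel₀ hcp.ne'] at this
    have g0' : g⁻¹ 0 = 0 := by
      change g.symm 0 = 0
      rw [Homeomorph.symm_apply_eq, g0]
    have e3 : g * τ * g⁻¹ = τ ^ m := h.inc_unique e2 (hτp m) (x := 0) (by
      simp only [Homeomorph.mul_apply, g0', hτ, T0, e1]; rfl)
    have e4 : x (m * n) = g (x n) := by
      simp only [hx, pow_mul, ← e3, conj_pow, Homeomorph.mul_apply, g0']
    simp only [hc, e4]
    nth_rw 1 [← g0]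
    rw [hg.map]
  obtain ⟨β, hβ, hcβ'⟩ := eq_rpow_of_mul hc1 hcm hmul
  have hcβ : ∀ n : ℕ, c n = (n : ℝ) ^ β := fun n => by
    rcases Nat.eq_zero_or_pos n with rfl | hn
    · simp [hc0, Real.zero_rpow hβ.ne']
    · exact hcβ' n hn
  have hdx : ∀ m n, ρ (x m) (x (m + n)) = (n : ℝ) ^ β := fun m n => by
    simp only [hx, pow_add, Homeomorph.mul_apply]
    rw [(hτp m).map, one_mul, ← hcβ]
  have hβ1 : β ≤ 1 := by
    have e1 := h.tri (x 0) (x 1) (x 2)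
    rw [hdx 0 1, hdx 1 1, show x 2 = x (0 + 2) from rfl, hdx 0 2] at e1
    have e2 : (2 : ℝ) ^ β ≤ 2 ^ (1 : ℝ) := by
      rw [Real.rpow_one]; simpa [one_add_one_eq_two] using e1
    exact (Real.rpow_le_rpow_left_iff (by norm_num)).mp e2
  have hdx' : ∀ m n : ℕ, ρ (x m) (x n) = |(m : ℝ) - n| ^ β := fun m n => by
    rcases le_total m n with hmn | hmn
    · obtain ⟨k, rfl⟩ := Nat.exists_eq_add_of_le hmn
      rw [hdx]; simp
    · obtain ⟨k, rfl⟩ := Nat.exists_eq_add_of_le hmn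
      rw [h.symm, hdx]; simp
  set q : ℝ → ℝ := fun a => M (a ^ β) with hq
  have hq0 : ∀ a, 0 ≤ a → 0 ≤ q a := fun a ha => hM0 _ (Real.rpow_nonneg ha β)
  have hq1 : ∀ a, 0 ≤ a → ρ 0 (q a) = a ^ β := fun a ha => hM1 _ (Real.rpow_nonneg ha β)
  have q0 : q 0 = 0 := by simp [hq, Real.zero_rpow hβ.ne', hM00]
  have hqm : ∀ a b, 0 ≤ a → a ≤ b → q a ≤ q b := fun a b ha hab =>
    hMm (Real.rpow_nonneg ha β) (Real.rpow_nonneg (ha.trans hab) β)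
      (Real.rpow_le_rpow ha hab hβ.le)
  have hqc : ∀ a, 0 < a → ContinuousAt q a := fun a ha =>
    ContinuousAt.comp (g := M) (hMc.continuousAt (Ioi_mem_nhds (Real.rpow_pos_of_pos ha β)))
      (Real.continuousAt_rpow_const _ _ (Or.inl ha.ne'))
  have hrat : ∀ N m n : ℕ, 0 < N → ρ (q (m / N)) (q (n / N)) = |(m / N : ℝ) - n / N| ^ β := by
    intro N m n hN
    have hN' : (0 : ℝ) < N := by exact_mod_cast hN
    obtain ⟨g, hg, g0⟩ := h.exists_homo (inv_pos.mpr (Real.rpow_pos_of_pos hN' β))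
    have e : ∀ k : ℕ, g (x k) = q (k / N) := fun k =>
      hscale _ g hg g0 _ (hxn k) _ (hq0 _ (by positivity)) (by
        change _ = _ * c k
        rw [hq1 _ (by positivity), hcβ, Real.div_rpow (by positivity) hN'.le, div_eq_inv_mul])
    rw [← e, ← e, hg.map, hdx', ← sub_div, abs_div, abs_of_pos hN',
      Real.div_rpow (abs_nonneg _) hN'.le, div_eq_inv_mul]
  have hqd : ∀ a b, 0 ≤ a → 0 ≤ b → ρ (q a) (q b) = |a - b| ^ β := by
    intro a b ha hb
    rcases ha.eq_or_lt with rfl | ha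
    · rw [q0, hq1 b hb, zero_sub, abs_neg, abs_of_nonneg hb]
    rcases hb.eq_or_lt with rfl | hb
    · rw [q0, h.symm, hq1 a ha.le, sub_zero, abs_of_pos ha]
    have ta := (tendsto_nat_floor_mul_div_atTop (R := ℝ) ha.le).comp tendsto_natCast_atTop_atTop
    have tb := (tendsto_nat_floor_mul_div_atTop (R := ℝ) hb.le).comp tendsto_natCast_atTop_atTop
    have t1 := (h.cont.tendsto (q a, q b)).comp
      (((hqc a ha).tendsto.comp ta).prodMk_nhds ((hqc b hb).tendsto.comp tb))
    have t2 := ((ta.sub tb).abs).rpow_const (p := β) (Or.inr hβ.le)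
    refine tendsto_nhds_unique t1 (t2.congr' ?_)
    filter_upwards [eventually_gt_atTop 0] with N hN
    exact (hrat N _ _ hN).symm
  have hadd : ∀ a b, 0 ≤ a → 0 ≤ b → T (q a) (q b) = q (a + b) := by
    intro a b ha hb
    suffices hs : q b = (T (q a)).symm (q (a + b)) by rw [hs, Homeomorph.apply_symm_apply]
    have e0 : (T (q a)).symm (q a) = 0 := by rw [Homeomorph.symm_apply_eq, T0]
    refine hinj (hq0 b hb) ?_ ?_
    · rw [Set.mem_Ici, ← e0]
      exact (strictMono_symm (hT (q a)).mono).monotone (hqm _ _ ha (by linarith))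
    · have e1 := ((hT (q a)).symm one_ne_zero).map (q a) (q (a + b))
      rw [e0, hqd _ _ ha (by positivity), inv_one, one_mul] at e1
      rw [hq1 b hb, e1, sub_add_cancel_left, abs_neg, abs_of_nonneg hb]
  have hTadd : ∀ a b, 0 ≤ a → 0 ≤ b → T (q a) * T (q b) = T (q (a + b)) := by
    intro a b ha hb
    refine h.inc_unique (x := 0) (by simpa using (hT (q a)).mul (hT (q b))) (hT _) ?_
    rw [Homeomorph.mul_apply, T0, T0, hadd a b ha hb]
  set p : ℝ → ℝ := fun a => (T (q |a|)).symm (q (a + |a|)) with hp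
  have hshift : ∀ a N K, 0 ≤ N → 0 ≤ K → 0 ≤ a + N →
      (T (q N)).symm (q (a + N)) = (T (q (N + K))).symm (q (a + (N + K))) := by
    intro a N K hN hK haN
    refine ((Homeomorph.symm_apply_eq _).mpr ?_).symm
    rw [add_comm N K, ← hTadd K N hK hN, Homeomorph.mul_apply,
      Homeomorph.apply_symm_apply, hadd _ _ hK haN]
    congr 1; ring
  have hpN : ∀ a N, 0 ≤ N → 0 ≤ a + N → p a = (T (q N)).symm (q (a + N)) := by
    intro a N hN haN
    rw [hp]
    simp only
    rw [hshift a |a| N (abs_nonneg a) hN (by linarith [neg_abs_le a]),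
      hshift a N |a| hN (abs_nonneg a) haN, add_comm N]
  have hpd : ∀ a b, ρ (p a) (p b) = |a - b| ^ β := by
    intro a b
    have ha := neg_abs_le a
    have hb := neg_abs_le b
    have ha' := abs_nonneg a
    have hb' := abs_nonneg b
    rw [hpN a (|a| + |b|) (by linarith) (by linarith), hpN b (|a| + |b|) (by linarith)
      (by linarith), ((hT _).symm one_ne_zero).map, hqd _ _ (by linarith) (by linarith), inv_one,
      one_mul]
    congr 2; ring
  have hqs : ∀ z, 0 ≤ z → ∃ a, 0 ≤ a ∧ q a = z := fun z hz => by
    have hz0 : 0 ≤ ρ 0 z := by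
      rcases hz.eq_or_lt with rfl | hz
      · rw [h.self]
      · exact (h.pos _ _ hz.ne).le
    refine ⟨(ρ 0 z) ^ β⁻¹, Real.rpow_nonneg hz0 _, ?_⟩
    simp only [hq]
    rw [Real.rpow_inv_rpow hz0 hβ.ne', hM2 z hz]
  have hT0 : T (q 0) = 1 := by
    refine h.inc_unique (x := 0) (hT _) ?_ ?_
    · simpa using (hT (M 1)).pow 0
    · rw [T0, q0]; rfl
  have hpq : ∀ a, 0 ≤ a → p a = q a := fun a ha => by
    rw [hpN a 0 le_rfl (by simpa using ha), hT0, add_zero]; rfl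
  refine ⟨β, p, hβ, hβ1, ⟨fun a b hab => ?_, fun z => ?_⟩, by rw [hpq 0 le_rfl, q0], hpd⟩
  · have e := hpd a b
    rw [hab, h.self, eq_comm, Real.rpow_eq_zero (abs_nonneg _) hβ.ne', abs_eq_zero,
      sub_eq_zero] at e
    exact e
  · rcases le_total 0 z with hz | hz
    · obtain ⟨a, ha, rfl⟩ := hqs z hz
      exact ⟨a, hpq a ha⟩
    · have e0 : (T z).symm z = 0 := by rw [Homeomorph.symm_apply_eq, T0]
      obtain ⟨N, hN, hN'⟩ := hqs ((T z).symm 0) (by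
        have := (strictMono_symm (hT z).mono).monotone hz
        rwa [e0] at this)
      refine ⟨-N, ?_⟩
      rw [hpN (-N) N hN (by simp), neg_add_cancel, q0, Homeomorph.symm_apply_eq]
      have e1 : T (q N) = (T z)⁻¹ := h.inc_unique (x := 0) (hT _) (hT z).inv (by
        rw [T0, hN']; rfl)
      rw [e1]
      exact e0.symm

end LineParam

section FiberParam

theorem continuous_of_scale {A B : Type*} [PseudoMetricSpace A] [PseudoMetricSpace B] {l : ℝ}
    (hl : 0 < l) {f : A → B} (hf : ∀ x y, dist (f x) (f y) = l * dist x y) : Continuous f :=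
  (LipschitzWith.of_dist_le_mul (K := ⟨l, hl.le⟩) fun x y => (hf x y).le).continuous

theorem scale_symm {A : Type*} [PseudoMetricSpace A] {l : ℝ} (hl : 0 < l) {g : A ≃ A}
    (hg : ∀ x y, dist (g x) (g y) = l * dist x y) (x y : A) :
    dist (g.symm x) (g.symm y) = l⁻¹ * dist x y := by
  have := hg (g.symm x) (g.symm y)
  simp only [Equiv.apply_symm_apply] at this
  rw [this, inv_mul_cancel_left₀ hl.ne']

theorem exists_homeomorph_of_scale {A : Type*} [PseudoMetricSpace A] {l : ℝ} (hl : 0 < l)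
    {g : A ≃ A} (hg : ∀ x y, dist (g x) (g y) = l * dist x y) : ∃ h : A ≃ₜ A, ∀ x, h x = g x :=
  ⟨⟨g, continuous_of_scale hl hg, continuous_of_scale (inv_pos.mpr hl) (scale_symm hl hg)⟩,
    fun _ => rfl⟩

theorem exists_snowflake_param {F : Type*} [MetricSpace F] [ProperSpace F] (e : F ≃ₜ ℝ) (o : F)
    (htrans : ∀ x y : F, ∃ g : F ≃ F, (∀ a b, dist (g a) (g b) = dist a b) ∧ g x = y)
    (hhomo : ∀ l : ℝ, 0 < l → ∃ g : F ≃ F, (∀ a b, dist (g a) (g b) = l * dist a b) ∧ g o = o) :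
    ∃ (β : ℝ) (p : ℝ → F), 0 < β ∧ β ≤ 1 ∧ Function.Bijective p ∧ p 0 = o ∧
      ∀ a b, dist (p a) (p b) = |a - b| ^ β := by
  set E : F ≃ₜ ℝ := e.trans (Homeomorph.addRight (-e o)) with hE
  have hEo : E o = 0 := by simp [hE]
  have hEo' : E.symm 0 = o := by rw [Homeomorph.symm_apply_eq, hEo]
  have hL : LineMetric fun x y => dist (E.symm x) (E.symm y) := by
    refine ⟨by fun_prop, fun x y => dist_comm _ _, fun x => dist_self _, fun x y hxy =>
      dist_pos.mpr (E.symm.injective.ne hxy), fun x y z => dist_triangle _ _ _, fun r => ?_,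
      fun x y => ?_, fun c hc => ?_⟩
    · obtain ⟨B, hB⟩ := ((isCompact_closedBall o r).image E.continuous).isBounded.exists_norm_le
      refine ⟨B, fun x hx => hB x ⟨E.symm x, ?_, E.apply_symm_apply x⟩⟩
      rwa [hEo', dist_comm] at hx
    · obtain ⟨g, hg, hxy⟩ := htrans (E.symm x) (E.symm y)
      obtain ⟨h, hh⟩ := exists_homeomorph_of_scale one_pos (g := g) (by simpa using hg)
      exact ⟨(E.symm.trans h).trans E, by simp [hh, hg], by simp [hh, hxy]⟩
    · obtain ⟨g, hg, hxy⟩ := hhomo c hc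
      obtain ⟨h, hh⟩ := exists_homeomorph_of_scale hc hg
      exact ⟨(E.symm.trans h).trans E, by simp [hh, hg], by simp [hh, hxy, hEo', hEo]⟩
  obtain ⟨β, p, hβ, hβ1, hp, p0, hd⟩ := hL.exists_param
  exact ⟨β, fun a => E.symm (p a), hβ, hβ1, E.symm.bijective.comp hp, by simp only [p0, hEo'], hd⟩

variable {Y : Type*} [MetricSpace Y] [InvSpace Y] {o : Y} {V : Type*} [NormedAddCommGroup V]
  [InnerProductSpace ℝ V]

theorem Chart.fiber_eq (C : Chart o V) :
    {y : Y | ∀ c : ℝ → Y, Isometry c → bus c y = bus c o} = {y | C.proj y = 0} := by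
  ext y
  simp only [Set.mem_ofPred_eq]
  constructor
  · intro h
    refine eq_of_inner_unit fun u hu => ?_
    have := h _ (C.isometry_tr u hu o)
    rwa [C.bus_tr u hu, C.bus_tr u hu, C.proj_base, sub_zero, sub_zero] at this
  · intro h c hc
    obtain ⟨u, hu, hcu⟩ := C.exists_dir c hc
    have : c = fun t => C.tr (t • u) (c 0) := funext hcu
    rw [this, C.bus_tr u hu, C.bus_tr u hu, h, C.proj_base]

/-- The restriction to the base fibre of a similarity preserving it. -/
theorem Chart.exists_restrict (C : Chart o V) {l : ℝ} (hl : 0 < l) {g : Y ≃ Y} (hg : IsSim l g)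
    (h0 : C.proj (g o) = 0) :
    ∃ h : {y // C.proj y = 0} ≃ {y // C.proj y = 0}, ∀ x, (h x : Y) = g x := by
  refine ⟨g.subtypeEquiv fun x => ?_, fun x => rfl⟩
  rw [C.proj_sim hg, h0, add_zero, smul_eq_zero, or_iff_right hl.ne']

theorem Chart.exists_fiber_param (C : Chart o V) (e : {y // C.proj y = 0} ≃ₜ ℝ) :
    ∃ (β : ℝ) (p : ℝ → Y), 0 < β ∧ β ≤ 1 ∧ p 0 = o ∧ (∀ a, C.proj (p a) = 0) ∧
      (∀ y, C.proj y = 0 → ∃ a, p a = y) ∧ ∀ a b, dist (p a) (p b) = |a - b| ^ β := by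
  have hcl : IsClosed {y | C.proj y = 0} := isClosed_eq C.continuous_proj continuous_const
  have : ProperSpace {y // C.proj y = 0} := ProperSpace.of_isClosed hcl
  obtain ⟨β, p, hβ, hβ1, hp, p0, hd⟩ := exists_snowflake_param e ⟨o, C.proj_base⟩
    (fun x y => by
      obtain ⟨g, hg, hxy⟩ := exists_shift x.1 y.1
      have h0 := C.proj_sim hg x.1
      rw [hxy, x.2, y.2, smul_zero, zero_add] at h0
      obtain ⟨h, hh⟩ := C.exists_restrict one_pos hg h0.symm
      exact ⟨h, fun a b => by simp [Subtype.dist_eq, hh, hg.dist_map], Subtype.ext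
        (by rw [hh, hxy])⟩)
    (fun l hl => by
      obtain ⟨g, hg⟩ := exists_hom o hl
      obtain ⟨h, hh⟩ := C.exists_restrict hl (hg.isSim hl) (by rw [hg.map_center, C.proj_base])
      exact ⟨h, fun a b => by simp [Subtype.dist_eq, hh, hg.dist_map],
        Subtype.ext (by rw [hh, hg.map_center])⟩)
  refine ⟨β, fun a => p a, hβ, hβ1, by simp only [p0], fun a => (p a).2, fun y hy => ?_, hd⟩
  obtain ⟨a, ha⟩ := hp.2 ⟨y, hy⟩
  exact ⟨a, by simp only [ha]⟩

end FiberParam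

section Coordinates

theorem eq_of_abs_sub_eq {f : ℝ → ℝ} {L : ℝ} (hf : ∀ a b, |f a - f b| = L * |a - b|) :
    (∀ a, f a = L * a + f 0) ∨ ∀ a, f a = -(L * a) + f 0 := by
  have h1 := hf 1 0
  have hL : 0 ≤ L := by
    have := abs_nonneg (f 1 - f 0)
    rw [h1] at this
    simpa using this
  rw [sub_zero, abs_one, mul_one] at h1
  have key : ∀ a, (f a - f 0) * (f 1 - f 0) = L ^ 2 * a := fun a => by
    have ha := congrArg (· ^ 2) (hf a 0)
    have ha1 := congrArg (· ^ 2) (hf a 1)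
    have h11 := congrArg (· ^ 2) h1
    simp only [sub_zero, mul_pow, sq_abs] at ha ha1 h11
    nlinarith
  rcases hL.eq_or_lt with h0 | hL
  · left
    intro a
    have := hf a 0
    rw [← h0, zero_mul, abs_eq_zero] at this
    rw [← h0]; linarith
  · rcases abs_choice (f 1 - f 0) with h2 | h2
    · left; intro a
      have := key a
      rw [← h2, h1, pow_two, mul_comm, mul_assoc] at this
      linarith [mul_left_cancel₀ hL.ne' this]
    · right; intro a
      have := key a
      rw [show f 1 - f 0 = -L by linarith, pow_two, mul_neg, mul_comm, mul_assoc, ← mul_neg] at this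
      linarith [mul_left_cancel₀ hL.ne' this]

variable {Y : Type*} [MetricSpace Y] [InvSpace Y] {o : Y} {V : Type*} [NormedAddCommGroup V]
  [InnerProductSpace ℝ V]

/-- A parametrization of the base fibre as a snowflake line. -/
structure FiberParam (C : Chart o V) (α : ℝ) (p : ℝ → Y) : Prop where
  one_le : 1 ≤ α
  zero : p 0 = o
  proj : ∀ a, C.proj (p a) = 0
  surj : ∀ y, C.proj y = 0 → ∃ a, p a = y
  dist : ∀ a b, dist (p a) (p b) = |a - b| ^ α⁻¹

variable {C : Chart o V} {α : ℝ} {p : ℝ → Y}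

theorem FiberParam.pos (P : FiberParam C α p) : 0 < α := one_pos.trans_le P.one_le

theorem FiberParam.abs_sub (P : FiberParam C α p) (a b : ℝ) :
    |a - b| = (Dist.dist (p a) (p b)) ^ α := by
  rw [P.dist, Real.rpow_inv_rpow (abs_nonneg _) P.pos.ne']

theorem FiberParam.inj (P : FiberParam C α p) {a b : ℝ} (h : p a = p b) : a = b := by
  have := P.abs_sub a b
  rw [h, dist_self, Real.zero_rpow P.pos.ne', abs_eq_zero, sub_eq_zero] at this
  exact this

theorem FiberParam.continuous (P : FiberParam C α p) : Continuous p := by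
  rw [continuous_iff_continuousAt]
  intro a
  rw [ContinuousAt, tendsto_iff_dist_tendsto_zero]
  simp only [P.dist]
  have h1 : Tendsto (fun x : ℝ => |x - a|) (𝓝 a) (𝓝 0) := by
    have : Continuous fun x : ℝ => |x - a| := by fun_prop
    simpa using this.tendsto a
  have h2 := h1.rpow_const (p := α⁻¹) (Or.inr (inv_nonneg.mpr P.pos.le))
  rwa [Real.zero_rpow (inv_pos.mpr P.pos).ne'] at h2

theorem FiberParam.continuous_of_comp (P : FiberParam C α p) {Z : Type*} [TopologicalSpace Z]
    {f : Z → ℝ} (hf : Continuous fun z => p (f z)) : Continuous f := by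
  rw [continuous_iff_continuousAt]
  intro z
  rw [ContinuousAt, tendsto_iff_dist_tendsto_zero]
  simp only [Real.dist_eq, P.abs_sub]
  have h1 := tendsto_iff_dist_tendsto_zero.mp (hf.tendsto z)
  have h2 := h1.rpow_const (p := α) (Or.inr P.pos.le)
  rwa [Real.zero_rpow P.pos.ne'] at h2

theorem FiberParam.one_lt (P : FiberParam C α p) : 1 < α := by
  refine lt_of_le_of_ne P.one_le fun h1 => ?_
  have hiso : Isometry p := Isometry.of_dist_eq fun a b => by
    rw [P.dist, ← h1, inv_one, Real.rpow_one, Real.dist_eq]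
  obtain ⟨u, hu, h⟩ := C.exists_dir p hiso
  have h2 := congrArg C.proj (h 1)
  rw [C.proj_tr, P.proj, P.proj, zero_add, one_smul] at h2
  rw [← h2, norm_zero] at hu
  exact zero_ne_one hu

theorem FiberParam.sim_apply (P : FiberParam C α p) {l : ℝ} (hl : 0 < l) {g : Y ≃ Y}
    (hg : IsSim l g) {b : ℝ} (hb : g o = p b) :
    (∀ a, g (p a) = p (l ^ α * a + b)) ∨ ∀ a, g (p a) = p (-(l ^ α * a) + b) := by
  have h1 : ∀ a, ∃ a', p a' = g (p a) := fun a => P.surj _ (by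
    rw [C.proj_sim hg, P.proj, hb, P.proj, smul_zero, zero_add])
  choose f hf using h1
  have hf0 : f 0 = b := P.inj (by rw [hf, P.zero, hb])
  have h2 : ∀ a b, |f a - f b| = l ^ α * |a - b| := fun a b => by
    rw [P.abs_sub, hf, hf, hg.dist_map, Real.mul_rpow hl.le dist_nonneg, ← P.abs_sub]
  rcases eq_of_abs_sub_eq h2 with h | h
  · left; intro a; rw [← hf, h, hf0]
  · right; intro a; rw [← hf, h, hf0]

theorem FiberParam.exists_translation (P : FiberParam C α p) (b : ℝ) :
    ∃ g : Y ≃ Y, IsSim 1 g ∧ ∀ a, g (p a) = p (a + b) := by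
  obtain ⟨g, hg, hgo⟩ := exists_shift o (p (b / 2))
  obtain ⟨k, hk, hko⟩ := exists_shift o (p (-(b / 2)))
  have hg' := P.sim_apply one_pos hg hgo
  have hk' := P.sim_apply one_pos hk hko
  simp only [Real.one_rpow, one_mul] at hg' hk'
  rcases hg' with h1 | h1
  · refine ⟨g.trans g, by simpa using hg.trans hg, fun a => ?_⟩
    simp only [Equiv.trans_apply, h1]
    congr 1; ring
  rcases hk' with h2 | h2
  · refine ⟨(k.trans k).symm, ?_, fun a => ?_⟩
    · have : IsSim 1 (k.trans k) := by simpa using hk.trans hk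
      simpa using this.symm one_pos
    · rw [Equiv.symm_apply_eq]
      simp only [Equiv.trans_apply, h2]
      congr 1; ring
  · refine ⟨k.trans g, by simpa using hk.trans hg, fun a => ?_⟩
    simp only [Equiv.trans_apply, h1, h2]
    congr 1; ring

theorem FiberParam.exists_homothety (P : FiberParam C α p) {φ : Y → Y} (hφ : IsInv o 1 φ) {l : ℝ}
    (hl : 0 < l) : ∃ g : Y ≃ Y, IsSim l g ∧ g o = o ∧ (∀ a, g (p a) = p (l ^ α * a)) ∧
      ∀ x, φ (g (φ x)) = g.symm x := by
  have hs := Real.sqrt_pos.mpr hl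
  obtain ⟨k, hk, hkφ⟩ := hφ.exists_hom hs
  have hk1 := hk.isSim hs
  have hpow : Real.sqrt l ^ α * Real.sqrt l ^ α = l ^ α := by
    rw [← Real.mul_rpow hs.le hs.le, Real.mul_self_sqrt hl.le]
  refine ⟨k.trans k, ?_, by simp [hk.map_center], fun a => ?_, fun x => ?_⟩
  · have := hk1.trans hk1
    rwa [Real.mul_self_sqrt hl.le] at this
  · have h1 := P.sim_apply hs hk1 (b := 0) (by rw [hk.map_center, P.zero])
    simp only [add_zero] at h1
    rcases h1 with h1 | h1
    · simp only [Equiv.trans_apply, h1]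
      rw [← mul_assoc, hpow]
    · simp only [Equiv.trans_apply, h1]
      rw [mul_neg, neg_neg, ← mul_assoc, hpow]
  · simp only [Equiv.trans_apply, Equiv.symm_trans_apply]
    rw [← hkφ, ← hkφ, hφ.invol]

theorem eq_of_nat_rpow_mul_le {β x K : ℝ} (hβ : 0 < β) (hx : 0 ≤ x)
    (h : ∀ n : ℕ, (n : ℝ) ^ β * x ≤ K) : x = 0 := by
  by_contra hne
  have hx : 0 < x := lt_of_le_of_ne hx (Ne.symm hne)
  obtain ⟨n, hn⟩ := (((tendsto_rpow_atTop hβ).comp tendsto_natCast_atTop_atTop).eventually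
    (eventually_gt_atTop (K / x))).exists
  simp only [Function.comp] at hn
  rw [div_lt_iff₀ hx] at hn
  exact absurd (h n) (not_le.mpr hn)

theorem FiberParam.exists_transversal (P : FiberParam C α p) (w : V) :
    ∃ g : Y ≃ Y, IsSim 1 g ∧ ∀ a, g (p a) = C.tr w (p a) := by
  choose T hT hTp using P.exists_translation
  have key : ∀ v : V, ∃ g : Y ≃ Y, IsSim 1 g ∧ ((∀ a, g (p a) = C.tr v (p a)) ∨
      ∀ a, g (p a) = C.tr v (p (-a))) := by
    intro v
    obtain ⟨g, hg, hgo⟩ := exists_shift o (C.tr v o)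
    have hproj : C.proj (g o) = v := by rw [hgo, C.proj_tr, C.proj_base, zero_add]
    have h1 : ∀ a, ∃ a', p a' = C.tr (-v) (g (p a)) := fun a => P.surj _ (by
      rw [C.proj_tr, C.proj_sim hg, P.proj, hproj, smul_zero, zero_add, add_neg_cancel])
    choose f hf using h1
    have hf' : ∀ a, g (p a) = C.tr v (p (f a)) := fun a => by rw [hf, C.tr_tr_neg]
    have hconj : ∀ b, ∃ s : Y ≃ Y, IsSim 1 s ∧ ∀ a, g (p (a + b)) = s (g (p a)) := fun b =>
      ⟨(g.symm.trans (T b)).trans g, by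
        simpa using ((hg.symm one_pos).trans (hT b)).trans hg, fun a => by simp [hTp]⟩
    have hadd : ∀ a b, f (a + b) = f a + f b := by
      have hshift : ∀ b, (∀ a, f (a + b) = f a + f b) ∨ ∀ a, f (a + b) = - f a + f b := by
        intro b
        obtain ⟨s, hs, hsg⟩ := hconj b
        have h2 : ∀ a, s (p (f a)) = p (f (a + b)) := fun a => by
          have := hsg a
          rw [hf', hf', C.sim_tr one_pos hs, one_smul] at this
          rw [← C.tr_neg_tr v (p (f (a + b))), this, C.tr_neg_tr]
        have hf0 : f 0 = 0 := P.inj (by rw [hf, P.zero, hgo, C.tr_neg_tr])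
        have h3 : s o = p (f b) := by rw [← P.zero, ← hf0, h2, zero_add]
        have h4 := P.sim_apply one_pos hs h3
        simp only [Real.one_rpow, one_mul] at h4
        rcases h4 with h4 | h4
        · left; intro a; exact P.inj (by rw [← h2, h4])
        · right; intro a; exact P.inj (by rw [← h2, h4])
      have hf0 : f 0 = 0 := P.inj (by rw [hf, P.zero, hgo, C.tr_neg_tr])
      have hinj : ∀ a b, f a = f b → a = b := fun a b h => P.inj (g.injective (by
        rw [hf', hf', h]))
      intro a b
      rcases hshift b with h | h
      · exact h a
      · by_cases hb : b = 0
        · simp [hb, hf0]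
        · have h5 := h (-b)
          rw [neg_add_cancel, hf0] at h5
          exact absurd (hinj _ _ (show f b = f (-b) by linarith)) fun h6 => hb (by linarith)
    have hβ : 0 < α⁻¹ := inv_pos.mpr P.pos
    have hbd : ∀ a, |(|f a| ^ α⁻¹ - |a| ^ α⁻¹)| ≤ 2 * ‖v‖ := by
      intro a
      have hf0 : f 0 = 0 := P.inj (by rw [hf, P.zero, hgo, C.tr_neg_tr])
      have e1 := P.dist (f a) 0
      have e2 := P.dist a 0
      rw [sub_zero, P.zero] at e1 e2
      rw [← hg.isometry.dist_eq, hf', hgo] at e2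
      have t1 := dist_triangle4 (p (f a)) (C.tr v (p (f a))) (C.tr v o) o
      have t2 := dist_triangle4 (C.tr v (p (f a))) (p (f a)) o (C.tr v o)
      rw [dist_comm _ (p (f a)), C.dist_tr, C.dist_tr] at t2
      rw [dist_comm (C.tr v o) o, C.dist_tr, C.dist_tr] at t1
      rw [← e1, ← e2, abs_le]
      constructor <;> linarith
    have habs : ∀ a, |f a| = |a| := by
      intro a
      have hn : ∀ n : ℕ, f (n * a) = n * f a := fun n => by
        induction n with
        | zero =>
          have := hadd 0 0
          simp only [add_zero, left_eq_add] at this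
          simpa using this
        | succ n ih => rw [Nat.cast_succ, add_mul, add_mul, hadd, ih, one_mul, one_mul]
      have h6 := eq_of_nat_rpow_mul_le (x := |(|f a| ^ α⁻¹ - |a| ^ α⁻¹)|) hβ (abs_nonneg _)
        (K := 2 * ‖v‖) fun n => by
          have := hbd (n * a)
          rw [hn, abs_mul, abs_mul, Nat.abs_cast, Real.mul_rpow (Nat.cast_nonneg _) (abs_nonneg _),
            Real.mul_rpow (Nat.cast_nonneg _) (abs_nonneg _), ← mul_sub, abs_mul,
            abs_of_nonneg (Real.rpow_nonneg (Nat.cast_nonneg n) _)] at this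
          exact this
      rw [abs_eq_zero, sub_eq_zero] at h6
      exact (Real.rpow_left_inj (abs_nonneg _) (abs_nonneg _) hβ.ne').mp h6
    have hsub : ∀ a b, f a - f b = f (a - b) := fun a b => by
      have := hadd (a - b) b
      rw [sub_add_cancel] at this
      linarith
    have hf0 : f 0 = 0 := by simpa using hadd 0 0
    refine ⟨g, hg, ?_⟩
    rcases eq_of_abs_sub_eq (f := f) (L := 1) (fun a b => by rw [hsub, habs, one_mul]) with h | h
    · left; intro a; rw [hf', h, hf0, one_mul, add_zero]
    · right; intro a; rw [hf', h, hf0, one_mul, add_zero]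
  obtain ⟨g, hg, h⟩ := key ((2 : ℝ)⁻¹ • w)
  have hw : ∀ x, C.tr ((2 : ℝ)⁻¹ • w) (C.tr ((2 : ℝ)⁻¹ • w) x) = C.tr w x := fun x => by
    rw [C.tr_smul]; norm_num
  refine ⟨g.trans g, by simpa using hg.trans hg, fun a => ?_⟩
  rcases h with h | h
  · rw [Equiv.trans_apply, h, C.sim_tr one_pos hg, h, one_smul, hw]
  · rw [Equiv.trans_apply, h, C.sim_tr one_pos hg, h, one_smul, hw, neg_neg]

end Coordinates

section Coord

variable {Y : Type*} [MetricSpace Y] [InvSpace Y] {o : Y} {V : Type*} [NormedAddCommGroup V]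
  [InnerProductSpace ℝ V]

/-- Global coordinates `(w, a)` in which the metric is left invariant for the group law twisted by
the cocycle `η`. -/
structure Coord (C : Chart o V) (α : ℝ) (Ψ : V → ℝ → Y) (η : V → V → ℝ) : Prop where
  one_lt : 1 < α
  surj : ∀ y, ∃ w a, Ψ w a = y
  zero : Ψ 0 0 = o
  proj : ∀ w a, C.proj (Ψ w a) = w
  tr : ∀ v u a, C.tr v (Ψ u a) = Ψ (u + v) (a + η u v)
  tr_zero : ∀ v a, C.tr v (Ψ 0 a) = Ψ v a
  dist_left : ∀ w a v h, dist (Ψ w a) (Ψ (w + v) (a + h + η w v)) = dist o (Ψ v h)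
  dist_zero : ∀ h, dist o (Ψ 0 h) = |h| ^ α⁻¹
  dist_smul : ∀ l : ℝ, 0 < l → ∀ (w : V) (h : ℝ), dist o (Ψ (l • w) (l ^ α * h)) = l * dist o
      (Ψ w h)
  cont : Continuous fun q : V × ℝ => Ψ q.1 q.2
  cont_cocycle : Continuous fun q : V × V => η q.1 q.2
  cont_of_comp : ∀ q : ℝ → ℝ, Continuous (fun s => Ψ 0 (q s)) → Continuous q
  cocycle_smul : ∀ (w : V) (s t : ℝ), η (s • w) (t • w) = 0
  cocycle : ∀ u v x, η u v + η (u + v) x = η v x + η u (v + x)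
  cocycle_homog : ∀ l : ℝ, 0 < l → ∀ u v : V, η (l • u) (l • v) = l ^ α * η u v
  inv_smul : ∀ φ, IsInv o 1 φ → ∀ l : ℝ, 0 < l → ∀ (w : V) (a : ℝ) (w' : V) (a' : ℝ), φ (Ψ w a) =
      Ψ w' a' →
    φ (Ψ (l • w) (l ^ α * a)) = Ψ (l⁻¹ • w') (l⁻¹ ^ α * a')

theorem FiberParam.exists_coord {C : Chart o V} {α : ℝ} {p : ℝ → Y} (P : FiberParam C α p) :
    ∃ η : V → V → ℝ, Coord C α (fun w a => C.tr w (p a)) η := by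
  choose T hT hTp using P.exists_translation
  choose γ hγ hγp using P.exists_transversal
  have hTo : ∀ a, T a o = p a := fun a => by
    have h := hTp a 0
    rwa [P.zero, zero_add] at h
  have hγo : ∀ w, γ w o = C.tr w o := fun w => by
    have h := hγp w 0
    rwa [P.zero] at h
  have hex : ∀ u v, ∃ a, p a = C.tr (-(u + v)) (C.tr v (C.tr u o)) := fun u v => P.surj _ (by
    rw [C.proj_tr, C.proj_tr, C.proj_tr, C.proj_base]; abel)
  choose η hη using hex
  have hη' : ∀ u v, C.tr v (C.tr u o) = C.tr (u + v) (p (η u v)) := fun u v => by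
    rw [hη, C.tr_tr_neg]
  have htr : ∀ v u a, C.tr v (C.tr u (p a)) = C.tr (u + v) (p (a + η u v)) := fun v u a => by
    have h1 := congrArg (T a) (hη' u v)
    simp only [C.sim_tr one_pos (hT a), one_smul, hTp, hTo] at h1
    rw [h1, add_comm a]
  have hinj : ∀ w a b, C.tr w (p a) = C.tr w (p b) → a = b := fun w a b h => P.inj (by
    rw [← C.tr_neg_tr w (p a), h, C.tr_neg_tr])
  have hleft : ∀ w a v h, γ w (T a (C.tr v (p h))) = C.tr (w + v) (p (a + h + η w v)) := by
    intro w a v h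
    rw [C.sim_tr one_pos (hT a), C.sim_tr one_pos (hγ w), hTp, hγp, one_smul, one_smul, htr,
      add_comm h a]
  have hcoc : ∀ u v x, η u v + η (u + v) x = η v x + η u (v + x) := by
    intro u v x
    have h1 : C.tr x (C.tr v (C.tr u o)) = C.tr (u + v + x) (p (η u v + η (u + v) x)) := by
      rw [hη', htr]
    have h2 : C.tr x (C.tr v (C.tr u o)) = C.tr (u + (v + x)) (p (η v x + η u (v + x))) := by
      have h3 := congrArg (γ u) (hη' v x)
      simp only [C.sim_tr one_pos (hγ u), one_smul, hγo, hγp, htr] at h3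
      exact h3
    rw [h1, ← add_assoc] at h2
    exact hinj _ _ _ h2
  have hscale : ∀ l : ℝ, 0 < l → ∃ g : Y ≃ Y, IsSim l g ∧ g o = o ∧ ∀ a, g (p a) = p (l ^ α * a) :=
    fun l hl => by
      obtain ⟨φ, hφ⟩ := InvSpace.exists_inv o 1 one_pos
      obtain ⟨g, hg, g0, hgp, -⟩ := P.exists_homothety hφ hl
      exact ⟨g, hg, g0, hgp⟩
  have hΨc : Continuous fun q : V × ℝ => C.tr q.1 (p q.2) :=
    C.continuous_tr.comp (continuous_fst.prodMk (P.continuous.comp continuous_snd))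
  refine ⟨η, ⟨P.one_lt, fun y => ?_, by rw [P.zero, C.tr_zero], fun w a => by
      rw [C.proj_tr, P.proj, zero_add], fun v u a => htr v u a, fun v a => by
      rw [C.tr_zero], fun w a v h => ?_, fun h => ?_, fun l hl w h => ?_, hΨc, ?_, fun q hq => ?_,
      fun w s t => ?_, hcoc, fun l hl u v => ?_, fun φ hφ l hl w a w' a' h => ?_⟩⟩
  · obtain ⟨a, ha⟩ := P.surj (C.tr (-C.proj y) y) (by rw [C.proj_tr, add_neg_cancel])
    exact ⟨C.proj y, a, by rw [ha, C.tr_tr_neg]⟩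
  · rw [← hleft, show C.tr w (p a) = γ w (T a o) by rw [hTo, hγp], (hγ w).isometry.dist_eq,
      (hT a).isometry.dist_eq]
  · rw [C.tr_zero, ← P.zero, P.dist, zero_sub, abs_neg]
  · obtain ⟨g, hg, g0, hgp⟩ := hscale l hl
    rw [← hg.dist_map, g0, C.sim_tr hl hg, hgp]
  · refine P.continuous_of_comp ?_
    simp only [hη]
    exact C.continuous_tr.comp ((by fun_prop : Continuous fun q : V × V => -(q.1 + q.2)).prodMk
      (C.continuous_tr.comp (continuous_snd.prodMk
        (C.continuous_tr.comp (continuous_fst.prodMk continuous_const)))))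
  · simp only [C.tr_zero] at hq
    exact P.continuous_of_comp hq
  · refine P.inj ?_
    rw [hη, C.tr_smul, ← add_smul, ← neg_smul, C.tr_smul, P.zero, add_comm t, neg_add_cancel,
      zero_smul, C.tr_zero]
  · obtain ⟨g, hg, g0, hgp⟩ := hscale l hl
    have h1 := congrArg g (hη' u v)
    simp only [C.sim_tr hl hg, g0, hgp] at h1
    rw [hη', smul_add] at h1
    exact hinj _ _ _ h1
  · obtain ⟨g, hg, g0, hgp, hgφ⟩ := P.exists_homothety hφ hl
    have h1 := hgφ (φ (C.tr w (p a)))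
    rw [hφ.invol, C.sim_tr hl hg, hgp] at h1
    rw [h1, h, Equiv.symm_apply_eq, C.sim_tr hl hg, hgp, smul_smul, mul_inv_cancel₀ hl.ne',
      one_smul,
      ← mul_assoc, ← Real.mul_rpow hl.le (inv_nonneg.mpr hl.le), mul_inv_cancel₀ hl.ne',
      Real.one_rpow, one_mul]

end Coord

section Cocycle

variable {Y : Type*} [MetricSpace Y] [InvSpace Y] {o : Y} {V : Type*} [NormedAddCommGroup V]
  [InnerProductSpace ℝ V] {C : Chart o V} {α : ℝ} {Ψ : V → ℝ → Y} {η : V → V → ℝ}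

theorem Coord.pos (H : Coord C α Ψ η) : 0 < α := one_pos.trans H.one_lt

theorem Coord.cocycle_zero_right (H : Coord C α Ψ η) (w : V) : η w 0 = 0 := by
  simpa using H.cocycle_smul w 1 0

theorem Coord.cocycle_zero_left (H : Coord C α Ψ η) (w : V) : η 0 w = 0 := by
  simpa using H.cocycle_smul w 0 1

theorem Coord.cocycle_self (H : Coord C α Ψ η) (w : V) : η w w = 0 := by
  simpa using H.cocycle_smul w 1 1

theorem Coord.dist_eq (H : Coord C α Ψ η) (w : V) (a : ℝ) (w' : V) (a' : ℝ) :
    dist (Ψ w a) (Ψ w' a') = dist o (Ψ (w' - w) (a' - a - η w (w' - w))) := by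
  rw [← H.dist_left w a]
  congr 2
  · abel
  · ring

theorem Coord.inj (H : Coord C α Ψ η) {w : V} {a : ℝ} {w' : V} {a' : ℝ}
    (h : Ψ w a = Ψ w' a') : w = w' ∧ a = a' := by
  obtain rfl : w = w' := by rw [← H.proj w a, h, H.proj]
  refine ⟨rfl, ?_⟩
  have h1 := H.dist_eq w a w a'
  rw [h, dist_self, sub_self, H.cocycle_zero_right, sub_zero, H.dist_zero, eq_comm,
    Real.rpow_eq_zero (abs_nonneg _) (inv_ne_zero H.pos.ne'), abs_eq_zero] at h1
  linarith

theorem Coord.ne_center (H : Coord C α Ψ η) {w : V} {a : ℝ} (h : w ≠ 0 ∨ a ≠ 0) : Ψ w a ≠ o := by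
  intro h1
  rw [← H.zero] at h1
  obtain ⟨h2, h3⟩ := H.inj h1
  tauto

theorem Coord.dist_neg (H : Coord C α Ψ η) (w : V) (a : ℝ) :
    dist o (Ψ (-w) (-a)) = dist o (Ψ w a) := by
  have h1 := H.dist_eq w a 0 0
  have h2 := H.cocycle_smul w 1 (-1)
  rw [one_smul, neg_one_smul] at h2
  rwa [H.zero, zero_sub, zero_sub, h2, sub_zero, dist_comm, eq_comm] at h1

theorem Coord.dist_base (H : Coord C α Ψ η) (w : V) : dist o (Ψ w 0) = ‖w‖ := by
  rw [← H.tr_zero, H.zero, C.dist_tr]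

theorem Coord.norm_le_dist (H : Coord C α Ψ η) (w : V) (a : ℝ) : ‖w‖ ≤ dist o (Ψ w a) := by
  have h := C.norm_proj_sub_le (Ψ w a) o
  rwa [H.proj, C.proj_base, sub_zero, dist_comm] at h

theorem Coord.cocycle_double (H : Coord C α Ψ η) (u v : V) :
    (2 ^ α - 2) * η u v = η u v - η v u := by
  have h0 := H.cocycle_homog 2 two_pos u v
  rw [two_smul ℝ u, two_smul ℝ v] at h0
  have h1 := H.cocycle (u + u) v v
  have h2 := H.cocycle (u + v) u v
  have h3 := H.cocycle u u v
  have h4 := H.cocycle u v u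
  rw [show u + v + u = u + u + v by abel, H.cocycle_self] at h2
  rw [H.cocycle_self] at h1 h3
  rw [add_comm v u] at h4
  linarith

theorem Coord.two_rpow_sub_pos (H : Coord C α Ψ η) : 0 < (2 : ℝ) ^ α - 2 := by
  have h := Real.rpow_lt_rpow_of_exponent_lt (one_lt_two : (1 : ℝ) < 2) H.one_lt
  rw [Real.rpow_one] at h
  linarith

theorem Coord.cocycle_antisymm (H : Coord C α Ψ η) (u v : V) : η u v = -η v u := by
  have h1 := H.cocycle_double u v
  have h2 := H.cocycle_double v u
  have h3 := H.two_rpow_sub_pos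
  have h4 : (2 ^ α - 2) * (η u v + η v u) = 0 := by linarith
  rcases mul_eq_zero.mp h4 with h | h <;> linarith

theorem Coord.cocycle_eq_zero (H : Coord C α Ψ η) (hα : α ≠ 2) (u v : V) : η u v = 0 := by
  have h1 := H.cocycle_double u v
  have h2 := H.cocycle_antisymm u v
  have h3 : ((2 : ℝ) ^ α - 4) * η u v = 0 := by linarith
  rcases mul_eq_zero.mp h3 with h | h
  · have h4 : (2 : ℝ) ^ α = 2 ^ (2 : ℝ) := by norm_num; linarith
    exact absurd ((Real.rpow_right_inj two_pos (by norm_num)).mp h4) hα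
  · exact h

theorem Coord.cocycle_add_left (H : Coord C α Ψ η) (u v x : V) :
    η (u + v) x = η u x + η v x := by
  have h1 := H.cocycle u v x
  have h2 := H.cocycle x u v
  have h3 := H.cocycle u x v
  rw [add_comm x u] at h2
  rw [add_comm x v] at h3
  have h4 := H.cocycle_antisymm x (u + v)
  have h5 := H.cocycle_antisymm x u
  have h6 := H.cocycle_antisymm x v
  linarith

theorem Coord.cocycle_add_right (H : Coord C α Ψ η) (u v x : V) :
    η x (u + v) = η x u + η x v := by
  rw [H.cocycle_antisymm, H.cocycle_add_left, H.cocycle_antisymm x u, H.cocycle_antisymm x v]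
  ring

theorem Coord.cocycle_smul_right (H : Coord C α Ψ η) (x v : V) (s : ℝ) :
    η x (s • v) = s * η x v := by
  let F : V →+ ℝ :=
    { toFun := η x
      map_zero' := H.cocycle_zero_right x
      map_add' := fun u v => H.cocycle_add_right u v x }
  exact map_real_smul F (H.cont_cocycle.comp (continuous_const.prodMk continuous_id)) s v

theorem Coord.cocycle_sub_right (H : Coord C α Ψ η) (u v x : V) :
    η x (u - v) = η x u - η x v := by
  rw [sub_eq_add_neg, H.cocycle_add_right, ← neg_one_smul ℝ v, H.cocycle_smul_right]
  ring

theorem Coord.exists_cocycle_vec [FiniteDimensional ℝ V] (H : Coord C α Ψ η) (w : V) :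
    ∃ k : V, ∀ u, inner ℝ k u = η w u := by
  have := FiniteDimensional.complete ℝ V
  let F : V →ₗ[ℝ] ℝ :=
    { toFun := η w
      map_add' := fun u v => H.cocycle_add_right u v w
      map_smul' := fun s v => H.cocycle_smul_right w v s }
  refine ⟨(InnerProductSpace.toDual ℝ V).symm (LinearMap.toContinuousLinearMap F), fun u => ?_⟩
  rw [InnerProductSpace.toDual_symm_apply]
  rfl

end Cocycle

section InvFiber

variable {Y : Type*} [MetricSpace Y] [InvSpace Y] {o : Y} {V : Type*} [NormedAddCommGroup V]
  [InnerProductSpace ℝ V] {C : Chart o V} {α : ℝ} {Ψ : V → ℝ → Y} {η : V → V → ℝ} {φ : Y → Y}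

theorem Coord.tr_base (H : Coord C α Ψ η) (v : V) : C.tr v o = Ψ v 0 := by
  have h := H.tr_zero v 0
  rwa [H.zero] at h

theorem Coord.hasDerivAt_dist (H : Coord C α Ψ η) (hφ : IsInv o 1 φ) {v : V} {a : ℝ}
    (hva : v ≠ 0 ∨ a ≠ 0) (u : V) :
    HasDerivAt (fun s : ℝ => dist o (Ψ (s • u - v) (-a - s * η v u)))
      (dist o (Ψ v a) * inner ℝ u (C.proj (φ (Ψ v a)))) 0 := by
  have heq : ∀ s : ℝ, dist o (Ψ (s • u - v) (-a - s * η v u)) =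
      dist (Ψ v a) (C.tr (s • u) o) := fun s => by
    rw [H.tr_base, H.dist_eq, H.cocycle_sub_right, H.cocycle_self, sub_zero, H.cocycle_smul_right,
      zero_sub]
  simp only [heq]
  rcases eq_or_ne u 0 with rfl | hu
  · simpa using hasDerivAt_const (0 : ℝ) (dist (Ψ v a) (C.tr 0 o))
  · have hu' : ‖u‖ ≠ 0 := norm_ne_zero_iff.mpr hu
    have h1 := C.hasDerivAt_dist hφ (H.ne_center hva) (u := ‖u‖⁻¹ • u)
      (by rw [norm_smul, norm_inv, norm_norm, inv_mul_cancel₀ hu'])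
    have h2 : HasDerivAt (fun s : ℝ => ‖u‖ * s) ‖u‖ 0 := by
      simpa using (hasDerivAt_id (0 : ℝ)).const_mul ‖u‖
    rw [← mul_zero ‖u‖] at h1
    have h3 := h1.comp (0 : ℝ) h2
    rw [C.proj_base, sub_zero, real_inner_smul_left, dist_comm] at h3
    refine (h3.congr_deriv (by field_simp)).congr_of_eventuallyEq (Eventually.of_forall fun s => ?_)
    change _ = dist (Ψ v a) (C.tr ((‖u‖ * s) • ‖u‖⁻¹ • u) o)
    rw [smul_smul, mul_right_comm, mul_inv_cancel₀ hu', one_mul]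

theorem tendsto_gap_rpow {α : ℝ} (hα : 1 < α) :
    Tendsto (fun n : ℕ => ((((n : ℝ) + 2) ^ α - ((n : ℝ) + 1) ^ α) ^ α⁻¹)⁻¹) atTop (𝓝 0) := by
  have h0 : 0 < α := one_pos.trans hα
  refine tendsto_inv_atTop_zero.comp ((tendsto_rpow_atTop (inv_pos.mpr h0)).comp ?_)
  have h1 : Tendsto (fun n : ℕ => ((n : ℝ)) ^ (α - 1)) atTop atTop :=
    (tendsto_rpow_atTop (sub_pos.mpr hα)).comp tendsto_natCast_atTop_atTop
  refine tendsto_atTop_mono (fun n => ?_) h1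
  have hn : (0 : ℝ) ≤ n := n.cast_nonneg
  have e1 : ((n : ℝ) + 2) ^ α = ((n : ℝ) + 2) ^ (α - 1) * (n + 2) := by
    rw [Real.rpow_sub_one (by positivity), div_mul_cancel₀ _ (by positivity)]
  have e2 : ((n : ℝ) + 1) ^ α = ((n : ℝ) + 1) ^ (α - 1) * (n + 1) := by
    rw [Real.rpow_sub_one (by positivity), div_mul_cancel₀ _ (by positivity)]
  have i1 : ((n : ℝ) + 1) ^ (α - 1) ≤ ((n : ℝ) + 2) ^ (α - 1) :=
    Real.rpow_le_rpow (by positivity) (by linarith) (by linarith)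
  have i2 : (n : ℝ) ^ (α - 1) ≤ ((n : ℝ) + 2) ^ (α - 1) :=
    Real.rpow_le_rpow (by positivity) (by linarith) (by linarith)
  rw [e1, e2]
  nlinarith

theorem Coord.dist_inv_one (H : Coord C α Ψ η) (hφ : IsInv o 1 φ) {w : V} {h : ℝ}
    (hw : φ (Ψ 0 1) = Ψ w h) {s t : ℝ} (hs : 0 < s) (hst : s < t) :
    dist o (Ψ ((t - s) • w) ((t ^ α - s ^ α) * h)) = (t ^ α - s ^ α) ^ α⁻¹ := by
  have key : ∀ s : ℝ, 0 < s → φ (Ψ 0 (s⁻¹ ^ α)) = Ψ (s • w) (s ^ α * h) := fun s hs => by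
    have h1 := H.inv_smul φ hφ s⁻¹ (inv_pos.mpr hs) 0 1 w h hw
    rwa [smul_zero, mul_one, inv_inv] at h1
  have ht := hs.trans hst
  have hne : ∀ s : ℝ, 0 < s → Ψ 0 (s⁻¹ ^ α) ≠ o := fun s hs => H.ne_center (Or.inr (by positivity))
  have hd : ∀ s : ℝ, 0 < s → dist (Ψ 0 (s⁻¹ ^ α)) o = s⁻¹ := fun s hs => by
    rw [dist_comm, H.dist_zero, abs_of_nonneg (by positivity), Real.rpow_rpow_inv (by positivity)
      H.pos.ne']
  have hm := hφ.dist_mul _ _ (hne s hs) (hne t ht)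
  rw [key s hs, key t ht, hd s hs, hd t ht, H.dist_eq, ← sub_smul, H.cocycle_smul, H.dist_eq 0,
    sub_self, H.cocycle_zero_right, H.dist_zero] at hm
  have hpos : 0 < t ^ α - s ^ α := sub_pos.mpr (Real.rpow_lt_rpow hs.le hst H.pos)
  have e : |t⁻¹ ^ α - s⁻¹ ^ α - 0| = (t ^ α - s ^ α) * (s⁻¹ * t⁻¹) ^ α := by
    rw [sub_zero, abs_sub_comm, Real.mul_rpow (by positivity) (by positivity), Real.inv_rpow hs.le,
      Real.inv_rpow ht.le]
    have hs' : (0 : ℝ) < s ^ α := by positivity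
    have ht' : (0 : ℝ) < t ^ α := by positivity
    rw [show (s ^ α)⁻¹ - (t ^ α)⁻¹ = (t ^ α - s ^ α) * ((s ^ α)⁻¹ * (t ^ α)⁻¹) by field_simp]
    exact abs_of_pos (by positivity)
  rw [sub_zero, e,
    Real.mul_rpow hpos.le (by positivity), Real.rpow_rpow_inv (by positivity) H.pos.ne', one_pow,
    one_mul, ← sub_mul] at hm
  have : s⁻¹ * t⁻¹ ≠ 0 := by positivity
  exact mul_right_cancel₀ this hm

theorem Coord.inv_one (H : Coord C α Ψ η) (hφ : IsInv o 1 φ) : φ (Ψ 0 1) = Ψ 0 (-1) := by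
  obtain ⟨w, h, hw⟩ := H.surj (φ (Ψ 0 1))
  set r : ℕ → ℝ := fun n => ((((n : ℝ) + 2) ^ α - ((n : ℝ) + 1) ^ α) ^ α⁻¹)⁻¹ with hr
  have hr0 : Tendsto r atTop (𝓝 0) := tendsto_gap_rpow H.one_lt
  have hgap : ∀ n : ℕ, 0 < ((n : ℝ) + 2) ^ α - ((n : ℝ) + 1) ^ α := fun n =>
    sub_pos.mpr (Real.rpow_lt_rpow (by positivity) (by linarith) H.pos)
  have hrpos : ∀ n, 0 < r n := fun n => inv_pos.mpr (Real.rpow_pos_of_pos (hgap n) _)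
  have hN : ∀ n, dist o (Ψ (r n • w) h) = 1 := fun n => by
    have h1 := H.dist_inv_one hφ hw.symm (s := n + 1) (t := n + 2) (by positivity) (by linarith)
    have h2 := H.dist_smul (r n) (hrpos n) (((n + 2 : ℝ) - (n + 1)) • w)
      ((((n : ℝ) + 2) ^ α - ((n : ℝ) + 1) ^ α) * h)
    rw [h1, show (n + 2 : ℝ) - (n + 1) = 1 by ring, one_smul] at h2
    have h3 : r n ^ α = (((n : ℝ) + 2) ^ α - ((n : ℝ) + 1) ^ α)⁻¹ := by
      rw [hr, Real.inv_rpow (Real.rpow_nonneg (hgap n).le _), Real.rpow_inv_rpow (hgap n).le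
        H.pos.ne']
    rw [h3, inv_mul_cancel_left₀ (hgap n).ne'] at h2
    rw [h2]
    exact inv_mul_cancel₀ (Real.rpow_pos_of_pos (hgap n) _).ne'
  have hh : |h| = 1 := by
    have h1 : Tendsto (fun n => dist o (Ψ (r n • w) h)) atTop (𝓝 (dist o (Ψ ((0 : ℝ) • w) h))) :=
      tendsto_const_nhds.dist ((H.cont.tendsto ((0 : ℝ) • w, h)).comp
        ((hr0.smul_const w).prodMk_nhds tendsto_const_nhds))
    simp only [hN] at h1
    have h2 := tendsto_nhds_unique h1 tendsto_const_nhds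
    rw [zero_smul, H.dist_zero] at h2
    have h3 := congrArg (fun x : ℝ => x ^ α) h2
    simpa [Real.rpow_inv_rpow (abs_nonneg h) H.pos.ne'] using h3
  have hd := H.hasDerivAt_dist hφ (v := 0) (a := 1) (Or.inr one_ne_zero) w
  have hN' : ∀ n, dist o (Ψ ((-h * r n) • w) (-1)) = 1 := fun n => by
    rcases eq_or_eq_neg_of_abs_eq hh with rfl | rfl
    · refine Eq.trans ?_ (hN n)
      rw [← H.dist_neg, ← neg_smul]
      simp
    · refine Eq.trans ?_ (hN n)
      simp
  have hw0 : w = 0 := by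
    rw [hasDerivAt_iff_tendsto_slope_zero] at hd
    have hseq : Tendsto (fun n => -h * r n) atTop (𝓝[≠] 0) := by
      refine tendsto_nhdsWithin_iff.mpr ⟨?_, Eventually.of_forall fun n => ?_⟩
      · simpa using hr0.const_mul (-h)
      · have : h ≠ 0 := by
          rintro rfl
          simp at hh
        exact mul_ne_zero (neg_ne_zero.mpr this) (hrpos n).ne'
    have h1 := hd.comp hseq
    have hone : dist o (Ψ 0 1) = 1 := by rw [H.dist_zero, abs_one, Real.one_rpow]
    have hone' : dist o (Ψ 0 (-1)) = 1 := by rw [H.dist_zero, abs_neg, abs_one, Real.one_rpow]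
    rw [← hw, H.proj, hone, one_mul] at h1
    have h2 := tendsto_nhds_unique h1 (b := 0) (by
      refine tendsto_const_nhds.congr fun n => ?_
      simp only [Function.comp_apply, zero_add, sub_zero, H.cocycle_zero_left, mul_zero, zero_smul,
        hN', hone', sub_self, smul_zero])
    exact inner_self_eq_zero.mp h2
  rw [← hw, hw0]
  rcases eq_or_eq_neg_of_abs_eq hh with rfl | rfl
  · rw [hw0] at hw
    exact absurd hw.symm (hφ.ne_self _ (H.ne_center (Or.inr one_ne_zero)))
  · rfl

theorem Coord.inv_fiber (H : Coord C α Ψ η) (hφ : IsInv o 1 φ) {a : ℝ} (ha : a ≠ 0) :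
    φ (Ψ 0 a) = Ψ 0 (-a⁻¹) := by
  have key : ∀ a : ℝ, 0 < a → φ (Ψ 0 a) = Ψ 0 (-a⁻¹) := fun a ha => by
    have h1 := H.inv_smul φ hφ (a ^ α⁻¹) (by positivity) 0 1 0 (-1) (H.inv_one hφ)
    rwa [smul_zero, smul_zero, Real.inv_rpow (by positivity), Real.rpow_inv_rpow ha.le H.pos.ne',
      mul_one, mul_neg_one] at h1
  rcases lt_or_gt_of_ne ha with h | h
  · have h1 := key (-a⁻¹) (by simpa using h)
    rw [inv_neg, inv_inv, neg_neg] at h1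
    rw [← h1, hφ.invol]
  · exact key a h

end InvFiber

section Gauge

/-- An even homogeneous gauge on the plane dominating the second coordinate. -/
structure PlaneGauge (n : ℝ → ℝ → ℝ) : Prop where
  cont : Continuous fun q : ℝ × ℝ => n q.1 q.2
  homog : ∀ l x y, n (l * x) (l * y) = |l| * n x y
  one : n 1 0 = 1
  symm : ∀ x y, n x y = n y x
  le : ∀ x y, |y| ≤ n x y

variable {n : ℝ → ℝ → ℝ}

theorem PlaneGauge.le' (N : PlaneGauge n) (x y : ℝ) : |x| ≤ n x y := by
  rw [N.symm]
  exact N.le y x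

theorem PlaneGauge.pos (N : PlaneGauge n) {x y : ℝ} (h : x ≠ 0 ∨ y ≠ 0) : 0 < n x y := by
  rcases h with h | h
  · exact (abs_pos.mpr h).trans_le (N.le' x y)
  · exact (abs_pos.mpr h).trans_le (N.le x y)

theorem PlaneGauge.eq_neg_one (N : PlaneGauge n) {a b c d : ℝ} (hdet : a * d - b * c = 1)
    (hinv : ∀ x y, n (a * x + b * y) (c * x + d * y) = n x y) (ht : a + d ≤ -2) :
    a = -1 ∧ b = 0 ∧ c = 0 ∧ d = -1 := by
  have heig : ∀ μ x y : ℝ, a * x + b * y = μ * x → c * x + d * y = μ * y → μ < -1 →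
      ¬(x ≠ 0 ∨ y ≠ 0) := fun μ x y h1 h2 hμ hxy => by
    have h3 := hinv x y
    rw [h1, h2, N.homog, abs_of_neg (by linarith)] at h3
    nlinarith [N.pos hxy]
  rcases ht.lt_or_eq with ht | ht
  · exfalso
    set s := Real.sqrt ((a + d) ^ 2 - 4) with hs
    have hpos : 0 < (a + d) ^ 2 - 4 := by nlinarith
    have hs2 : s ^ 2 = (a + d) ^ 2 - 4 := Real.sq_sqrt hpos.le
    have hs0 : 0 < s := Real.sqrt_pos.mpr hpos
    set μ := (a + d - s) / 2 with hμ
    have hroot : μ ^ 2 - (a + d) * μ + 1 = 0 := by rw [hμ]; linarith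
    have hμ1 : μ < -1 := by rw [hμ]; linarith
    have h1 := heig μ b (μ - a) (by ring) (by linarith) hμ1
    have h2 := heig μ (μ - d) c (by linarith) (by ring) hμ1
    push Not at h1 h2
    have : μ = a + d - μ := by linarith [h1.2, h2.1]
    rw [hμ] at this
    linarith
  · have key : ∀ x y, n (x - ((a + 1) * x + b * y)) (y - (c * x + (d + 1) * y)) = n x y := by
      intro x y
      have h1 := N.homog (-1) (a * x + b * y) (c * x + d * y)
      rw [hinv, abs_neg, abs_one, one_mul] at h1
      rw [← h1]
      congr 1 <;> ring
    have e1 : (a + 1) * (a + 1) + b * c = 0 := by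
      have : d = -2 - a := by linarith
      rw [this] at hdet
      linarith
    have e2 : d + 1 = -(a + 1) := by linarith
    have hk : ∀ (k : ℕ) (x y : ℝ),
        n (x - k * ((a + 1) * x + b * y)) (y - k * (c * x + (d + 1) * y)) = n x y := by
      intro k
      induction k with
      | zero => intro x y; simp
      | succ k ih =>
        intro x y
        rw [← ih x y, ← key (x - k * _) (y - k * _)]
        rw [e2]
        push_cast
        congr 1
        · linear_combination (-k * x) * e1
        · linear_combination (-k * y) * e1
    have hz : ∀ x z M : ℝ, (∀ k : ℕ, |x - k * z| ≤ M) → z = 0 := by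
      intro x z M h
      by_contra hz
      obtain ⟨k, hk⟩ := exists_nat_gt ((M + |x|) / |z|)
      rw [div_lt_iff₀ (abs_pos.mpr hz)] at hk
      have h1 := h k
      have h2 := abs_sub_abs_le_abs_sub ((k : ℝ) * z) x
      rw [abs_mul, Nat.abs_cast, abs_sub_comm] at h2
      linarith
    have hx : ∀ x y, (a + 1) * x + b * y = 0 := fun x y => hz x _ (n x y) fun k => by
      rw [← hk k x y]
      exact N.le' _ _
    have hy : ∀ x y, c * x + (d + 1) * y = 0 := fun x y => hz y _ (n x y) fun k => by
      rw [← hk k x y]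
      exact N.le _ _
    have a1 := hx 1 0
    have a2 := hx 0 1
    have a3 := hy 1 0
    have a4 := hy 0 1
    refine ⟨?_, ?_, ?_, ?_⟩ <;> linarith

theorem PlaneGauge.sq_of_irrational (N : PlaneGauge n) {a b c d θ : ℝ} (hdet : a * d - b * c = 1)
    (hinv : ∀ x y, n (a * x + b * y) (c * x + d * y) = n x y) (ht : a + d = 2 * Real.cos θ)
    (hirr : Irrational (θ / (2 * Real.pi))) (hsin : Real.sin θ ≠ 0) (x y : ℝ) :
    n x y ^ 2 = x ^ 2 + y ^ 2 := by
  obtain ⟨p, hp⟩ : ∃ p, p = (a - d) / (2 * Real.sin θ) := ⟨_, rfl⟩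
  obtain ⟨q, hq⟩ : ∃ q, q = b / Real.sin θ := ⟨_, rfl⟩
  obtain ⟨r, hr⟩ : ∃ r, r = c / Real.sin θ := ⟨_, rfl⟩
  have hpp : p * (2 * Real.sin θ) = a - d := by rw [hp]; field_simp
  have hqq : q * Real.sin θ = b := by rw [hq]; field_simp
  have hrr : r * Real.sin θ = c := by rw [hr]; field_simp
  have hJ : p ^ 2 + q * r = -1 := by
    have h1 : (p ^ 2 + q * r + 1) * Real.sin θ ^ 2 = 0 := by
      have h2 := Real.sin_sq_add_cos_sq θ
      have h3 : p * Real.sin θ = (a - d) / 2 := by linarith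
      have h4 : Real.cos θ = (a + d) / 2 := by linarith
      calc (p ^ 2 + q * r + 1) * Real.sin θ ^ 2
          = (p * Real.sin θ) ^ 2 + (q * Real.sin θ) * (r * Real.sin θ) + Real.sin θ ^ 2 := by ring
        _ = ((a - d) / 2) ^ 2 + b * c + (1 - ((a + d) / 2) ^ 2) := by
          rw [h3, hqq, hrr, ← h4]; linarith
        _ = 0 := by linarith
    rcases mul_eq_zero.mp h1 with h | h
    · linarith
    · exact absurd (pow_eq_zero_iff two_ne_zero |>.mp h) hsin
  have hcomp : ∀ s t u v : ℝ,
      (Real.cos (s + t) * u + Real.sin (s + t) * (p * u + q * v) =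
        Real.cos s * (Real.cos t * u + Real.sin t * (p * u + q * v)) +
        Real.sin s * (p * (Real.cos t * u + Real.sin t * (p * u + q * v)) +
          q * (Real.cos t * v + Real.sin t * (r * u - p * v)))) ∧
      (Real.cos (s + t) * v + Real.sin (s + t) * (r * u - p * v) =
        Real.cos s * (Real.cos t * v + Real.sin t * (r * u - p * v)) +
        Real.sin s * (r * (Real.cos t * u + Real.sin t * (p * u + q * v)) -
          p * (Real.cos t * v + Real.sin t * (r * u - p * v)))) := by
    intro s t u v
    rw [Real.cos_add, Real.sin_add]
    constructor
    · linear_combination (-Real.sin s * Real.sin t * u) * hJ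
    · linear_combination (-Real.sin s * Real.sin t * v) * hJ
  let G : AddSubgroup ℝ :=
    { carrier := {s | ∀ u v, n (Real.cos s * u + Real.sin s * (p * u + q * v))
        (Real.cos s * v + Real.sin s * (r * u - p * v)) = n u v}
      zero_mem' := fun u v => by simp
      add_mem' := fun {s t} hs ht u v => by
        rw [(hcomp s t u v).1, (hcomp s t u v).2, hs, ht]
      neg_mem' := fun {s} hs u v => by
        rw [← hs, ← (hcomp s (-s) u v).1, ← (hcomp s (-s) u v).2]
        simp }
  have hG : ∀ s, s ∈ G ↔ ∀ u v, n (Real.cos s * u + Real.sin s * (p * u + q * v))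
        (Real.cos s * v + Real.sin s * (r * u - p * v)) = n u v := fun s => Iff.rfl
  have hclosed : IsClosed (G : Set ℝ) := by
    have : (G : Set ℝ) = ⋂ u : ℝ, ⋂ v : ℝ, {s | n (Real.cos s * u + Real.sin s * (p * u + q * v))
        (Real.cos s * v + Real.sin s * (r * u - p * v)) = n u v} := by
      ext s
      simp only [Set.mem_iInter]
      exact Iff.rfl
    rw [this]
    refine isClosed_iInter fun u => isClosed_iInter fun v => isClosed_eq ?_ continuous_const
    exact N.cont.comp (by fun_prop : Continuous fun s : ℝ =>
      (Real.cos s * u + Real.sin s * (p * u + q * v),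
        Real.cos s * v + Real.sin s * (r * u - p * v)))
  have hθ : θ ∈ G := (hG θ).mpr fun u v => by
    rw [← hinv u v]
    congr 1
    · linear_combination u * (hpp / 2 - ht / 2) + v * hqq
    · linear_combination v * (-hpp / 2 - ht / 2) + u * hrr
  have h2π : 2 * Real.pi ∈ G := (hG _).mpr fun u v => by simp
  have hall : ∀ s, s ∈ G := by
    have hd := dense_addSubgroupClosure_pair_iff.mpr hirr
    have hle : AddSubgroup.closure {θ, 2 * Real.pi} ≤ G := by
      rw [AddSubgroup.closure_le]
      rintro s (rfl | rfl)
      · exact hθ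
      · exact h2π
    intro s
    exact hclosed.closure_subset (hd.mono hle s)
  have h01 : n 0 1 = 1 := by rw [N.symm, N.one]
  have hp0 : p = 0 := by
    have h1 := (hG _).mp (hall (Complex.arg ⟨1, -p⟩)) 0 1
    have h2 := N.le (Real.cos (Complex.arg ⟨1, -p⟩) * 0 +
      Real.sin (Complex.arg ⟨1, -p⟩) * (p * 0 + q * 1)) (Real.cos (Complex.arg ⟨1, -p⟩) * 1 +
      Real.sin (Complex.arg ⟨1, -p⟩) * (r * 0 - p * 1))
    rw [h1, h01] at h2
    have h3 := Complex.norm_mul_cos_arg ⟨1, -p⟩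
    have h4 := Complex.norm_mul_sin_arg ⟨1, -p⟩
    have h5 : ‖(⟨1, -p⟩ : ℂ)‖ ^ 2 = 1 + p ^ 2 := by
      rw [Complex.sq_norm, Complex.normSq_mk]; ring
    simp only at h3 h4
    set ρ := ‖(⟨1, -p⟩ : ℂ)‖ with hρ
    have hρ0 : 0 ≤ ρ := norm_nonneg _
    have h6 := (abs_le.mp h2).2
    have h7 : ρ * (Real.cos (Complex.arg ⟨1, -p⟩) * 1 +
      Real.sin (Complex.arg ⟨1, -p⟩) * (r * 0 - p * 1)) = 1 + p ^ 2 := by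
      linear_combination h3 - p * h4
    have h8 : 1 + p ^ 2 ≤ ρ := by
      rw [← h7]
      nlinarith
    nlinarith
  have hqr : q ^ 2 = 1 := by
    have h1 := (hG _).mp (hall (Real.pi / 2)) 0 1
    have h2 := N.homog q 1 0
    rw [Real.cos_pi_div_two, Real.sin_pi_div_two, h01, hp0] at h1
    simp only [mul_one, mul_zero, zero_add, one_mul, sub_zero] at h1 h2
    rw [h1, N.one, mul_one] at h2
    rw [← sq_abs, ← h2, one_pow]
  have hr' : r = -q := by
    rw [hp0] at hJ
    linear_combination q * hJ - r * hqr
  have h1 := (hG _).mp (hall (Complex.arg ⟨x, -q * y⟩)) 1 0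
  have h2 := N.homog ‖(⟨x, -q * y⟩ : ℂ)‖ (Real.cos (Complex.arg ⟨x, -q * y⟩))
    (-q * Real.sin (Complex.arg ⟨x, -q * y⟩))
  have h3 := Complex.norm_mul_cos_arg ⟨x, -q * y⟩
  have h4 := Complex.norm_mul_sin_arg ⟨x, -q * y⟩
  have h5 : ‖(⟨x, -q * y⟩ : ℂ)‖ ^ 2 = x ^ 2 + y ^ 2 := by
    rw [Complex.sq_norm, Complex.normSq_mk]
    linear_combination y ^ 2 * hqr
  rw [hp0, hr', N.one] at h1
  simp only [mul_one, mul_zero, zero_add, add_zero, sub_zero] at h1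
  rw [mul_comm (Real.sin _)] at h1
  rw [h1, mul_one, abs_norm, h3, mul_left_comm, h4, ← mul_assoc, neg_mul_neg, ← sq, hqr,
    one_mul] at h2
  rw [h2, h5]

theorem PlaneGauge.sq_eq (N : PlaneGauge n) {a b c d : ℝ → ℝ} (ha : Continuous a)
    (hd : Continuous d) (hdet : ∀ s, a s * d s - b s * c s = 1)
    (hinv : ∀ s x y, n (a s * x + b s * y) (c s * x + d s * y) = n x y) (h0 : a 0 + d 0 = -2)
    (h1 : ¬(a 1 = -1 ∧ b 1 = 0 ∧ c 1 = 0 ∧ d 1 = -1)) (x y : ℝ) : n x y ^ 2 = x ^ 2 + y ^ 2 := by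
  have ht : -2 < a 1 + d 1 := by
    by_contra h
    exact h1 (N.eq_neg_one (hdet 1) (hinv 1) (not_lt.mp h))
  obtain ⟨τ, hτ1, hτ2⟩ : ∃ τ, -1 < τ ∧ τ < min 1 ((a 1 + d 1) / 2) :=
    exists_between (lt_min (by norm_num) (by linarith))
  rw [lt_min_iff] at hτ2
  have hacos : Real.arccos τ < Real.pi := by
    rw [← Real.arccos_neg_one]
    exact Real.arccos_lt_arccos le_rfl hτ1 hτ2.1.le
  have hacos0 : 0 < Real.arccos τ := Real.arccos_pos.mpr hτ2.1
  have hπ := Real.pi_pos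
  obtain ⟨z, hz, hz1, hz2⟩ := exists_irrational_btwn
    (show Real.arccos τ / (2 * Real.pi) < Real.pi / (2 * Real.pi) by gcongr)
  rw [div_lt_iff₀ (by positivity)] at hz1
  rw [lt_div_iff₀ (by positivity)] at hz2
  have hcos : Real.cos (z * (2 * Real.pi)) < τ := by
    rw [← Real.cos_arccos hτ1.le hτ2.1.le]
    exact Real.cos_lt_cos_of_nonneg_of_le_pi hacos0.le hz2.le hz1
  have hsin : 0 < Real.sin (z * (2 * Real.pi)) :=
    Real.sin_pos_of_pos_of_lt_pi (hacos0.trans hz1) hz2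
  have hcos1 := Real.neg_one_le_cos (z * (2 * Real.pi))
  obtain ⟨s, -, hs⟩ := intermediate_value_Icc (zero_le_one (α := ℝ)) (ha.add hd).continuousOn
    (show 2 * Real.cos (z * (2 * Real.pi)) ∈ Set.Icc (a 0 + d 0) (a 1 + d 1) from
      ⟨by linarith, by linarith [hτ2.2]⟩)
  refine N.sq_of_irrational (hdet s) (hinv s) hs ?_ hsin.ne' x y
  rwa [mul_div_cancel_right₀ _ (by positivity)]

end Gauge

section OddPower

/-- The odd extension of `t ↦ t ^ β`. -/
noncomputable def oddRpow (β t : ℝ) : ℝ := max t 0 ^ β - max (-t) 0 ^ β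

variable {β : ℝ}

theorem oddRpow_neg (t : ℝ) : oddRpow β (-t) = -oddRpow β t := by
  simp only [oddRpow, neg_neg]
  ring

theorem oddRpow_of_nonneg (hβ : 0 < β) {t : ℝ} (ht : 0 ≤ t) : oddRpow β t = t ^ β := by
  rw [oddRpow, max_eq_left ht, max_eq_right (by linarith), Real.zero_rpow hβ.ne', sub_zero]

theorem abs_oddRpow (hβ : 0 < β) (t : ℝ) : |oddRpow β t| = |t| ^ β := by
  rcases le_total 0 t with h | h
  · rw [oddRpow_of_nonneg hβ h, abs_of_nonneg (by positivity), abs_of_nonneg h]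
  · rw [← neg_neg t, oddRpow_neg, oddRpow_of_nonneg hβ (neg_nonneg.mpr h), abs_neg, abs_neg,
      abs_of_nonneg (Real.rpow_nonneg (neg_nonneg.mpr h) _), abs_of_nonneg (neg_nonneg.mpr h)]

theorem continuous_oddRpow (hβ : 0 < β) : Continuous (oddRpow β) := by
  unfold oddRpow
  exact ((continuous_id.max continuous_const).rpow_const fun _ => Or.inr hβ.le).sub
    ((continuous_neg.max continuous_const).rpow_const fun _ => Or.inr hβ.le)

theorem oddRpow_mul (hβ : 0 < β) {l : ℝ} (hl : 0 < l) (t : ℝ) :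
    oddRpow β (l * t) = l ^ β * oddRpow β t := by
  have key : ∀ t, 0 ≤ t → oddRpow β (l * t) = l ^ β * oddRpow β t := fun t ht => by
    rw [oddRpow_of_nonneg hβ ht, oddRpow_of_nonneg hβ (by positivity), Real.mul_rpow hl.le ht]
  rcases le_total 0 t with h | h
  · exact key t h
  · have h1 := key (-t) (neg_nonneg.mpr h)
    rw [mul_neg, oddRpow_neg, oddRpow_neg, mul_neg] at h1
    exact neg_injective h1

end OddPower

section InvGauge

variable {Y : Type*} [MetricSpace Y] [InvSpace Y] {o : Y} {V : Type*} [NormedAddCommGroup V]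
  [InnerProductSpace ℝ V] {C : Chart o V} {α : ℝ} {Ψ : V → ℝ → Y} {η : V → V → ℝ} {φ : Y → Y}

/-- The power of the distance to the base point that is homogeneous of degree one on the plane
spanned by a direction and the fiber. -/
noncomputable def planeDist (Ψ : V → ℝ → Y) (o : Y) (α : ℝ) (w : V) (s t : ℝ) : ℝ :=
  dist o (Ψ (oddRpow α⁻¹ t • w) s) ^ α

theorem Coord.inv_pos (H : Coord C α Ψ η) : 0 < α⁻¹ := _root_.inv_pos.mpr H.pos

theorem Coord.planeDist_of_pos (H : Coord C α Ψ η) (w : V) (s : ℝ) {r : ℝ} (hr : 0 ≤ r) :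
    planeDist Ψ o α w s (r ^ α) = dist o (Ψ (r • w) s) ^ α := by
  rw [planeDist, oddRpow_of_nonneg H.inv_pos (by positivity), Real.rpow_rpow_inv hr H.pos.ne']

theorem Coord.planeDist_one (H : Coord C α Ψ η) (w : V) : planeDist Ψ o α w 1 0 = 1 := by
  rw [planeDist, oddRpow_of_nonneg H.inv_pos le_rfl, Real.zero_rpow H.inv_pos.ne', zero_smul,
    H.dist_zero, abs_one, Real.one_rpow, Real.one_rpow]

theorem Coord.planeDist_neg (H : Coord C α Ψ η) (w : V) (s t : ℝ) :
    planeDist Ψ o α w (-s) (-t) = planeDist Ψ o α w s t := by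
  rw [planeDist, oddRpow_neg, neg_smul, H.dist_neg, planeDist]

theorem planeDist_neg_dir (w : V) (s t : ℝ) :
    planeDist Ψ o α (-w) s (-t) = planeDist Ψ o α w s t := by
  rw [planeDist, oddRpow_neg, neg_smul_neg, planeDist]

theorem Coord.planeDist_mul (H : Coord C α Ψ η) (w : V) (l s t : ℝ) :
    planeDist Ψ o α w (l * s) (l * t) = |l| * planeDist Ψ o α w s t := by
  have key : ∀ l : ℝ, 0 < l →
      planeDist Ψ o α w (l * s) (l * t) = l * planeDist Ψ o α w s t := fun l hl => by
    have h1 := H.dist_smul (l ^ α⁻¹) (by positivity) (oddRpow α⁻¹ t • w) s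
    rw [Real.rpow_inv_rpow hl.le H.pos.ne', smul_smul] at h1
    rw [planeDist, oddRpow_mul H.inv_pos hl, h1, Real.mul_rpow (by positivity) dist_nonneg,
      Real.rpow_inv_rpow hl.le H.pos.ne', planeDist]
  rcases lt_trichotomy l 0 with h | rfl | h
  · have h1 := key (-l) (by linarith)
    rwa [neg_mul, neg_mul, H.planeDist_neg, ← abs_of_neg h] at h1
  · rw [zero_mul, zero_mul, abs_zero, zero_mul, planeDist, oddRpow_of_nonneg H.inv_pos le_rfl,
      Real.zero_rpow H.inv_pos.ne', zero_smul, H.zero, dist_self, Real.zero_rpow H.pos.ne']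
  · rw [key l h, abs_of_pos h]

theorem Coord.planeDist_inv (H : Coord C α Ψ η) (hφ : IsInv o 1 φ) {w v : V} (hw : w ≠ 0)
    {a h ρ : ℝ} (hρ : 0 ≤ ρ) (hφw : φ (Ψ w a) = Ψ (ρ • v) h) (x y : ℝ) :
    planeDist Ψ o α w x y = dist o (Ψ w a) ^ α *
      planeDist Ψ o α v (-h * x + (a * h + 1) * y) (-ρ ^ α * x + a * ρ ^ α * y) := by
  have hne : Ψ w a ≠ o := H.ne_center (Or.inl hw)
  rcases eq_or_ne y 0 with rfl | hy
  · have h1 := H.planeDist_mul w x 1 0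
    have h2 := H.planeDist_mul v (-x) h (ρ ^ α)
    have h3 := hφ.dist_center _ hne
    rw [H.planeDist_of_pos v h hρ, ← hφw] at h2
    rw [H.planeDist_one, mul_one, mul_zero, mul_one] at h1
    rw [h1, mul_zero, add_zero, mul_zero, add_zero, show -h * x = -x * h by ring,
      show -ρ ^ α * x = -x * ρ ^ α by ring, h2, abs_neg, mul_left_comm,
      ← Real.mul_rpow dist_nonneg dist_nonneg, dist_comm o, dist_comm o, mul_comm (dist _ o), h3,
      one_pow, Real.one_rpow, mul_one]
  · obtain ⟨X, rfl⟩ : ∃ X, x = y * X := ⟨x / y, by field_simp⟩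
    have h1 := H.planeDist_mul w y X 1
    have h2 := H.planeDist_mul v y (-h * X + (a * h + 1)) (-ρ ^ α * X + a * ρ ^ α)
    rw [mul_one] at h1
    rw [show -h * (y * X) + (a * h + 1) * y = y * (-h * X + (a * h + 1)) by ring,
      show -ρ ^ α * (y * X) + a * ρ ^ α * y = y * (-ρ ^ α * X + a * ρ ^ α) by ring, h1, h2,
      mul_left_comm]
    congr 1
    have hone : planeDist Ψ o α w X 1 = dist o (Ψ w X) ^ α := by
      have := H.planeDist_of_pos w X zero_le_one
      rwa [Real.one_rpow, one_smul] at this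
    rw [hone]
    obtain ⟨z, rfl⟩ : ∃ z, X = a - z := ⟨a - X, by ring⟩
    rcases eq_or_ne z 0 with rfl | hz
    · rw [show -h * (a - 0) + (a * h + 1) = 1 by ring,
        show -ρ ^ α * (a - 0) + a * ρ ^ α = 0 by ring, H.planeDist_one, mul_one, sub_zero]
    · have h3 := hφ.dist_mul _ _ (H.ne_center (w := 0) (a := z) (Or.inr hz)) hne
      have h4 := H.planeDist_mul v z (h + z⁻¹) (ρ ^ α)
      rw [H.planeDist_of_pos v _ hρ] at h4
      rw [H.inv_fiber hφ hz, hφw, H.dist_eq, H.dist_eq 0 z, H.cocycle_zero_left,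
        H.cocycle_zero_left, sub_zero, sub_zero, sub_zero, sub_zero, sub_neg_eq_add, one_pow,
        one_mul, dist_comm _ o, dist_comm _ o, H.dist_zero] at h3
      rw [show -h * (a - z) + (a * h + 1) = z * (h + z⁻¹) by field_simp; ring,
        show -ρ ^ α * (a - z) + a * ρ ^ α = z * ρ ^ α by ring, h4, ← h3,
        Real.mul_rpow dist_nonneg (by positivity), Real.mul_rpow (by positivity) dist_nonneg,
        Real.rpow_inv_rpow (abs_nonneg z) H.pos.ne']
      ring

theorem Coord.inv_unit (H : Coord C α Ψ η) (hφ : IsInv o 1 φ) {w : V} (hw : ‖w‖ = 1) :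
    φ (Ψ w 0) = Ψ (-w) 0 := by
  have h := hφ.map_line _ (C.isometry_tr w hw o) (by rw [zero_smul, C.tr_zero]) 1 one_ne_zero
  simp only [one_smul, one_pow, div_one, neg_smul, H.tr_base] at h
  exact h

theorem Coord.planeGauge (H : Coord C α Ψ η) (hφ : IsInv o 1 φ) {w : V} (hw : ‖w‖ = 1) :
    PlaneGauge (planeDist Ψ o α w) where
  cont := by
    unfold planeDist
    refine (continuous_const.dist (H.cont.comp (((continuous_oddRpow H.inv_pos).comp
      continuous_snd).smul continuous_const |>.prodMk continuous_fst))).rpow_const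
      fun _ => Or.inr H.pos.le
  homog := H.planeDist_mul w
  one := H.planeDist_one w
  symm x y := by
    have hw0 : w ≠ 0 := by
      rintro rfl
      simp at hw
    have h := H.planeDist_inv hφ hw0 (v := -w) (a := 0) (h := 0) (ρ := 1) zero_le_one
      (by rw [one_smul, H.inv_unit hφ hw]) x y
    rw [H.dist_base, hw, Real.one_rpow, one_mul, show -0 * x + (0 * 0 + 1) * y = y by ring,
      show -1 * x + 0 * 1 * y = -x by ring, planeDist_neg_dir] at h
    exact h
  le x y := by
    have h := H.norm_le_dist (oddRpow α⁻¹ y • w) x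
    rw [norm_smul, hw, mul_one, Real.norm_eq_abs, abs_oddRpow H.inv_pos] at h
    have h1 := Real.rpow_le_rpow (by positivity) h H.pos.le
    rwa [Real.rpow_inv_rpow (abs_nonneg y) H.pos.ne'] at h1

theorem Coord.continuous_height (H : Coord C α Ψ η) {w : ℝ → V} {h : ℝ → ℝ}
    (hc : Continuous fun s => Ψ (w s) (h s)) : Continuous h := by
  have hw : Continuous w := by
    have := C.continuous_proj.comp hc
    simpa only [Function.comp_def, H.proj] using this
  refine H.cont_of_comp h ?_
  have h1 : ∀ s, Ψ 0 (h s) = C.tr (-w s) (Ψ (w s) (h s)) := fun s => by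
    have h2 := H.cocycle_smul (w s) 1 (-1)
    rw [one_smul, neg_one_smul] at h2
    rw [H.tr, h2, add_neg_cancel, add_zero]
  simp only [h1]
  exact C.continuous_tr.comp (hw.neg.prodMk hc)

theorem Coord.planeDist_sq (H : Coord C α Ψ η) (hφ : IsInv o 1 φ) {w : V} (hw : ‖w‖ = 1)
    (x y : ℝ) : planeDist Ψ o α w x y ^ 2 = x ^ 2 + y ^ 2 := by
  have hw0 : w ≠ 0 := by
    rintro rfl
    simp at hw
  choose u h hu using fun a : ℝ => H.surj (φ (Ψ w a))
  have hne : ∀ a, Ψ w a ≠ o := fun a => H.ne_center (Or.inl hw0)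
  have hcont : Continuous fun a => Ψ (u a) (h a) := by
    simp only [hu]
    exact hφ.continuousOn.comp_continuous
      (H.cont.comp (continuous_const.prodMk continuous_id)) hne
  have hh : Continuous h := H.continuous_height hcont
  have huc : Continuous u := by
    have := C.continuous_proj.comp hcont
    simpa only [Function.comp_def, H.proj] using this
  have hu0 : ∀ a, u a ≠ 0 := fun a h0 => by
    have h1 := hu a
    rw [h0] at h1
    rcases eq_or_ne (h a) 0 with h2 | h2
    · rw [h2, H.zero] at h1
      exact hφ.ne_center (hne a) h1.symm
    · have h3 := congrArg φ h1
      rw [hφ.invol, H.inv_fiber hφ h2] at h3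
      exact hw0 (H.inj h3).1.symm
  obtain ⟨D, hD⟩ : ∃ D : ℝ → ℝ, ∀ a, D a = ‖u a‖ ^ α := ⟨_, fun _ => rfl⟩
  have hDpos : ∀ a, 0 < D a := fun a => by
    have := norm_pos_iff.mpr (hu0 a)
    rw [hD]
    positivity
  have hDc : Continuous D := by
    rw [show D = fun a => ‖u a‖ ^ α from funext hD]
    exact huc.norm.rpow_const fun _ => Or.inr H.pos.le
  have hkey : ∀ a x y, planeDist Ψ o α w x y = dist o (Ψ w a) ^ α *
      planeDist Ψ o α (‖u a‖⁻¹ • u a) (-h a * x + (a * h a + 1) * y) (-D a * x + a * D a * y) := by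
    intro a x y
    rw [hD]
    refine H.planeDist_inv hφ hw0 (norm_nonneg _) ?_ x y
    rw [smul_smul, mul_inv_cancel₀ (norm_ne_zero_iff.mpr (hu0 a)), one_smul, hu]
  have hsymm : ∀ a x y, planeDist Ψ o α (‖u a‖⁻¹ • u a) x y =
      planeDist Ψ o α (‖u a‖⁻¹ • u a) y x := fun a =>
    (H.planeGauge hφ (by rw [norm_smul, norm_inv, norm_norm,
      inv_mul_cancel₀ (norm_ne_zero_iff.mpr (hu0 a))])).symm
  have hu00 : u 0 = -w ∧ h 0 = 0 := by
    have h1 := hu 0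
    rw [H.inv_unit hφ hw] at h1
    exact H.inj h1
  have hD0 : D 0 = 1 := by rw [hD, hu00.1, norm_neg, hw, Real.one_rpow]
  have N := H.planeGauge hφ hw
  refine N.sq_eq (a := fun a => (h a ^ 2 - D a ^ 2) / D a)
    (b := fun a => (a * D a ^ 2 - h a * (a * h a + 1)) / D a)
    (c := fun a => (h a * (a * h a + 1) - a * D a ^ 2) / D a)
    (d := fun a => (a ^ 2 * D a ^ 2 - (a * h a + 1) ^ 2) / D a) ?_ ?_ ?_ ?_ ?_ ?_ x y
  · exact ((hh.pow 2).sub (hDc.pow 2)).div hDc fun a => (hDpos a).ne'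
  · exact (((continuous_id.pow 2).mul (hDc.pow 2)).sub
      (((continuous_id.mul hh).add continuous_const).pow 2)).div hDc fun a => (hDpos a).ne'
  · intro a
    have := (hDpos a).ne'
    field_simp
    ring
  · intro a x y
    have := (hDpos a).ne'
    rw [N.symm, hkey a, hkey a x y, hsymm a]
    congr 2 <;> field_simp <;> ring
  · rw [hu00.2, hD0]
    norm_num
  · rintro ⟨h1, h2, -, -⟩
    have := hDpos 1
    field_simp at h1 h2
    nlinarith

theorem Coord.dist_rpow (H : Coord C α Ψ η) (v : V) (h : ℝ) :
    (dist o (Ψ v h) ^ α) ^ 2 = (‖v‖ ^ α) ^ 2 + h ^ 2 := by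
  obtain ⟨φ, hφ⟩ := InvSpace.exists_inv o 1 one_pos
  rcases eq_or_ne v 0 with rfl | hv
  · rw [H.dist_zero, Real.rpow_inv_rpow (abs_nonneg h) H.pos.ne', norm_zero,
      Real.zero_rpow H.pos.ne', sq_abs]
    ring
  · have hv' := norm_ne_zero_iff.mpr hv
    have h1 := H.planeDist_sq hφ (w := ‖v‖⁻¹ • v)
      (by rw [norm_smul, norm_inv, norm_norm, inv_mul_cancel₀ hv']) h (‖v‖ ^ α)
    rw [H.planeDist_of_pos _ _ (norm_nonneg v), smul_smul, mul_inv_cancel₀ hv', one_smul] at h1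
    rw [h1, add_comm]

end InvGauge

section InvBase

variable {Y : Type*} [MetricSpace Y] [InvSpace Y] {o : Y} {V : Type*} [NormedAddCommGroup V]
  [InnerProductSpace ℝ V] {C : Chart o V} {α : ℝ} {Ψ : V → ℝ → Y} {η : V → V → ℝ} {φ : Y → Y}

theorem Coord.inner_inv (H : Coord C α Ψ η) (hφ : IsInv o 1 φ) {v : V} (hv : v ≠ 0) (a : ℝ)
    (u : V) : α * (dist o (Ψ v a) ^ α) ^ 2 * inner ℝ u (C.proj (φ (Ψ v a))) =
      -(α * (‖v‖ ^ 2) ^ (α - 1) * inner ℝ u v) + a * η v u := by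
  have hN : 0 < dist o (Ψ v a) := dist_pos.mpr (H.ne_center (Or.inl hv)).symm
  have hv0 : 0 < ‖v‖ := norm_pos_iff.mpr hv
  have hg := H.hasDerivAt_dist hφ (Or.inl hv) (a := a) u
  have e0 : dist o (Ψ ((0 : ℝ) • u - v) (-a - 0 * η v u)) = dist o (Ψ v a) := by
    rw [zero_smul, zero_sub, zero_mul, sub_zero, H.dist_neg]
  have h1 := (hg.rpow_const (p := α) (Or.inl (by rw [e0]; exact hN.ne'))).pow 2
  rw [e0] at h1
  have hn : ∀ s : ℝ, ‖s • u - v‖ ^ 2 = s ^ 2 * ‖u‖ ^ 2 - 2 * s * inner ℝ u v + ‖v‖ ^ 2 := fun s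
    => by
    rw [norm_sub_sq_real, inner_smul_left, norm_smul, mul_pow, Real.norm_eq_abs, sq_abs]
    simp only [conj_trivial]
    ring
  have h2 : HasDerivAt (fun s : ℝ => ‖s • u - v‖ ^ 2) (-2 * inner ℝ u v) 0 := by
    simp only [hn]
    have := (((hasDerivAt_id (0 : ℝ)).pow 2).mul_const (‖u‖ ^ 2)).sub
      (((hasDerivAt_id (0 : ℝ)).const_mul 2).mul_const (inner ℝ u v)) |>.add_const (‖v‖ ^ 2)
    exact this.congr_deriv (by simp)
  have h3 := h2.rpow_const (p := α) (Or.inl (by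
    rw [zero_smul, zero_sub, norm_neg]; positivity))
  have h4 : HasDerivAt (fun s : ℝ => (-a - s * η v u) ^ 2) (2 * a * η v u) 0 := by
    have := (((hasDerivAt_id (0 : ℝ)).mul_const (η v u)).const_sub (-a)).pow 2
    exact this.congr_deriv (by simp)
  have h5 := h3.add h4
  have h6 := h1.unique (h5.congr_of_eventuallyEq (Eventually.of_forall fun s => by
    simp only [Pi.pow_apply, Pi.add_apply]
    rw [H.dist_rpow, ← Real.rpow_natCast, ← Real.rpow_mul (norm_nonneg _), mul_comm,
      Real.rpow_mul (norm_nonneg _), Real.rpow_natCast]))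
  have h7 : dist o (Ψ v a) ^ (α - 1) * dist o (Ψ v a) = dist o (Ψ v a) ^ α := by
    rw [Real.rpow_sub_one hN.ne', div_mul_cancel₀ _ hN.ne']
  rw [zero_smul, zero_sub, norm_neg] at h6
  simp only [Nat.cast_ofNat, Nat.add_one_sub_one, pow_one] at h6
  have h8 : α * (dist o (Ψ v a) ^ α) ^ 2 * inner ℝ u (C.proj (φ (Ψ v a))) =
      α * dist o (Ψ v a) ^ α * (dist o (Ψ v a) ^ (α - 1) * dist o (Ψ v a)) *
        inner ℝ u (C.proj (φ (Ψ v a))) := by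
    rw [h7]; ring
  rw [h8]
  linarith

theorem Coord.inv_ne_zero (H : Coord C α Ψ η) (hφ : IsInv o 1 φ) {v : V} (hv : v ≠ 0) (a : ℝ) :
    C.proj (φ (Ψ v a)) ≠ 0 := by
  intro h0
  have h := H.inner_inv hφ hv a v
  rw [h0, inner_zero_right, H.cocycle_self, mul_zero, mul_zero, add_zero,
    real_inner_self_eq_norm_sq] at h
  have h1 := norm_pos_iff.mpr hv
  have h2 := H.pos
  have h3 : 0 < α * (‖v‖ ^ 2) ^ (α - 1) * ‖v‖ ^ 2 := by positivity
  linarith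

theorem Coord.inner_inv_inv (H : Coord C α Ψ η) (hφ : IsInv o 1 φ) {v w : V} (hv : v ≠ 0) {a h : ℝ}
    (hw : φ (Ψ v a) = Ψ w h) (u : V) : α * inner ℝ u v =
      (dist o (Ψ v a) ^ α) ^ 2 * (-(α * (‖w‖ ^ 2) ^ (α - 1) * inner ℝ u w) + h * η w u) := by
  have hw0 : w ≠ 0 := by
    have := H.inv_ne_zero hφ hv a
    rwa [hw, H.proj] at this
  have h1 := H.inner_inv hφ hw0 h u
  rw [← hw, hφ.invol, H.proj, hw] at h1
  rw [← h1]
  have h2 := hφ.dist_center _ (H.ne_center (Or.inl hv) : Ψ v a ≠ o)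
  rw [hw, dist_comm _ o, dist_comm _ o, one_pow] at h2
  have h3 : dist o (Ψ v a) ^ α * dist o (Ψ w h) ^ α = 1 := by
    rw [← Real.mul_rpow dist_nonneg dist_nonneg, mul_comm, h2, Real.one_rpow]
  calc α * inner ℝ u v = α * inner ℝ u v * (dist o (Ψ v a) ^ α * dist o (Ψ w h) ^ α) ^ 2 := by
        rw [h3]; ring
    _ = _ := by ring

theorem Coord.exponent_eq (H : Coord C α Ψ η) {v : V} (hv : ‖v‖ = 1) : α = 2 := by
  by_contra hα
  obtain ⟨φ, hφ⟩ := InvSpace.exists_inv o 1 one_pos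
  have hv0 : v ≠ 0 := by
    rintro rfl
    simp at hv
  obtain ⟨w, h, hw⟩ := H.surj (φ (Ψ v 1))
  have h0 := H.pos
  have hN : (dist o (Ψ v 1) ^ α) ^ 2 = 2 := by
    rw [H.dist_rpow, hv, Real.one_rpow]; norm_num
  have h1 : w = -(1 / 2 : ℝ) • v := by
    refine ext_inner_left ℝ fun u => ?_
    have := H.inner_inv hφ hv0 1 u
    rw [hN, ← hw, H.proj, H.cocycle_eq_zero hα, hv, one_pow, Real.one_rpow] at this
    rw [inner_smul_right]
    have h2 : α * (2 * inner ℝ u w + inner ℝ u v) = 0 := by linarith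
    rcases mul_eq_zero.mp h2 with h3 | h3
    · exact absurd h3 h0.ne'
    · linarith
  have h2 := H.inner_inv_inv hφ hv0 hw.symm v
  rw [hN, H.cocycle_eq_zero hα, h1, norm_smul, inner_smul_right, real_inner_self_eq_norm_sq, hv]
    at h2
  have h3 : ((1 / 4 : ℝ)) ^ (α - 1) = 1 := by
    norm_num at h2
    have : α * ((1 / 4 : ℝ) ^ (α - 1) - 1) = 0 := by linarith
    rcases mul_eq_zero.mp this with h4 | h4
    · exact absurd h4 h0.ne'
    · linarith
  have h4 : ((1 / 4 : ℝ)) ^ (α - 1) < 1 :=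
    Real.rpow_lt_one (by norm_num) (by norm_num) (by linarith [H.one_lt])
  linarith

theorem Coord.norm_cocycle_vec (H : Coord C α Ψ η) {v k : V} (hv : ‖v‖ = 1)
    (hk : ∀ u, inner ℝ k u = η v u) : ‖k‖ = 2 := by
  obtain rfl : α = 2 := H.exponent_eq hv
  obtain ⟨φ, hφ⟩ := InvSpace.exists_inv o 1 one_pos
  have hv0 : v ≠ 0 := by
    rintro rfl
    simp at hv
  obtain ⟨w, h, hw⟩ := H.surj (φ (Ψ v 2))
  have hN : (dist o (Ψ v 2) ^ (2 : ℝ)) ^ 2 = 5 := by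
    rw [H.dist_rpow, hv, Real.one_rpow]; norm_num
  have h1 : (5 : ℝ) • w = k - v := by
    refine ext_inner_left ℝ fun u => ?_
    have := H.inner_inv hφ hv0 2 u
    rw [hN, ← hw, H.proj, ← hk, hv, one_pow, Real.one_rpow] at this
    rw [inner_smul_right, inner_sub_right, real_inner_comm k u]
    linarith
  have hkv : inner ℝ k v = 0 := by rw [hk, H.cocycle_self]
  have h2 : 25 * ‖w‖ ^ 2 = ‖k‖ ^ 2 + 1 := by
    have h3 := congrArg (fun x : V => ‖x‖ ^ 2) h1
    simp only [norm_smul] at h3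
    rw [norm_sub_sq_real, hkv, hv, mul_pow] at h3
    norm_num at h3
    linarith
  have h3 : 5 * inner ℝ w v = -1 := by
    have h3 := congrArg (fun x : V => inner ℝ x v) h1
    simp only [inner_smul_left, inner_sub_left, hkv, real_inner_self_eq_norm_sq, hv] at h3
    norm_num at h3
    linarith
  have h4 := H.inner_inv_inv hφ hv0 hw.symm w
  rw [hN, H.cocycle_self, real_inner_self_eq_norm_sq] at h4
  norm_num at h4
  have h5 : (‖k‖ ^ 2 + 1) ^ 2 = 25 := by nlinarith
  have h6 : ‖k‖ ^ 2 = 4 := by nlinarith [sq_nonneg ‖k‖]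
  nlinarith [norm_nonneg k]

/-- The cocycle is twice the symplectic form of a complex structure. -/
theorem Coord.exists_complex_structure [FiniteDimensional ℝ V] (H : Coord C α Ψ η) :
    ∃ J : V →ₗ[ℝ] V, (∀ v, ‖J v‖ = ‖v‖) ∧ (∀ v, J (J v) = -v) ∧
      ∀ v u, η v u = 2 * inner ℝ (J v) u := by
  choose K hK using H.exists_cocycle_vec
  have hKs : ∀ v (s : ℝ), K (s • v) = s • K v := fun v s => ext_inner_right ℝ fun u => by
    rw [hK, inner_smul_left, hK, H.cocycle_antisymm, H.cocycle_smul_right, H.cocycle_antisymm v]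
    simp
  let J : V →ₗ[ℝ] V :=
    { toFun := fun v => (1 / 2 : ℝ) • K v
      map_add' := fun v w => by
        rw [← smul_add]
        congr 1
        exact ext_inner_right ℝ fun u => by
          rw [inner_add_left, hK, hK, hK, H.cocycle_add_left]
      map_smul' := fun s v => by
        rw [hKs, smul_comm]; rfl }
  have hJ : ∀ v, J v = (1 / 2 : ℝ) • K v := fun _ => rfl
  have hη : ∀ v u, η v u = 2 * inner ℝ (J v) u := fun v u => by
    rw [hJ, inner_smul_left, hK]
    simp
  have hn : ∀ v, ‖J v‖ = ‖v‖ := fun v => by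
    rcases eq_or_ne v 0 with rfl | hv
    · simp
    · have hv' := norm_ne_zero_iff.mpr hv
      have h1 := H.norm_cocycle_vec (v := ‖v‖⁻¹ • v) (k := ‖v‖⁻¹ • K v)
        (by rw [norm_smul, norm_inv, norm_norm, inv_mul_cancel₀ hv'])
        (fun u => by rw [← hKs, hK])
      rw [norm_smul, norm_inv, norm_norm] at h1
      have h2 : ‖K v‖ = 2 * ‖v‖ := by
        field_simp at h1
        linarith
      rw [hJ, norm_smul, h2]
      norm_num
      ring
  refine ⟨J, hn, fun v => ext_inner_right ℝ fun u => ?_, hη⟩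
  have h1 : inner ℝ (J v) (J u) = inner ℝ v u := LinearIsometry.inner_map_map ⟨J, hn⟩ v u
  have h2 := hη (J v) u
  rw [H.cocycle_antisymm, hη, real_inner_comm, h1] at h2
  rw [inner_neg_left]
  linarith

end InvBase

section Complexify

variable {V : Type*} [NormedAddCommGroup V] [InnerProductSpace ℝ V]

/-- The complex vector space structure in which `Complex.I` acts as `J`. -/
@[reducible] noncomputable def complexModule (J : V →ₗ[ℝ] V) (h : ∀ v, J (J v) = -v) :
    Module ℂ V where
  smul z v := z.re • v + z.im • J v
  one_smul v := by
    change (1 : ℂ).re • v + (1 : ℂ).im • J v = v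
    simp
  mul_smul z w v := by
    change (z * w).re • v + (z * w).im • J v =
      z.re • (w.re • v + w.im • J v) + z.im • J (w.re • v + w.im • J v)
    simp only [Complex.mul_re, Complex.mul_im, map_add, map_smul, h]
    module
  smul_zero z := by
    change z.re • (0 : V) + z.im • J 0 = 0
    simp
  smul_add z v w := by
    change z.re • (v + w) + z.im • J (v + w) = z.re • v + z.im • J v + (z.re • w + z.im • J w)
    rw [map_add]
    module
  add_smul z w v := by
    change (z + w).re • v + (z + w).im • J v = z.re • v + z.im • J v + (w.re • v + w.im • J v)
    rw [Complex.add_re, Complex.add_im]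
    module
  zero_smul v := by
    change (0 : ℂ).re • v + (0 : ℂ).im • J v = 0
    simp

/-- The Hermitian structure in which `Complex.I` acts as `J`. -/
@[reducible] noncomputable def complexInner (J : V →ₗ[ℝ] V) (h : ∀ v, J (J v) = -v)
    (hs : ∀ v w, inner ℝ (J v) w = -inner ℝ v (J w)) : InnerProductSpace ℂ V :=
  let _ : Module ℂ V := complexModule J h
  { norm_smul_le := fun z v => by
      change ‖z.re • v + z.im • J v‖ ≤ ‖z‖ * ‖v‖
      have h0 : inner ℝ v (J v) = 0 := by
        have := hs v v
        rw [real_inner_comm] at this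
        linarith
      have h1 : ‖J v‖ = ‖v‖ := by
        rw [← sq_eq_sq₀ (norm_nonneg _) (norm_nonneg _), ← real_inner_self_eq_norm_sq, hs, h,
          inner_neg_right, neg_neg, real_inner_self_eq_norm_sq]
      refine le_of_sq_le_sq ?_ (by positivity)
      rw [norm_add_sq_real, inner_smul_left, inner_smul_right, h0, norm_smul, norm_smul, h1,
        mul_pow, mul_pow, mul_pow, Complex.sq_norm, Complex.normSq_apply, Real.norm_eq_abs,
        Real.norm_eq_abs, sq_abs, sq_abs]
      apply le_of_eq
      simp
      ring
    inner := fun v w => ⟨inner ℝ v w, inner ℝ (J v) w⟩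
    norm_sq_eq_re_inner := fun v => (real_inner_self_eq_norm_sq v).symm
    conj_inner_symm := fun v w => by
      refine Complex.ext ?_ ?_
      · exact real_inner_comm _ _
      · change -inner ℝ (J w) v = inner ℝ (J v) w
        rw [hs, neg_neg, real_inner_comm]
    add_left := fun u v w => by
      refine Complex.ext ?_ ?_
      · exact inner_add_left _ _ _
      · change inner ℝ (J (u + v)) w = inner ℝ (J u) w + inner ℝ (J v) w
        rw [map_add, inner_add_left]
    smul_left := fun v w z => by
      refine Complex.ext ?_ ?_
      · change inner ℝ (z.re • v + z.im • J v) w =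
          z.re * inner ℝ v w - -z.im * inner ℝ (J v) w
        rw [inner_add_left, inner_smul_left, inner_smul_left]
        simp
      · change inner ℝ (J (z.re • v + z.im • J v)) w =
          z.re * inner ℝ (J v) w + -z.im * inner ℝ v w
        rw [map_add, map_smul, map_smul, h, inner_add_left, inner_smul_left, inner_smul_left,
          inner_neg_left]
        simp }

theorem exists_complex_coords [FiniteDimensional ℝ V] (J : V →ₗ[ℝ] V) (hn : ∀ v, ‖J v‖ = ‖v‖)
    (h : ∀ v, J (J v) = -v) :
    ∃ (m : ℕ) (e : V ≃ EuclideanSpace ℂ (Fin m)), (∀ v w, ‖e v - e w‖ = ‖v - w‖) ∧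
      ∀ v w, (inner ℂ (e v) (e w)).im = inner ℝ (J v) w := by
  have hs : ∀ v w, inner ℝ (J v) w = -inner ℝ v (J w) := fun v w => by
    have h1 : inner ℝ (J (J v)) (J w) = inner ℝ (J v) w :=
      LinearIsometry.inner_map_map ⟨J, hn⟩ (J v) w
    rw [← h1, h, inner_neg_left]
  let _ : InnerProductSpace ℂ V := complexInner J h hs
  have hsm : ∀ (z : ℂ) (v : V), z • v = z.re • v + z.im • J v := fun _ _ => rfl
  have : IsScalarTower ℝ ℂ V := ⟨fun r z v => by
    rw [hsm, hsm]
    simp only [Complex.smul_re, Complex.smul_im]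
    module⟩
  have : FiniteDimensional ℂ V := Module.Finite.of_restrictScalars_finite ℝ ℂ V
  let b := (stdOrthonormalBasis ℂ V).repr
  refine ⟨_, b.toEquiv, fun v w => ?_, fun v w => ?_⟩
  · change ‖b v - b w‖ = _
    rw [← map_sub, b.norm_map]
  · change (inner ℂ (b v) (b w)).im = _
    rw [b.inner_map_map]
    rfl

end Complexify

section InvModel

variable {Y : Type*} [MetricSpace Y] [InvSpace Y] {o : Y}

theorem exists_heisenberg_coords
    (e : {y : Y | ∀ c : ℝ → Y, Isometry c → bus c y = bus c o} ≃ₜ ℝ) :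
    ∃ m : ℕ, 1 ≤ m ∧ ∃ Φ : Y → EuclideanSpace ℂ (Fin m) × ℝ, Function.Bijective Φ ∧
      ∀ x y : Y, dist x y ^ 4 = ‖(Φ x).1 - (Φ y).1‖ ^ 4 +
        16 * ((Φ x).2 - (Φ y).2 - (1 / 2) *
          (∑ i, (Φ x).1 i * (starRingEnd ℂ) ((Φ y).1 i)).im) ^ 2 := by
  obtain ⟨C⟩ := exists_chart o
  have := finiteDimensional_dirV o
  rw [C.fiber_eq] at e
  obtain ⟨β, p, hβ, hβ1, p0, hp, hps, hpd⟩ := C.exists_fiber_param e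
  have P : FiberParam C β⁻¹ p := ⟨(one_le_inv₀ hβ).mpr hβ1, p0, hp, hps, by rwa [inv_inv]⟩
  obtain ⟨η, H⟩ := P.exists_coord
  obtain ⟨c, hc, -⟩ := InvSpace.exists_line o
  obtain ⟨v, hv, -⟩ := C.exists_dir c hc
  have hα := H.exponent_eq hv
  obtain ⟨J, hJn, hJ, hη⟩ := H.exists_complex_structure
  obtain ⟨m, f, hf, hfi⟩ := exists_complex_coords J hJn hJ
  choose w a hwa using H.surj
  refine ⟨m, ?_, fun y => (f (w y), a y / 4), ⟨fun x y hxy => ?_, fun z => ?_⟩, fun x y => ?_⟩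
  · rw [Nat.one_le_iff_ne_zero]
    rintro rfl
    have h1 := hf v 0
    rw [Subsingleton.elim (f v) (f 0), sub_self, sub_zero, hv, norm_zero] at h1
    exact zero_ne_one h1
  · simp only [Prod.mk.injEq, EmbeddingLike.apply_eq_iff_eq] at hxy
    rw [← hwa x, ← hwa y, hxy.1, show a x = a y by linarith [hxy.2]]
  · refine ⟨C.tr (f.symm z.1) (p (4 * z.2)), ?_⟩
    obtain ⟨h1, h2⟩ := H.inj (hwa (C.tr (f.symm z.1) (p (4 * z.2))))
    beta_reduce
    rw [h1, h2, Equiv.apply_symm_apply, mul_div_cancel_left₀ _ (by norm_num : (4 : ℝ) ≠ 0)]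
  · have h1 := H.dist_rpow (w y - w x) (a y - a x - η (w x) (w y - w x))
    rw [← H.dist_eq (w x) (a x), hwa, hwa, hα, Real.rpow_two, Real.rpow_two, ← pow_mul, ← pow_mul,
      H.cocycle_sub_right, H.cocycle_self, sub_zero, hη, norm_sub_rev] at h1
    have h2 : (∑ i, f (w x) i * (starRingEnd ℂ) (f (w y) i)).im = -inner ℝ (J (w x)) (w y) := by
      have h3 := hfi (w x) (w y)
      rw [← h3, ← inner_conj_symm, Complex.conj_im, neg_neg]
      rfl
    simp only
    rw [h2, hf, h1]
    ring

end InvModel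

section MetricBasic

variable {X : Type*}

theorem ExtMetric.fd_self (d : ExtMetric X) (x : X) : d.fd x x = 0 := by
  simp [ExtMetric.fd, d.d_self]

theorem ExtMetric.fd_comm (d : ExtMetric X) (x y : X) : d.fd x y = d.fd y x := by
  simp only [ExtMetric.fd, d.symm x y]

theorem ExtMetric.fd_pos (d : ExtMetric X) {x y : X} (h : x ≠ y) : 0 < d.fd x y := by
  unfold ExtMetric.fd
  split_ifs with h1
  · exact one_pos
  · exact ENNReal.toReal_pos (d.pos x y h).ne' h1

theorem ExtMetric.fd_nonneg (d : ExtMetric X) (x y : X) : 0 ≤ d.fd x y := by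
  rcases eq_or_ne x y with rfl | h
  · rw [d.fd_self]
  · exact (d.fd_pos h).le

theorem ExtMetric.ne_top (d : ExtMetric X) {x y : X} (hx : d.rem ≠ some x) (hy : d.rem ≠ some y) :
    d.d x y ≠ ⊤ := by
  rw [Ne, d.d_eq_top_iff]
  tauto

theorem ExtMetric.fd_eq (d : ExtMetric X) {x y : X} (hx : d.rem ≠ some x) (hy : d.rem ≠ some y) :
    d.fd x y = (d.d x y).toReal := if_neg (d.ne_top hx hy)

theorem ExtMetric.fd_rem (d : ExtMetric X) {x ω : X} (h : d.rem = some ω) (hx : x ≠ ω) :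
    d.fd x ω = 1 := if_pos ((d.d_eq_top_iff _ _).mpr ⟨hx, Or.inr h⟩)

theorem ExtMetric.rem_ne {d : ExtMetric X} {ω : X} (h : d.rem = some ω) {x : X} (hx : x ≠ ω) :
    d.rem ≠ some x := by
  rw [h]
  simpa using hx.symm

theorem ExtMetric.ofReal_fd (d : ExtMetric X) {x y : X} (hx : d.rem ≠ some x)
    (hy : d.rem ≠ some y) : ENNReal.ofReal (d.fd x y) = d.d x y := by
  rw [d.fd_eq hx hy, ENNReal.ofReal_toReal (d.ne_top hx hy)]

/-- Conformally rescaled metrics are Möbius equivalent. -/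
theorem MobiusStructure.mem_of_fd (S : MobiusStructure X) {d d' : ExtMetric X} (hd : d ∈ S.M)
    {m : X → ℝ} (hm : ∀ x, 0 < m x) (h : ∀ x y, d'.fd x y = d.fd x y * (m x * m y)) : d' ∈ S.M := by
  refine S.maximal d' fun d₁ hd₁ x y z u ha => ?_
  refine (S.compat d hd d₁ hd₁ x y z u ha).trans'
    ⟨m x * m y * m z * m u, mul_pos (mul_pos (mul_pos (hm x) (hm y)) (hm z)) (hm u), ?_⟩
  simp only [crtVec, h, Prod.smul_mk, smul_eq_mul, Prod.mk.injEq]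
  refine ⟨?_, ?_, ?_⟩ <;> ring

/-- The metric obtained from `d` by inversion at `ω`. -/
noncomputable def invDist (d : ExtMetric X) (ω x y : X) : ℝ≥0∞ :=
  open Classical in
  if x = y then 0 else if x = ω ∨ y = ω then ⊤ else
    ENNReal.ofReal (d.fd x y / (d.fd x ω * d.fd y ω))

theorem fd_ptolemy {S : MobiusStructure X} (hpt : IsPtolemyStructure S) {d : ExtMetric X}
    (hd : d ∈ S.M) (x y z u : X) :
    d.fd x z * d.fd y u ≤ d.fd x y * d.fd z u + d.fd x u * d.fd y z := by
  by_cases ha : Admissible x y z u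
  · exact (hpt d hd x y z u ha).2.1
  · have h0 := d.fd_self
    unfold Admissible at ha
    have : (x = y ∧ y = z) ∨ (x = y ∧ y = u) ∨ (x = z ∧ z = u) ∨ (y = z ∧ z = u) := by tauto
    rcases this with ⟨rfl, rfl⟩ | ⟨rfl, rfl⟩ | ⟨rfl, rfl⟩ | ⟨rfl, rfl⟩ <;>
      simp [h0, d.fd_comm]

/-- Inversion at `ω` produces a metric with remote point `ω`. -/
noncomputable def invMetric {S : MobiusStructure X} (hpt : IsPtolemyStructure S) {d : ExtMetric X}
    (hd : d ∈ S.M) (ω : X) : ExtMetric X where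
  d := invDist d ω
  rem := some ω
  symm x y := by
    rw [invDist, invDist, d.fd_comm x y, mul_comm (d.fd x ω)]
    classical
    exact if_congr eq_comm rfl (if_congr or_comm rfl rfl)
  d_self x := by simp [invDist]
  pos x y h := by
    rw [invDist, if_neg h]
    split_ifs with h1
    · exact ENNReal.zero_lt_top
    · rw [not_or] at h1
      exact ENNReal.ofReal_pos.mpr (div_pos (d.fd_pos h) (mul_pos (d.fd_pos h1.1) (d.fd_pos h1.2)))
  triangle x y z := by
    by_cases hxz : x = z
    · simp [invDist, hxz]
    by_cases hxy : x = y
    · simp [hxy]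
    by_cases hyz : y = z
    · simp [hyz]
    by_cases hx : x = ω
    · simp [invDist, hx ▸ hxy, hx]
    by_cases hz : z = ω
    · simp [invDist, hz ▸ hyz, hz]
    by_cases hy : y = ω
    · simp [invDist, hy, hx]
    · have h1 := d.fd_pos hx
      have h2 := d.fd_pos hy
      have h3 := d.fd_pos hz
      simp only [invDist, hxz, hxy, hyz, hx, hy, hz, if_false, or_self]
      rw [← ENNReal.ofReal_add (div_nonneg (d.fd_nonneg _ _) (by positivity))
        (div_nonneg (d.fd_nonneg _ _) (by positivity))]
      refine ENNReal.ofReal_le_ofReal ?_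
      have h4 := fd_ptolemy hpt hd x y z ω
      rw [← sub_nonneg]
      have h5 : d.fd x y / (d.fd x ω * d.fd y ω) + d.fd y z / (d.fd y ω * d.fd z ω) -
          d.fd x z / (d.fd x ω * d.fd z ω) = (d.fd x y * d.fd z ω + d.fd x ω * d.fd y z -
            d.fd x z * d.fd y ω) / (d.fd x ω * d.fd y ω * d.fd z ω) := by
        field_simp
      rw [h5]
      exact div_nonneg (by linarith) (by positivity)
  d_eq_top_iff x y := by
    unfold invDist
    split_ifs with h1 h2
    · simp [h1]
    · simp [h1, Option.some.injEq, eq_comm (a := ω), h2]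
    · simp [Option.some.injEq, eq_comm (a := ω), h2]

theorem exists_metric_rem {S : MobiusStructure X} (hpt : IsPtolemyStructure S) (ω : X) :
    ∃ d ∈ S.M, d.rem = some ω := by
  classical
  obtain ⟨d, hd⟩ := S.nonempty
  refine ⟨invMetric hpt hd ω, S.mem_of_fd hd (m := fun x => if x = ω then 1 else (d.fd x ω)⁻¹)
    (fun x => ?_) fun x y => ?_, rfl⟩
  · split_ifs with h
    · exact one_pos
    · exact inv_pos.mpr (d.fd_pos h)
  · change (if invDist d ω x y = ⊤ then 1 else (invDist d ω x y).toReal) = _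
    unfold invDist
    by_cases hxy : x = y
    · simp [hxy, d.fd_self]
    by_cases hx : x = ω
    · subst hx
      have := (d.fd_pos (Ne.symm hxy)).ne'
      simp [hxy, d.fd_comm x y, Ne.symm hxy, this]
    by_cases hy : y = ω
    · subst hy
      have := (d.fd_pos hxy).ne'
      simp [hxy, this]
    · have h1 := d.fd_pos hx
      have h2 := d.fd_pos hy
      simp only [hxy, hx, hy, or_self, if_false, ENNReal.ofReal_ne_top]
      rw [ENNReal.toReal_ofReal (div_nonneg (d.fd_nonneg _ _) (by positivity))]
      field_simp

theorem mem_of_auto (S : MobiusStructure X) {d d' : ExtMetric X} (hd : d ∈ S.M) {f : X → X}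
    (hf : IsMobiusAuto S f) (h : ∀ x y, d'.d x y = d.d (f x) (f y)) : d' ∈ S.M := by
  refine S.maximal d' fun d₁ hd₁ x y z u ha => ?_
  refine (S.compat d hd d₁ hd₁ x y z u ha).trans' ?_
  have h1 := hf.2 d hd x y z u ha
  have h2 : crtVec d' x y z u = crtVec d (f x) (f y) (f z) (f u) := by
    simp only [crtVec, ExtMetric.fd, h]
  rwa [h2]

end MetricBasic

section Punctured

variable {X : Type*}

/-- The complement of the remote point of `d`. -/
structure Punct (d : ExtMetric X) {ω : X} (h : d.rem = some ω) where
  val : X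
  ne : val ≠ ω

variable {d : ExtMetric X} {ω : X} {h : d.rem = some ω}

theorem Punct.ext' {x y : Punct d h} (hxy : x.val = y.val) : x = y := by
  cases x
  cases y
  simpa using hxy

theorem Punct.ne_top (x y : Punct d h) : d.d x.val y.val ≠ ⊤ :=
  d.ne_top (d.rem_ne h x.ne) (d.rem_ne h y.ne)

noncomputable instance : MetricSpace (Punct d h) where
  dist x y := (d.d x.val y.val).toReal
  dist_self x := by simp [d.d_self]
  dist_comm x y := by rw [d.symm]
  dist_triangle x y z := by
    rw [← ENNReal.toReal_add (x.ne_top y) (y.ne_top z)]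
    exact ENNReal.toReal_mono (ENNReal.add_ne_top.mpr ⟨x.ne_top y, y.ne_top z⟩)
      (d.triangle _ _ _)
  eq_of_dist_eq_zero {x y} hxy := by
    by_contra hne
    have h1 : x.val ≠ y.val := fun h2 => hne (Punct.ext' h2)
    rw [ENNReal.toReal_eq_zero_iff] at hxy
    rcases hxy with h2 | h2
    · exact (d.pos _ _ h1).ne' h2
    · exact x.ne_top y h2

theorem Punct.dist_def (x y : Punct d h) : dist x y = (d.d x.val y.val).toReal := rfl

theorem Punct.dist_eq_fd (x y : Punct d h) : dist x y = d.fd x.val y.val :=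
  (d.fd_eq (d.rem_ne h x.ne) (d.rem_ne h y.ne)).symm

theorem Punct.edist_eq (x y : Punct d h) : d.d x.val y.val = ENNReal.ofReal (dist x y) := by
  rw [Punct.dist_def, ENNReal.ofReal_toReal (x.ne_top y)]

variable {S : MobiusStructure X}

theorem isOpen_mobius_ball (hd : d ∈ S.M) {x : X} (hx : d.rem ≠ some x) {r : ℝ} (hr : 0 < r) :
    IsOpen[mobiusTop S] {y | d.d y x < ENNReal.ofReal r} :=
  TopologicalSpace.isOpen_generateFrom_of_mem
    ⟨d, hd, x, hx, _, ENNReal.ofReal_pos.mpr hr, ENNReal.ofReal_ne_top, Or.inl rfl⟩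

theorem isOpen_mobius_coball (hd : d ∈ S.M) {x : X} (hx : d.rem ≠ some x) {r : ℝ} (hr : 0 < r) :
    IsOpen[mobiusTop S] {y | ENNReal.ofReal r < d.d y x} :=
  TopologicalSpace.isOpen_generateFrom_of_mem
    ⟨d, hd, x, hx, _, ENNReal.ofReal_pos.mpr hr, ENNReal.ofReal_ne_top, Or.inr rfl⟩

theorem t2_mobiusTop (hpt : IsPtolemyStructure S) : @T2Space X (mobiusTop S) := by
  let _ := mobiusTop S
  refine ⟨fun x y hxy => ?_⟩
  obtain ⟨d, hd, hy⟩ := exists_metric_rem hpt y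
  have hx : d.rem ≠ some x := d.rem_ne hy hxy
  refine ⟨_, _, isOpen_mobius_ball hd hx one_pos, isOpen_mobius_coball hd hx one_pos, ?_, ?_, ?_⟩
  · simp [d.d_self]
  · have : d.d y x = ⊤ := (d.d_eq_top_iff _ _).mpr ⟨hxy.symm, Or.inl hy⟩
    simp [this]
  · exact Set.disjoint_left.mpr fun z h1 h2 => lt_asymm (Set.mem_ofPred_eq ▸ h1) h2

/-- The identity map onto the punctured space. -/
def toPunct (h : d.rem = some ω) (x : {x : X // x ≠ ω}) : Punct d h := ⟨x.1, x.2⟩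

theorem continuous_toPunct (hd : d ∈ S.M) (h : d.rem = some ω) :
    letI := mobiusTop S
    Continuous (toPunct h) := by
  let _ := mobiusTop S
  rw [continuous_iff_continuousAt]
  intro a
  rw [ContinuousAt, Metric.tendsto_nhds]
  intro ε hε
  have h1 := (isOpen_mobius_ball hd (d.rem_ne h a.2) hε).preimage
    (continuous_subtype_val (p := fun x => x ≠ ω))
  filter_upwards [h1.mem_nhds (by simpa [d.d_self] using hε)] with x hx
  have h2 : d.d x.1 a.1 < ENNReal.ofReal ε := hx
  rw [show d.d x.1 a.1 = d.d (toPunct h x).val (toPunct h a).val from rfl, Punct.edist_eq] at h2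
  exact (ENNReal.ofReal_lt_ofReal_iff hε).mp h2

theorem isCompact_image_toPunct (hcomp : MobiusCompact S) (hd : d ∈ S.M) (h : d.rem = some ω)
    (A : Set {x : X // x ≠ ω}) (hA : letI := mobiusTop S; IsClosed A) (x : Punct d h) {r : ℝ}
    (hr : 0 < r) : IsCompact (toPunct h '' A ∩ Metric.closedBall x r) := by
  let _ := mobiusTop S
  have : CompactSpace X := hcomp
  have hB : IsClosed {y | d.d y x.val ≤ ENNReal.ofReal r} := by
    rw [← isOpen_compl_iff]
    convert isOpen_mobius_coball hd (d.rem_ne h x.ne) hr using 1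
    ext y
    simp
  have hsub : {y | d.d y x.val ≤ ENNReal.ofReal r} ⊆ Set.range ((↑) : {x : X // x ≠ ω} → X) := by
    intro y hy
    rw [Subtype.range_coe_subtype]
    rintro rfl
    have h1 : d.d y x.val = ⊤ := (d.d_eq_top_iff _ _).mpr ⟨x.ne.symm, Or.inl h⟩
    have h2 : d.d y x.val ≤ ENNReal.ofReal r := hy
    rw [h1] at h2
    exact ENNReal.ofReal_ne_top (top_le_iff.mp h2)
  have hK : IsCompact ((↑) ⁻¹' {y | d.d y x.val ≤ ENNReal.ofReal r} : Set {x : X // x ≠ ω}) :=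
    (Topology.IsInducing.subtypeVal.isCompact_preimage_iff hsub).mpr hB.isCompact
  convert (hK.inter_left hA).image (continuous_toPunct hd h) using 1
  rw [← Set.image_inter_preimage]
  congr 2
  ext y
  change dist (toPunct h y) x ≤ r ↔ d.d (toPunct h y).val x.val ≤ ENNReal.ofReal r
  rw [Punct.edist_eq, ENNReal.ofReal_le_ofReal_iff hr.le]

theorem surjective_toPunct (h : d.rem = some ω) : Function.Surjective (toPunct h) :=
  fun x => ⟨⟨x.val, x.ne⟩, rfl⟩

theorem injective_toPunct (h : d.rem = some ω) : Function.Injective (toPunct h) :=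
  fun _ _ hxy => Subtype.ext (congrArg Punct.val hxy)

theorem properSpace_punct (hcomp : MobiusCompact S) (hd : d ∈ S.M) (h : d.rem = some ω) :
    ProperSpace (Punct d h) := by
  refine ProperSpace.of_isCompact_closedBall_of_le 1 fun x r hr => ?_
  have h1 := isCompact_image_toPunct hcomp hd h Set.univ
    (@isClosed_univ _ (@instTopologicalSpaceSubtype _ _ (mobiusTop S))) x (one_pos.trans_le hr)
  rwa [Set.image_univ, (surjective_toPunct h).range_eq, Set.univ_inter] at h1

/-- The Möbius topology of the punctured space is the metric topology. -/
theorem exists_homeo_punct (hcomp : MobiusCompact S) (hd : d ∈ S.M) (h : d.rem = some ω) :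
    letI := mobiusTop S
    ∃ e : {x : X // x ≠ ω} ≃ₜ Punct d h, ∀ x, e x = toPunct h x := by
  let _ := mobiusTop S
  refine ⟨(Equiv.ofBijective _ ⟨injective_toPunct h,
    surjective_toPunct h⟩).toHomeomorphOfContinuousClosed
    (continuous_toPunct hd h) fun A hA => ?_, fun _ => rfl⟩
  change IsClosed (toPunct h '' A)
  refine isClosed_of_closure_subset fun x hx => ?_
  have h1 := (isCompact_image_toPunct hcomp hd h A hA x one_pos).isClosed
  refine (h1.closure_subset ?_).1
  rw [Metric.mem_closure_iff] at hx ⊢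
  intro ε hε
  obtain ⟨b, hb, hb1⟩ := hx (min ε 1) (by positivity)
  refine ⟨b, ⟨hb, ?_⟩, hb1.trans_le (min_le_left _ _)⟩
  rw [Metric.mem_closedBall, dist_comm]
  exact (hb1.trans_le (min_le_right _ _)).le

end Punctured

section Circle

variable {X : Type*} {S : MobiusStructure X}

theorem admissible_of_ne {x y z : X} (u : X) (hxy : x ≠ y) (hxz : x ≠ z) (hyz : y ≠ z) :
    Admissible x y z u :=
  ⟨fun h => hxy h.1, fun h => hxy h.1, fun h => hxz h.1, fun h => hyz h.1⟩

theorem fd_ptolemy_eq_congr {d d' : ExtMetric X} (hd : d ∈ S.M) (hd' : d' ∈ S.M) {x y z u : X}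
    (ha : Admissible x y z u)
    (h : d.fd x z * d.fd y u = d.fd x y * d.fd z u + d.fd x u * d.fd y z) :
    d'.fd x z * d'.fd y u = d'.fd x y * d'.fd z u + d'.fd x u * d'.fd y z := by
  obtain ⟨l, -, hl⟩ := S.compat d hd d' hd' x y z u ha
  simp only [crtVec, Prod.smul_mk, smul_eq_mul, Prod.mk.injEq] at hl
  rw [hl.1, hl.2.1, hl.2.2, h]
  ring

theorem dist_ptolemy_of_fd (d : ExtMetric X) {x y z u : X} (hxy : x ≠ y) (hxz : x ≠ z)
    (hyu : y ≠ u) (hzu : z ≠ u)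
    (h : d.fd x z * d.fd y u = d.fd x y * d.fd z u + d.fd x u * d.fd y z) :
    d.d x z * d.d y u = d.d x y * d.d z u + d.d x u * d.d y z := by
  have hp : ∀ {a b : X}, a ≠ b → d.d a b ≠ 0 := fun hab => (d.pos _ _ hab).ne'
  have ht : ∀ {a b : X}, a ≠ b → d.rem = some a → d.d a b = ⊤ := fun hab hr =>
    (d.d_eq_top_iff _ _).mpr ⟨hab, Or.inl hr⟩
  have ht' : ∀ {a b : X}, a ≠ b → d.rem = some b → d.d a b = ⊤ := fun hab hr =>
    (d.d_eq_top_iff _ _).mpr ⟨hab, Or.inr hr⟩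
  by_cases rx : d.rem = some x
  · rw [ht hxz rx, ht hxy rx, ENNReal.top_mul (hp hyu), ENNReal.top_mul (hp hzu), top_add]
  by_cases ry : d.rem = some y
  · rw [ht hyu ry, ht' hxy ry, ENNReal.mul_top (hp hxz), ENNReal.top_mul (hp hzu), top_add]
  by_cases rz : d.rem = some z
  · rw [ht' hxz rz, ht hzu rz, ENNReal.top_mul (hp hyu), ENNReal.mul_top (hp hxy), top_add]
  by_cases ru : d.rem = some u
  · rw [ht' hyu ru, ht' hzu ru, ENNReal.mul_top (hp hxz), ENNReal.mul_top (hp hxy), top_add]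
  rw [← d.ofReal_fd rx rz, ← d.ofReal_fd ry ru, ← d.ofReal_fd rx ry, ← d.ofReal_fd rz ru,
    ← d.ofReal_fd rx ru, ← d.ofReal_fd ry rz]
  have hn := d.fd_nonneg
  rw [← ENNReal.ofReal_mul (hn _ _), ← ENNReal.ofReal_mul (hn _ _), ← ENNReal.ofReal_mul (hn _ _),
    ← ENNReal.ofReal_add (mul_nonneg (hn _ _) (hn _ _)) (mul_nonneg (hn _ _) (hn _ _)), h]

theorem abs_add_of_mul_nonneg {p q : ℝ} (h : 0 ≤ p * q) : |p + q| = |p| + |q| := by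
  rw [abs_add_eq_add_abs_iff]
  exact mul_nonneg_iff.mp h

variable {d : ExtMetric X} {ω : X} {h : d.rem = some ω}

theorem isEmbedding_punct_val (hcomp : MobiusCompact S) (hd : d ∈ S.M) (h : d.rem = some ω) :
    letI := mobiusTop S
    IsEmbedding (Punct.val : Punct d h → X) := by
  let _ := mobiusTop S
  obtain ⟨e, he⟩ := exists_homeo_punct hcomp hd h
  convert IsEmbedding.subtypeVal.comp e.symm.isEmbedding using 1
  ext t
  rw [Function.comp_apply]
  conv_lhs => rw [← e.apply_symm_apply t, he]
  rfl

theorem isEmbedding_line (hcomp : MobiusCompact S) (hd : d ∈ S.M) {c : ℝ → Punct d h}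
    (hc : Isometry c) : letI := mobiusTop S
    IsEmbedding fun t => (c t).val := by
  let _ := mobiusTop S
  exact (isEmbedding_punct_val hcomp hd h).comp hc.isEmbedding

theorem tendsto_line (hcomp : MobiusCompact S) (hd : d ∈ S.M) {c : ℝ → Punct d h}
    (hc : Isometry c) : letI := mobiusTop S
    Tendsto (fun t => (c t).val) (cocompact ℝ) (𝓝 ω) := by
  let _ := mobiusTop S
  have : CompactSpace X := hcomp
  obtain ⟨e, he⟩ := exists_homeo_punct hcomp hd h
  rw [tendsto_nhds]
  intro U hU hωU
  have h1 : IsCompact ((↑) ⁻¹' Uᶜ : Set {x : X // x ≠ ω}) := by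
    refine (IsInducing.subtypeVal.isCompact_preimage_iff ?_).mpr hU.isClosed_compl.isCompact
    rw [Subtype.range_coe_subtype]
    rintro x hx rfl
    exact hx hωU
  have h2 := hc.isClosedEmbedding.isCompact_preimage (h1.image e.continuous)
  rw [mem_cocompact]
  refine ⟨_, h2, fun t ht => ?_⟩
  by_contra hn
  refine ht ⟨e.symm (c t), ?_, e.apply_symm_apply _⟩
  have h3 : (e.symm (c t)).1 = (c t).val := by
    conv_rhs => rw [← e.apply_symm_apply (c t), he]
    rfl
  rw [Set.mem_preimage, h3]
  exact hn

theorem exists_onePoint_homeo_circle :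
    Nonempty (OnePoint ℝ ≃ₜ Metric.sphere (0 : ℂ) 1) := by
  have e1 : OnePoint ℝ ≃ₜ Metric.sphere (0 : EuclideanSpace ℝ (Fin 2)) 1 :=
    onePointEquivSphereOfFinrankEq (by simp)
  have f := Complex.orthonormalBasisOneI.repr
  refine ⟨e1.trans (f.toHomeomorph.symm.subtype fun x => ?_)⟩
  change x ∈ _ ↔ f.symm x ∈ _
  rw [mem_sphere_zero_iff_norm, mem_sphere_zero_iff_norm, f.symm.norm_map]

theorem homeoToCircle_line (hpt : IsPtolemyStructure S) (hcomp : MobiusCompact S) (hd : d ∈ S.M)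
    {c : ℝ → Punct d h} (hc : Isometry c) :
    HomeoToCircle S (insert ω (Set.range fun t => (c t).val)) := by
  let _ := mobiusTop S
  have := t2_mobiusTop hpt
  have hemb := isEmbedding_line hcomp hd hc
  obtain ⟨g⟩ := exists_onePoint_homeo_circle
  let F : OnePoint ℝ → X := fun o => Option.elim o ω fun t => (c t).val
  have hFc : Continuous F := by
    rw [OnePoint.continuous_iff]
    refine ⟨?_, hemb.continuous⟩
    rw [coclosedCompact_eq_cocompact]
    exact tendsto_line hcomp hd hc
  have hFi : Function.Injective F := by
    intro a b hab
    induction a using OnePoint.rec with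
    | infty =>
      induction b using OnePoint.rec with
      | infty => rfl
      | coe b => exact absurd hab.symm (c b).ne
    | coe a =>
      induction b using OnePoint.rec with
      | infty => exact absurd hab (c a).ne
      | coe b => exact congrArg _ (hemb.injective hab)
  have hr : Set.range F = insert ω (Set.range fun t => (c t).val) := by
    ext x
    constructor
    · rintro ⟨a, rfl⟩
      induction a using OnePoint.rec with
      | infty => exact Or.inl rfl
      | coe a => exact Or.inr ⟨a, rfl⟩
    · rintro (rfl | ⟨a, rfl⟩)
      · exact ⟨OnePoint.infty, rfl⟩
      · exact ⟨(a : OnePoint ℝ), rfl⟩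
  rw [← hr]
  exact ⟨(hFc.isClosedEmbedding hFi).toIsEmbedding.toHomeomorph.symm.trans g⟩

theorem not_separatesIn {σ A : Set X} {x z y u : X}
    (hA : letI := mobiusTop S; IsPreconnected A) (hAσ : A ⊆ σ) (hx : x ∉ A) (hz : z ∉ A)
    (hy : y ∈ A) (hu : u ∈ A) : ¬SeparatesIn S σ x z y u := by
  let _ := mobiusTop S
  rw [SeparatesIn, not_not]
  have hsub : A ⊆ σ \ {x, z} := fun v hv => ⟨hAσ hv, by
    rintro (rfl | rfl)
    exacts [hx hv, hz hv]⟩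
  exact hA.subset_connectedComponentIn hy hsub hu

theorem isPreconnected_line_ray (hcomp : MobiusCompact S) (hd : d ∈ S.M) {c : ℝ → Punct d h}
    (hc : Isometry c) {A : Set ℝ} (hA : IsPreconnected A) {l : Filter ℝ} [l.NeBot] (hAl : A ∈ l)
    (hl : l ≤ cocompact ℝ) : letI := mobiusTop S
    IsPreconnected (insert ω ((fun t => (c t).val) '' A)) := by
  let _ := mobiusTop S
  refine (hA.image _ (isEmbedding_line hcomp hd hc).continuous.continuousOn).subset_closure
    (Set.subset_insert _ _) (Set.insert_subset ?_ subset_closure)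
  exact mem_closure_of_tendsto ((tendsto_line hcomp hd hc).mono_left hl)
    (mem_of_superset hAl fun t ht => ⟨t, ht, rfl⟩)

theorem isPreconnected_line_outside (hcomp : MobiusCompact S) (hd : d ∈ S.M) {c : ℝ → Punct d h}
    (hc : Isometry c) (a b : ℝ) : letI := mobiusTop S
    IsPreconnected (insert ω ((fun t => (c t).val) '' {v | 0 < (v - a) * (v - b)})) := by
  let _ := mobiusTop S
  have h1 : {v | 0 < (v - a) * (v - b)} = Set.Iio (min a b) ∪ Set.Ioi (max a b) := by
    ext v
    simp only [Set.mem_ofPred_eq, Set.mem_union, Set.mem_Iio, Set.mem_Ioi, lt_min_iff, max_lt_iff,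
      mul_pos_iff, sub_pos, sub_neg]
    tauto
  rw [h1, Set.image_union, Set.insert_union_distrib]
  exact (isPreconnected_line_ray hcomp hd hc isPreconnected_Iio (Iio_mem_atBot _)
    atBot_le_cocompact).union ω (Set.mem_insert _ _) (Set.mem_insert _ _)
    (isPreconnected_line_ray hcomp hd hc isPreconnected_Ioi (Ioi_mem_atTop _) atTop_le_cocompact)

theorem isPtolemyCircle_line (hpt : IsPtolemyStructure S) (hcomp : MobiusCompact S) (hd : d ∈ S.M)
    {c : ℝ → Punct d h} (hc : Isometry c) :
    IsPtolemyCircle S (insert ω (Set.range fun t => (c t).val)) := by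
  let _ := mobiusTop S
  have hemb := isEmbedding_line hcomp hd hc
  have hinj : ∀ {s t : ℝ}, (c s).val = (c t).val ↔ s = t := hemb.injective.eq_iff
  refine ⟨homeoToCircle_line hpt hcomp hd hc, fun d' hd' x hx y hy z hz u hu hxy hxz hxu hyz hyu hzu
    hsep => dist_ptolemy_of_fd d' hxy hxz hyu hzu
      (fd_ptolemy_eq_congr hd hd' (admissible_of_ne u hxy hxz hyz) ?_)⟩
  have hfd : ∀ s t, d.fd (c s).val (c t).val = |s - t| := fun s t => by
    rw [← Punct.dist_eq_fd, hc.dist_eq, Real.dist_eq]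
  have hω : ∀ t, d.fd (c t).val ω = 1 := fun t => d.fd_rem h (c t).ne
  have hω' : ∀ t, d.fd ω (c t).val = 1 := fun t => by rw [d.fd_comm, hω]
  have hcω : ∀ t, (c t).val ≠ ω := fun t => (c t).ne
  have hsub : ∀ A : Set ℝ, (fun t => (c t).val) '' A ⊆ insert ω (Set.range fun t => (c t).val) :=
    fun A => (Set.image_subset_range _ _).trans (Set.subset_insert _ _)
  have himg : ∀ {A : Set ℝ}, IsPreconnected A → IsPreconnected ((fun t => (c t).val) '' A) :=
    fun hA => hA.image _ hemb.continuous.continuousOn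
  have hmem : ∀ {A : Set ℝ} {t : ℝ}, (c t).val ∈ (fun t => (c t).val) '' A ↔ t ∈ A := fun {A t} =>
    ⟨fun ⟨s, hs, hst⟩ => hinj.mp hst ▸ hs, fun ht => ⟨t, ht, rfl⟩⟩
  have hωim : ∀ A : Set ℝ, ω ∉ (fun t => (c t).val) '' A := fun A ⟨s, _, hs⟩ => hcω s hs
  -- a finite point separates two others from the remote point
  have hray : ∀ {b s t : ℝ} {p q : X}, (p = ω ∧ q = (c b).val ∨ p = (c b).val ∧ q = ω) → s ≠ b →
      t ≠ b → SeparatesIn S (insert ω (Set.range fun t => (c t).val)) p q (c s).val (c t).val →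
      (s - b) * (t - b) ≤ 0 := by
    intro b s t p q hpq hs ht hsep
    by_contra hn
    have key : ∀ A : Set ℝ, IsPreconnected A → b ∉ A → s ∈ A → t ∈ A → False := by
      intro A hA hb hs ht
      refine not_separatesIn (himg hA) (hsub A) ?_ ?_ (hmem.mpr hs) (hmem.mpr ht) hsep
      · rcases hpq with ⟨rfl, rfl⟩ | ⟨rfl, rfl⟩
        · exact hωim A
        · rwa [hmem]
      · rcases hpq with ⟨rfl, rfl⟩ | ⟨rfl, rfl⟩
        · rwa [hmem]
        · exact hωim A
    rw [not_le, mul_pos_iff] at hn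
    rcases hn with ⟨h1, h2⟩ | ⟨h1, h2⟩
    · exact key (Set.Ioi b) isPreconnected_Ioi (lt_irrefl b) (sub_pos.mp h1) (sub_pos.mp h2)
    · exact key (Set.Iio b) isPreconnected_Iio (lt_irrefl b) (sub_neg.mp h1) (sub_neg.mp h2)
  have hout : ∀ {a b : ℝ} {p q : X}, p ∈ insert ω ((fun t => (c t).val) ''
    {v | 0 < (v - a) * (v - b)}) →
      q ∈ insert ω ((fun t => (c t).val) '' {v | 0 < (v - a) * (v - b)}) →
      ¬SeparatesIn S (insert ω (Set.range fun t => (c t).val)) (c a).val (c b).val p q := by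
    intro a b p q hp hq
    refine not_separatesIn (isPreconnected_line_outside hcomp hd hc a b)
      (Set.insert_subset_insert (Set.image_subset_range _ _)) ?_ ?_ hp hq
    · rintro (h1 | h1)
      · exact hcω a h1
      · rw [hmem] at h1
        simp at h1
    · rintro (h1 | h1)
      · exact hcω b h1
      · rw [hmem] at h1
        simp at h1
  have hin : ∀ {a b s t : ℝ}, (s - a) * (s - b) < 0 → (t - a) * (t - b) < 0 →
      ¬SeparatesIn S (insert ω (Set.range fun t => (c t).val)) (c a).val (c b).val (c s).val
        (c t).val := by
    intro a b s t hs ht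
    have h1 : ∀ v, (v - a) * (v - b) < 0 → v ∈ Set.Ioo (min a b) (max a b) := fun v hv => by
      rw [mul_neg_iff, sub_pos, sub_neg, sub_neg, sub_pos] at hv
      rw [Set.mem_Ioo, min_lt_iff, lt_max_iff]
      tauto
    refine not_separatesIn (himg (isPreconnected_Ioo (a := min a b) (b := max a b))) (hsub _) ?_ ?_
      (hmem.mpr (h1 s hs)) (hmem.mpr (h1 t ht))
    · rw [hmem, Set.mem_Ioo, min_lt_iff, lt_max_iff]
      rintro ⟨h2 | h2, h3 | h3⟩ <;> linarith
    · rw [hmem, Set.mem_Ioo, min_lt_iff, lt_max_iff]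
      rintro ⟨h2 | h2, h3 | h3⟩ <;> linarith
  rcases hx with rfl | ⟨a, rfl⟩
  · rcases hy with rfl | ⟨s, rfl⟩
    · exact absurd rfl hxy
    rcases hz with rfl | ⟨b, rfl⟩
    · exact absurd rfl hxz
    rcases hu with rfl | ⟨t, rfl⟩
    · exact absurd rfl hxu
    have h1 := hray (Or.inl ⟨rfl, rfl⟩) (fun h => hyz (hinj.mpr h))
      (fun h => hzu (hinj.mpr h.symm)) hsep
    simp only [hfd, hω']
    rw [one_mul, one_mul, one_mul, ← abs_add_of_mul_nonneg (by linarith)]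
    congr 1
    ring
  rcases hz with rfl | ⟨b, rfl⟩
  · rcases hy with rfl | ⟨s, rfl⟩
    · exact absurd rfl hyz
    rcases hu with rfl | ⟨t, rfl⟩
    · exact absurd rfl hzu
    have h1 := hray (Or.inr ⟨rfl, rfl⟩) (fun h => hxy (hinj.mpr h.symm))
      (fun h => hxu (hinj.mpr h.symm)) hsep
    simp only [hfd, hω, hω']
    rw [one_mul, mul_one, mul_one, abs_sub_comm a s, ← abs_add_of_mul_nonneg (by linarith)]
    congr 1
    ring
  rcases hy with rfl | ⟨s, rfl⟩
  · rcases hu with rfl | ⟨t, rfl⟩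
    · exact absurd rfl hyu
    have h1 : (t - a) * (t - b) ≤ 0 := by
      by_contra hn
      exact hout (Set.mem_insert _ _) (Or.inr (hmem.mpr (not_le.mp hn))) hsep
    simp only [hfd, hω, hω']
    rw [one_mul, mul_one, mul_one, abs_sub_comm b t, ← abs_add_of_mul_nonneg (by linarith)]
    congr 1
    ring
  have hs0 : (s - a) * (s - b) ≠ 0 := mul_ne_zero
    (sub_ne_zero.mpr fun h => hxy (hinj.mpr h.symm)) (sub_ne_zero.mpr fun h => hyz (hinj.mpr h))
  rcases hu with rfl | ⟨t, rfl⟩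
  · have h1 : (s - a) * (s - b) ≤ 0 := by
      by_contra hn
      exact hout (Or.inr (hmem.mpr (not_le.mp hn))) (Set.mem_insert _ _) hsep
    simp only [hfd, hω]
    rw [one_mul, mul_one, mul_one, ← abs_add_of_mul_nonneg (by linarith)]
    congr 1
    ring
  · have ht0 : (t - a) * (t - b) ≠ 0 := mul_ne_zero
      (sub_ne_zero.mpr fun h => hxu (hinj.mpr h.symm))
      (sub_ne_zero.mpr fun h => hzu (hinj.mpr h.symm))
    have h1 : (s - a) * (s - b) * ((t - a) * (t - b)) ≤ 0 := by
      rcases lt_or_gt_of_ne hs0 with h2 | h2 <;> rcases lt_or_gt_of_ne ht0 with h3 | h3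
      · exact absurd hsep (hin h2 h3)
      · exact (mul_neg_of_neg_of_pos h2 h3).le
      · exact (mul_neg_of_pos_of_neg h2 h3).le
      · exact absurd hsep (hout (Or.inr (hmem.mpr h2)) (Or.inr (hmem.mpr h3)))
    simp only [hfd]
    rw [← abs_mul, ← abs_mul, ← abs_mul, ← abs_add_of_mul_nonneg (by linarith)]
    congr 1
    ring

end Circle

section CircleToLine

theorem exists_isometry_of_dist_add {Y : Type*} [MetricSpace Y] {H : ℝ → Y} (hc : Continuous H)
    (hadd : ∀ a b c, a < b → b < c → dist (H a) (H c) = dist (H a) (H b) + dist (H b) (H c))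
    (hlim : Tendsto (fun t => dist (H 0) (H t)) (cocompact ℝ) atTop) :
    ∃ c : ℝ → Y, Isometry c := by
  have hadd' : ∀ a b c, a ≤ b → b ≤ c →
      dist (H a) (H c) = dist (H a) (H b) + dist (H b) (H c) := by
    intro a b c hab hbc
    rcases hab.eq_or_lt with rfl | hab
    · simp
    rcases hbc.eq_or_lt with rfl | hbc
    · simp
    exact hadd a b c hab hbc
  let f : ℝ → ℝ := fun t => if 0 ≤ t then dist (H 0) (H t) else -dist (H 0) (H t)
  have hf : ∀ s t, s ≤ t → f t - f s = dist (H s) (H t) := by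
    intro s t hst
    simp only [f]
    split_ifs with ht hs hs
    · linarith [hadd' 0 s t hs hst]
    · linarith [hadd' s 0 t (not_le.mp hs).le ht, dist_comm (H s) (H 0)]
    · exact absurd (hs.trans hst) ht
    · linarith [hadd' s t 0 hst (not_le.mp ht).le, dist_comm (H s) (H 0), dist_comm (H t) (H 0)]
  have hf' : ∀ s t, |f s - f t| = dist (H s) (H t) := by
    intro s t
    rcases le_total s t with h | h
    · rw [abs_sub_comm, hf s t h, abs_of_nonneg dist_nonneg]
    · rw [hf t s h, abs_of_nonneg dist_nonneg, dist_comm]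
  have hfc : Continuous f := by
    rw [continuous_iff_continuousAt]
    intro t
    rw [ContinuousAt, tendsto_iff_dist_tendsto_zero]
    simp only [Real.dist_eq, hf']
    exact tendsto_iff_dist_tendsto_zero.mp (hc.tendsto t)
  have hsurj : Function.Surjective f := by
    refine hfc.surjective ?_ ?_
    · refine (hlim.mono_left atTop_le_cocompact).congr' ?_
      filter_upwards [eventually_ge_atTop 0] with t ht
      exact (if_pos ht).symm
    · refine (tendsto_neg_atTop_atBot.comp (hlim.mono_left atBot_le_cocompact)).congr' ?_
      filter_upwards [eventually_lt_atBot 0] with t ht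
      exact (if_neg ht.not_ge).symm
  refine ⟨fun t => H (Function.surjInv hsurj t), Isometry.of_dist_eq fun s t => ?_⟩
  rw [← hf', Function.surjInv_eq hsurj, Function.surjInv_eq hsurj, Real.dist_eq]

variable {X : Type*} {S : MobiusStructure X}

theorem separatesIn_onePoint {σ : Set X} (g : letI := mobiusTop S; OnePoint ℝ ≃ₜ σ) {a b c : ℝ}
    (hab : a < b) (hbc : b < c) :
    SeparatesIn S σ (g b).1 (g OnePoint.infty).1 (g a).1 (g c).1 := by
  let _ := mobiusTop S
  intro hmem
  set C := connectedComponentIn (σ \ {(g b).1, (g OnePoint.infty).1}) (g a).1 with hC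
  have hCc : (g c).1 ∈ C := hmem
  have hCsub : C ⊆ σ \ {(g b).1, (g OnePoint.infty).1} := connectedComponentIn_subset _ _
  have hCa : (g a).1 ∈ C := mem_connectedComponentIn
    (connectedComponentIn_nonempty_iff.mp ⟨_, hCc⟩)
  have hind : IsInducing fun t : ℝ => (g t).1 :=
    (IsInducing.subtypeVal.comp g.isInducing).comp OnePoint.isOpenEmbedding_coe.isInducing
  have hCr : C ⊆ Set.range fun t : ℝ => (g t).1 := by
    intro x hx
    obtain ⟨hxσ, hxn⟩ := hCsub hx
    obtain ⟨p, hp⟩ := g.surjective ⟨x, hxσ⟩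
    induction p using OnePoint.rec with
    | infty => exact absurd (Or.inr (congrArg Subtype.val hp).symm) hxn
    | coe t => exact ⟨t, congrArg Subtype.val hp⟩
  have hP : IsPreconnected ((fun t : ℝ => (g t).1) ⁻¹' C) := by
    rw [← hind.isPreconnected_image, Set.image_preimage_eq_of_subset hCr]
    exact isPreconnected_connectedComponentIn
  have hb := hP.ordConnected.out hCa hCc ⟨hab.le, hbc.le⟩
  exact (hCsub hb).2 (Or.inl rfl)

theorem exists_line_of_circle (hpt : IsPtolemyStructure S)
    {σ : Set X} (hσ : IsPtolemyCircle S σ) :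
    ∃ ω ∈ σ, ∀ d ∈ S.M, ∀ h : d.rem = some ω, ∃ c : ℝ → Punct d h, Isometry c := by
  let _ := mobiusTop S
  obtain ⟨g₁⟩ := exists_onePoint_homeo_circle
  obtain ⟨g₂⟩ := hσ.1
  let g : OnePoint ℝ ≃ₜ σ := g₁.trans g₂.symm
  refine ⟨(g OnePoint.infty).1, (g OnePoint.infty).2, fun d hd h => ?_⟩
  have hinj : ∀ {p q : OnePoint ℝ}, (g p).1 = (g q).1 ↔ p = q :=
    (Subtype.val_injective.comp g.injective).eq_iff
  have hne : ∀ t : ℝ, (g t).1 ≠ (g OnePoint.infty).1 := fun t ht =>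
    OnePoint.coe_ne_infty t (hinj.mp ht)
  let H : ℝ → Punct d h := fun t => ⟨(g t).1, hne t⟩
  have hgc : Continuous fun t : ℝ => (g t).1 :=
    continuous_subtype_val.comp (g.continuous.comp OnePoint.continuous_coe)
  have hHc : Continuous H :=
    (continuous_toPunct hd h).comp (hgc.subtype_mk hne)
  refine exists_isometry_of_dist_add hHc ?_ ?_
  · intro a b c hab hbc
    obtain ⟨d', hd', hr⟩ := exists_metric_rem hpt (g ((c + 1 : ℝ) : OnePoint ℝ)).1
    have hn : ∀ {p q : OnePoint ℝ}, p ≠ q → (g p).1 ≠ (g q).1 := fun hpq h => hpq (hinj.mp h)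
    have hcoe : ∀ {s t : ℝ}, s ≠ t → (s : OnePoint ℝ) ≠ (t : OnePoint ℝ) := fun hst h =>
      hst (OnePoint.coe_injective h)
    have h1 := hσ.2 d' hd' _ (g b).2 _ (g a).2 _ (g OnePoint.infty).2 _ (g c).2
      (hn (hcoe hab.ne')) (hne b) (hn (hcoe hbc.ne)) (hne a) (hn (hcoe (hab.trans hbc).ne))
      (hne c).symm (separatesIn_onePoint g hab hbc)
    have ra : d'.rem ≠ some (g a).1 := d'.rem_ne hr (hn (hcoe (by linarith)))
    have rb : d'.rem ≠ some (g b).1 := d'.rem_ne hr (hn (hcoe (by linarith)))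
    have rc : d'.rem ≠ some (g c).1 := d'.rem_ne hr (hn (hcoe (by linarith)))
    have rω : d'.rem ≠ some (g OnePoint.infty).1 := d'.rem_ne hr (hne _).symm
    have h2 := congrArg ENNReal.toReal h1
    rw [ENNReal.toReal_add (ENNReal.mul_ne_top (d'.ne_top rb ra) (d'.ne_top rω rc))
      (ENNReal.mul_ne_top (d'.ne_top rb rc) (d'.ne_top ra rω))] at h2
    simp only [ENNReal.toReal_mul] at h2
    rw [← d'.fd_eq rb rω, ← d'.fd_eq ra rc, ← d'.fd_eq rb ra, ← d'.fd_eq rω rc, ← d'.fd_eq rb rc,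
      ← d'.fd_eq ra rω] at h2
    have h3 := fd_ptolemy_eq_congr hd' hd
      (admissible_of_ne _ (hn (hcoe hab.ne')) (hne b) (hne a)) h2
    rw [d.fd_rem h (hne b), d.fd_comm (g OnePoint.infty).1 (g c).1, d.fd_rem h (hne c), d.fd_rem h
      (hne a)] at h3
    simp only [Punct.dist_eq_fd, H]
    rw [d.fd_comm (g a).1 (g b).1]
    linarith
  · rw [tendsto_atTop]
    intro r
    have h1 : Tendsto (fun t : ℝ => (g t).1) (cocompact ℝ) (𝓝 (g OnePoint.infty).1) := by
      rw [← coclosedCompact_eq_cocompact]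
      exact ((continuous_subtype_val.comp g.continuous).tendsto _).comp OnePoint.tendsto_coe_infty
    have h2 := isOpen_mobius_coball hd (d.rem_ne h (hne 0)) (r := max r 1) (by positivity)
    have h3 : (g OnePoint.infty).1 ∈ {y | ENNReal.ofReal (max r 1) < d.d y (g (0 : ℝ)).1} := by
      rw [Set.mem_ofPred_eq, (d.d_eq_top_iff _ _).mpr ⟨(hne 0).symm, Or.inl h⟩]
      exact ENNReal.ofReal_lt_top
    filter_upwards [h1.eventually (h2.mem_nhds h3)] with t ht
    rw [dist_comm, Punct.dist_def]
    have h4 := (ENNReal.ofReal_lt_iff_lt_toReal (by positivity) ((H t).ne_top (H 0))).mp ht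
    exact (le_max_left _ _).trans h4.le

end CircleToLine

section Inversions

variable {X : Type*} {S : MobiusStructure X} {d : ExtMetric X} {ω : X} {h : d.rem = some ω}

theorem IsSpaceInversion.dist_center {o : X} {r : ℝ} {f : X → X}
    (hf : IsSpaceInversion S o ω {x | d.d x o = ENNReal.ofReal r} f) (hd : d ∈ S.M)
    (h : d.rem = some ω) (ho : o ≠ ω) (hr : 0 < r) (hs : ∃ p, d.d p o = ENNReal.ofReal r) :
    (∀ x, x ≠ ω → x ≠ o → d.fd (f x) o * d.fd x o = r ^ 2) ∧
      ∀ x y, x ≠ ω → x ≠ o → y ≠ ω → y ≠ o →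
        d.fd (f x) (f y) * (d.fd x o * d.fd y o) = r ^ 2 * d.fd x y := by
  obtain ⟨⟨hbij, hcrt⟩, hinv, -, hfo, hSp, -⟩ := hf
  have hfω : f ω = o := by rw [← hfo, hinv]
  have hfx : ∀ {x}, x ≠ o → f x ≠ ω := fun hx hfx => hx (by rw [← hfω, ← hfx, hinv])
  have key : ∀ x y, x ≠ ω → x ≠ o → y ≠ ω → y ≠ o → x ≠ y →
      ∃ l, d.fd (f x) (f y) = l * d.fd x y ∧ d.fd (f x) o = l * d.fd y o ∧
        d.fd (f y) o = l * d.fd x o := by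
    intro x y hx hxo hy hyo hxy
    obtain ⟨l, -, hl⟩ := hcrt d hd x y ω o (admissible_of_ne o hxy hx hy)
    simp only [crtVec, hfo, hfω, Prod.smul_mk, smul_eq_mul, Prod.mk.injEq, d.fd_comm ω,
      d.fd_rem h hx, d.fd_rem h hy, d.fd_rem h (hfx hxo), d.fd_rem h (hfx hyo), d.fd_rem h ho] at hl
    exact ⟨l, by linarith [hl.1], by linarith [hl.2.1], by linarith [hl.2.2]⟩
  obtain ⟨p, hp⟩ := hs
  have hpo : p ≠ o := by
    rintro rfl
    rw [d.d_self] at hp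
    exact (ENNReal.ofReal_pos.mpr hr).ne hp
  have hfd : ∀ q, d.d q o = ENNReal.ofReal r → d.fd q o = r := fun q hq => by
    rw [ExtMetric.fd, if_neg (hq ▸ ENNReal.ofReal_ne_top), hq, ENNReal.toReal_ofReal hr.le]
  have hpω : p ≠ ω := by
    rintro rfl
    rw [(d.d_eq_top_iff _ _).mpr ⟨hpo, Or.inl h⟩] at hp
    exact ENNReal.ofReal_ne_top hp.symm
  have hfp : d.d (f p) o = ENNReal.ofReal r := by
    have : f p ∈ {x | d.d x o = ENNReal.ofReal r} := hSp ▸ ⟨p, hp, rfl⟩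
    exact this
  have h1 : ∀ x, x ≠ ω → x ≠ o → d.fd (f x) o * d.fd x o = r ^ 2 := by
    intro x hx hxo
    rcases eq_or_ne x p with rfl | hxp
    · rw [hfd _ hfp, hfd _ hp]
      ring
    · obtain ⟨l, -, h2, h3⟩ := key x p hx hxo hpω hpo hxp
      rw [hfd _ hp] at h2
      rw [hfd _ hfp] at h3
      rw [h2]
      linear_combination -r * h3
  refine ⟨h1, fun x y hx hxo hy hyo => ?_⟩
  rcases eq_or_ne x y with rfl | hxy
  · simp [d.fd_self]
  · obtain ⟨l, h2, h3, -⟩ := key x y hx hxo hy hyo hxy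
    rw [h2, ← h1 x hx hxo, h3]
    ring

/-- The properties of the restriction of a space inversion to the complement of the remote
point. -/
structure IsPunctInv (S : MobiusStructure X) (o : Punct d h) (r : ℝ) (φ : Punct d h → Punct d h) :
    Prop where
  map_center : φ o = o
  invol : Function.Involutive φ
  ne_self : ∀ x, x ≠ o → φ x ≠ x
  dist_mul : ∀ x y, x ≠ o → y ≠ o →
    dist (φ x) (φ y) * (dist x o * dist y o) = r ^ 2 * dist x y
  dist_center : ∀ x, x ≠ o → dist (φ x) o * dist x o = r ^ 2
  map_circle : ∀ σ, IsPtolemyCircle S σ → o.val ∈ σ → ω ∈ σ → ∀ x, x ≠ o → x.val ∈ σ →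
    (φ x).val ∈ σ

theorem exists_isPunctInv (hI : PropertyI S) (hd : d ∈ S.M) (o : Punct d h) {r : ℝ} (hr : 0 < r)
    (hs : ∃ p, dist p o = r) : ∃ φ, IsPunctInv S o r φ := by
  classical
  obtain ⟨f, hf, -⟩ := hI o.val ω o.ne {x | d.d x o.val = ENNReal.ofReal r}
    ⟨d, hd, h, _, ENNReal.ofReal_pos.mpr hr, ENNReal.ofReal_ne_top, rfl⟩
  obtain ⟨h1, h2⟩ := hf.dist_center hd h o.ne hr
    (hs.imp' Punct.val fun p hp => by rw [Punct.edist_eq, hp])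
  obtain ⟨-, hinv, hne, hfo, -, hcirc⟩ := hf
  have hfω : f ω = o.val := (hinv.eq_iff.mp hfo).symm
  have hv : ∀ {x : Punct d h}, x ≠ o → x.val ≠ o.val := fun hx hv => hx (Punct.ext' hv)
  have hfx : ∀ {x : Punct d h}, x ≠ o → f x.val ≠ ω := fun hx hfx =>
    hv hx ((hinv.eq_iff.mp hfx).trans hfω)
  have hfx' : ∀ {x : Punct d h}, f x.val ≠ o.val := fun {x} hx =>
    x.ne ((hinv.eq_iff.mp hx).trans hfo)
  let φ : Punct d h → Punct d h := fun x => if hx : x = o then o else ⟨f x.val, hfx hx⟩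
  have hφo : φ o = o := dif_pos rfl
  have hφ : ∀ {x}, x ≠ o → (φ x).val = f x.val := fun hx => by simp only [φ, dif_neg hx]
  refine ⟨φ, hφo, fun x => ?_, fun x hx hx' => ?_, fun x y hx hy => ?_, fun x hx => ?_,
    fun σ hσ hoσ hωσ x hx hxσ => ?_⟩
  · by_cases hx : x = o
    · rw [hx, hφo, hφo]
    · have h3 : φ x ≠ o := fun h4 => hfx' (x := x) (by rw [← hφ hx, h4])
      exact Punct.ext' (by rw [hφ h3, hφ hx, hinv])
  · exact hne x.val (by rw [← hφ hx, hx'])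
  · simp only [Punct.dist_eq_fd, hφ hx, hφ hy]
    exact h2 _ _ x.ne (hv hx) y.ne (hv hy)
  · simp only [Punct.dist_eq_fd, hφ hx]
    exact h1 _ x.ne (hv hx)
  · rw [hφ hx, ← hcirc σ hσ hoσ hωσ]
    exact ⟨_, hxσ, rfl⟩

theorem IsPunctInv.isInv {o : Punct d h} {r : ℝ} {φ : Punct d h → Punct d h}
    (hφ : IsPunctInv S o r φ) (hr : 0 < r) (hpt : IsPtolemyStructure S) (hcomp : MobiusCompact S)
    (hd : d ∈ S.M) : IsInv o r φ := by
  refine ⟨hφ.map_center, hφ.invol, hφ.ne_self, hφ.dist_mul, hφ.dist_center, fun c hc hc0 => ?_⟩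
  have hne : ∀ {t}, t ≠ 0 → c t ≠ o := fun ht h0 => ht (hc.injective (h0.trans hc0.symm))
  have key : ∀ t, t ≠ 0 → ∃ s, φ (c t) = c s ∧ |s| * |t| = r ^ 2 := by
    intro t ht
    have h1 := hφ.map_circle _ (isPtolemyCircle_line hpt hcomp hd hc) (Or.inr ⟨0, by rw [← hc0]⟩)
      (Or.inl rfl) (c t) (hne ht) (Or.inr ⟨t, rfl⟩)
    rcases h1 with h1 | ⟨s, h1⟩
    · exact absurd h1 (φ (c t)).ne
    · have h2 : φ (c t) = c s := Punct.ext' h1.symm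
      refine ⟨s, h2, ?_⟩
      have h3 := hφ.dist_center (c t) (hne ht)
      rwa [h2, ← hc0, hc.dist_eq, hc.dist_eq, Real.dist_0_eq_abs, Real.dist_0_eq_abs] at h3
  have hcr : φ (c r) = c (-r) := by
    obtain ⟨s, hs, h1⟩ := key r hr.ne'
    rw [abs_of_pos hr, sq] at h1
    rcases (abs_eq hr.le).mp (mul_right_cancel₀ hr.ne' h1) with rfl | rfl
    · exact absurd hs (hφ.ne_self _ (hne hr.ne'))
    · exact hs
  intro t ht
  obtain ⟨s, hs, h1⟩ := key t ht
  rw [hs]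
  rw [← abs_mul, abs_eq (by positivity)] at h1
  rcases h1 with h1 | h1
  · exfalso
    have h2 := hφ.dist_mul (c t) (c r) (hne ht) (hne hr.ne')
    rw [hs, hcr, ← hc0] at h2
    simp only [hc.dist_eq, Real.dist_eq, sub_zero, sub_neg_eq_add] at h2
    rw [← mul_assoc, ← abs_mul, abs_of_pos hr, add_mul, h1,
      show r ^ 2 + r * t = r * (r + t) by ring, abs_mul, abs_of_pos hr] at h2
    have h3 : |r + t| = |t - r| := by
      have : r ^ 2 ≠ 0 := by positivity
      exact mul_left_cancel₀ this (by linarith)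
    rcases abs_eq_abs.mp h3 with h4 | h4
    · linarith
    · exact ht (by linarith)
  · congr 1
    field_simp
    linarith

theorem exists_dist_eq_of_line {Y : Type*} [MetricSpace Y] {c : ℝ → Y} (hc : Isometry c) (p : Y)
    {r : ℝ} (hr : dist (c 0) p ≤ r) : ∃ x, dist x p = r := by
  have h1 : r ≤ dist (c (r + dist (c 0) p)) p := by
    have h2 := dist_triangle (c (r + dist (c 0) p)) p (c 0)
    have h3 := le_abs_self (r + dist (c 0) p)
    rw [hc.dist_eq, Real.dist_0_eq_abs, dist_comm p] at h2
    linarith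
  have h2 : Continuous fun t => dist (c t) p := hc.continuous.dist continuous_const
  obtain ⟨t, ht⟩ := mem_range_of_exists_le_of_exists_ge h2 ⟨0, hr⟩ ⟨_, h1⟩
  exact ⟨c t, ht⟩

theorem exists_line_through [ProperSpace (Punct d h)] (hI : PropertyI S) (hd : d ∈ S.M)
    {c : ℝ → Punct d h} (hc : Isometry c) (p : Punct d h) :
    ∃ c' : ℝ → Punct d h, Isometry c' ∧ c' 0 = p := by
  by_cases hp : ∃ t, c t = p
  · obtain ⟨t, ht⟩ := hp
    exact ⟨fun s => c (s + t), hc.comp (isometry_add_right t), by simpa using ht⟩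
  push Not at hp
  set r := dist (c 0) p with hrdef
  have hr : 0 < r := dist_pos.mpr (hp 0)
  obtain ⟨φ, hφ⟩ := exists_isPunctInv hI hd p hr (exists_dist_eq_of_line hc p le_rfl)
  have hn : ∀ n : ℕ, (1 : ℝ) ≤ n + 1 := fun n => by
    have : (0 : ℝ) ≤ n := n.cast_nonneg
    linarith
  have hn0 : ∀ n : ℕ, (0 : ℝ) < n + 1 := fun n => one_pos.trans_le (hn n)
  choose ψ hψ using fun n : ℕ => exists_isPunctInv hI hd p (mul_pos (hn0 n) hr)
    (exists_dist_eq_of_line hc p (le_mul_of_one_le_left hr.le (hn n)))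
  have hψne : ∀ n x, x ≠ p → ψ n x ≠ p := fun n x hx hx' =>
    hx ((hψ n).invol.injective (hx'.trans (hψ n).map_center.symm))
  have hdist : ∀ n x, x ≠ p → dist (φ (ψ n x)) p = dist x p / (n + 1) ^ 2 := by
    intro n x hx
    have h1 := (hψ n).dist_center x hx
    have h2 := hφ.dist_center _ (hψne n x hx)
    have h3 : 0 < dist (ψ n x) p := dist_pos.mpr (hψne n x hx)
    rw [eq_div_iff (pow_pos (hn0 n) 2).ne']
    refine mul_right_cancel₀ (mul_pos h3 (pow_pos hr 2)).ne' ?_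
    linear_combination r ^ 2 * (n + 1) ^ 2 * h2 - r ^ 2 * h1
  have hscale : ∀ n x y, x ≠ p → y ≠ p →
      dist (φ (ψ n x)) (φ (ψ n y)) = dist x y / (n + 1) ^ 2 := by
    intro n x y hx hy
    have h1 := (hψ n).dist_mul x y hx hy
    have h2 := hφ.dist_mul _ _ (hψne n x hx) (hψne n y hy)
    have h3 : 0 < dist (ψ n x) p := dist_pos.mpr (hψne n x hx)
    have h4 : 0 < dist (ψ n y) p := dist_pos.mpr (hψne n y hy)
    have h5 := (hψ n).dist_center x hx
    have h6 := (hψ n).dist_center y hy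
    have h7 : 0 < dist x p := dist_pos.mpr hx
    have h8 : 0 < dist y p := dist_pos.mpr hy
    have hN := hn0 n
    rw [eq_div_iff (pow_pos hN 2).ne']
    set D := dist (φ (ψ n x)) (φ (ψ n y))
    have h9 : D * ((((n + 1) * r) ^ 2) * (((n + 1) * r) ^ 2)) =
        r ^ 2 * (((n + 1) * r) ^ 2 * dist x y) := by
      rw [← h1]
      nth_rewrite 1 [← h5]
      rw [← h6]
      linear_combination dist x p * dist y p * h2
    refine mul_right_cancel₀ (mul_pos (pow_pos hr 4) (pow_pos hN 2)).ne' ?_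
    linear_combination h9
  have hf : ∀ n, Isometry fun t : ℝ => φ (ψ n (c ((n + 1) ^ 2 * t))) := by
    intro n
    refine Isometry.of_dist_eq fun s t => ?_
    have hN := hn0 n
    rw [hscale n _ _ (hp _) (hp _), hc.dist_eq, Real.dist_eq, Real.dist_eq, ← mul_sub, abs_mul,
      abs_of_pos (by positivity)]
    field_simp
  have hf0 : ∀ n : ℕ, dist (φ (ψ n (c ((n + 1) ^ 2 * 0)))) p = r / (n + 1) ^ 2 := by
    intro n
    rw [hdist n _ (hp _), mul_zero]
  let U : Ultrafilter ℕ := Ultrafilter.of atTop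
  obtain ⟨c', hc'⟩ := exists_ultralimit U (fun n t => φ (ψ n (c ((n + 1) ^ 2 * t)))) p
    (fun t => |t| + r) fun t => Eventually.of_forall fun n => by
      refine (dist_triangle _ (φ (ψ n (c ((n + 1) ^ 2 * 0)))) _).trans (add_le_add ?_ ?_)
      · exact ((hf n).dist_eq t 0).le.trans (by rw [Real.dist_0_eq_abs])
      · rw [hf0]
        exact div_le_self hr.le (one_le_pow₀ (hn n))
  refine ⟨c', isometry_of_tendsto hf hc', ?_⟩
  have h1 : Tendsto (fun n : ℕ => r / ((n : ℝ) + 1) ^ 2) atTop (𝓝 0) := by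
    refine tendsto_const_nhds.div_atTop ?_
    exact (tendsto_pow_atTop two_ne_zero).comp
      (tendsto_atTop_add_const_right _ _ tendsto_natCast_atTop_atTop)
  have h2 := (hc' 0).dist (tendsto_const_nhds (x := p))
  simp only [hf0] at h2
  exact dist_eq_zero.mp (tendsto_nhds_unique h2 (h1.mono_left (Ultrafilter.of_le _)))

theorem invSpace_punct (hpt : IsPtolemyStructure S) (hcomp : MobiusCompact S) (hI : PropertyI S)
    (hd : d ∈ S.M) {c : ℝ → Punct d h} (hc : Isometry c) : InvSpace (Punct d h) := by
  have := properSpace_punct hcomp hd h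
  refine { this with
    ptolemy := fun x y z u => ?_
    exists_line := exists_line_through hI hd hc
    exists_inv := fun o r hr => ?_ }
  · simp only [Punct.dist_eq_fd]
    exact fd_ptolemy hpt hd _ _ _ _
  · obtain ⟨c', hc', h0⟩ := exists_line_through hI hd hc o
    obtain ⟨φ, hφ⟩ := exists_isPunctInv hI hd o hr
      ⟨c' r, by rw [← h0, hc'.dist_eq, Real.dist_0_eq_abs, abs_of_pos hr]⟩
    exact ⟨φ, hφ.isInv hr hpt hcomp hd⟩

end Inversions

section Final

variable {X : Type*} {S : MobiusStructure X} {d : ExtMetric X} {ω : X} {h : d.rem = some ω}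

theorem image_val_fiber (hpt : IsPtolemyStructure S) (hcomp : MobiusCompact S) (hd : d ∈ S.M)
    (o : Punct d h) :
    Punct.val '' {y : Punct d h | ∀ c : ℝ → Punct d h, Isometry c → bus c y = bus c o} =
      mobiusFiber S d ω o.val := by
  classical
  ext y
  constructor
  · rintro ⟨y, hy, rfl⟩
    refine ⟨y.ne, ?_⟩
    rintro l b ⟨⟨σ, -, -, rfl⟩, c, ⟨hr, hc⟩, C, hb⟩
    have hne : ∀ t, c t ≠ ω := fun t => (hr ▸ Set.mem_range_self t : c t ∈ σ \ {ω}).2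
    let c' : ℝ → Punct d h := fun t => ⟨c t, hne t⟩
    have hc' : Isometry c' := Isometry.of_dist_eq fun s t => by
      rw [Punct.dist_def, hc, ENNReal.toReal_ofReal (abs_nonneg _), Real.dist_eq]
    have hbus : ∀ x : Punct d h, b x.val + C = -bus c' x := fun x => by
      refine tendsto_nhds_unique (hb x.val x.ne) ((tendsto_bus hc' x).neg.congr fun t => ?_)
      rw [neg_sub]
      rfl
    have h1 := hbus y
    rw [hy c' hc', ← hbus o] at h1
    exact add_right_cancel h1
  · rintro ⟨hyω, hy⟩
    refine ⟨⟨y, hyω⟩, fun c hc => ?_, rfl⟩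
    have h1 := hy (insert ω (Set.range fun t => (c t).val) \ {ω})
      (fun x => if hx : x = ω then 0 else -bus c ⟨x, hx⟩)
      ⟨⟨_, isPtolemyCircle_line hpt hcomp hd hc, Or.inl rfl, rfl⟩, fun t => (c t).val,
        ⟨?_, fun s t => ?_⟩, 0, fun x hx => ?_⟩
    · simp only [dif_neg hyω, dif_neg o.ne, neg_inj] at h1
      exact h1
    · rw [Set.insert_sdiff_of_mem _ (Set.mem_singleton ω), Set.sdiff_singleton_eq_self]
      rintro ⟨t, ht⟩
      exact (c t).ne ht
    · rw [Punct.edist_eq, hc.dist_eq, Real.dist_eq]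
    · simp only [dif_neg hx, add_zero]
      refine (tendsto_bus hc ⟨x, hx⟩).neg.congr fun t => ?_
      rw [neg_sub]
      rfl

theorem exists_fiber_homeo (hpt : IsPtolemyStructure S) (hcomp : MobiusCompact S) (hd : d ∈ S.M)
    (o : Punct d h) (hf : SubsetHomeoToReal S (mobiusFiber S d ω o.val)) :
    Nonempty ({y : Punct d h | ∀ c : ℝ → Punct d h, Isometry c → bus c y = bus c o} ≃ₜ ℝ) := by
  let _ := mobiusTop S
  obtain ⟨e⟩ := hf
  exact ⟨(((isEmbedding_punct_val hcomp hd h).homeomorphImage _).trans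
    (Homeomorph.setCongr (image_val_fiber hpt hcomp hd o))).trans e⟩

theorem exists_auto_of_ne (hI : PropertyI S) (hd : d ∈ S.M) (h : d.rem = some ω) {ω' : X}
    (hω : ω' ≠ ω) : ∃ f : X → X, IsMobiusAuto S f ∧ f ω' = ω := by
  obtain ⟨f, hf, -⟩ := hI ω' ω hω {x | d.d x ω' = 1}
    ⟨d, hd, h, 1, one_pos, ENNReal.one_ne_top, rfl⟩
  exact ⟨f, hf.1, hf.2.2.2.1⟩

/-- The pullback of an extended metric by a bijection. -/
noncomputable def ExtMetric.pullback (d : ExtMetric X) (f : X ≃ X) : ExtMetric X where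
  d x y := d.d (f x) (f y)
  rem := d.rem.map f.symm
  symm _ _ := d.symm _ _
  d_self _ := d.d_self _
  pos _ _ hxy := d.pos _ _ (f.injective.ne hxy)
  triangle _ _ _ := d.triangle _ _ _
  d_eq_top_iff x y := by
    rw [d.d_eq_top_iff, f.injective.ne_iff]
    simp [Option.map_eq_some_iff, f.symm_apply_eq]

end Final

end Proof

/-- Theorem 1.2, the case `p = 1`.  Let `X` be a compact Ptolemy
space with properties (E) and (I) whose canonical fibrations have fibers homeomorphic
to `ℝ`.  Then there is `k ≥ 2` such that for every `ω ∈ X` there are a metric `d ∈ 𝓜`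
with infinitely remote point `ω` and a bijection `Φ : X∖{ω} → ℂ^{k−1} × ℝ` with
`d(x,x')⁴ = ‖z−z'‖⁴ + 16·(h − h' − ½·Im⟨z,z'⟩)²` for all `x, x'`, where
`Φ x = (z,h)`, `Φ x' = (z',h')` and `⟨z,z'⟩ = ∑ᵢ zᵢ·conj(z'ᵢ)`; i.e. `X∖{ω}` with a
suitably normalized metric of `𝓜` is isometric to the Heisenberg group with the
Korányi gauge, so `X` is Möbius equivalent to `∂_∞ ℂHᵏ`. -/
theorem stmt_19 {X : Type*} (S : MobiusStructure X)
    (hpt : IsPtolemyStructure S) (hcomp : MobiusCompact S)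
    (hE : PropertyE S) (hI : PropertyI S)
    (hfib : ∀ ω : X, ∀ d ∈ S.M, d.rem = some ω → ∀ x : X, x ≠ ω →
      SubsetHomeoToReal S (mobiusFiber S d ω x)) :
    ∃ k : ℕ, 2 ≤ k ∧ ∀ ω : X, ∃ d ∈ S.M, d.rem = some ω ∧
      ∃ Φ : {x : X // x ≠ ω} → EuclideanSpace ℂ (Fin (k - 1)) × ℝ,
        Function.Bijective Φ ∧
        ∀ a b : {x : X // x ≠ ω},
          ((d.d a.1 b.1).toReal) ^ 4 =
            ‖(Φ a).1 - (Φ b).1‖ ^ 4 +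
              16 * ((Φ a).2 - (Φ b).2 -
                (1 / 2) * (∑ i, (Φ a).1 i * (starRingEnd ℂ) ((Φ b).1 i)).im) ^ 2 := by
  obtain ⟨σ, hσ⟩ := hE
  obtain ⟨ω₀, -, hω₀⟩ := exists_line_of_circle hpt hσ
  obtain ⟨d, hd, h⟩ := exists_metric_rem hpt ω₀
  obtain ⟨c, hc⟩ := hω₀ d hd h
  have := invSpace_punct hpt hcomp hI hd hc
  obtain ⟨e⟩ := exists_fiber_homeo hpt hcomp hd (c 0) (hfib ω₀ d hd h _ (c 0).ne)
  obtain ⟨m, hm, Φ, hΦ, hΦd⟩ := exists_heisenberg_coords e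
  refine ⟨m + 1, by omega, fun ω => ?_⟩
  obtain ⟨f, hf, hfω⟩ : ∃ f : X → X, IsMobiusAuto S f ∧ f ω = ω₀ := by
    rcases eq_or_ne ω ω₀ with rfl | hω
    · exact ⟨id, ⟨Function.bijective_id, fun _ _ _ _ _ _ _ => ProjEq.refl _⟩, rfl⟩
    · exact exists_auto_of_ne hI hd h hω
  let g : X ≃ X := Equiv.ofBijective f hf.1
  refine ⟨d.pullback g, mem_of_auto S hd hf fun _ _ => rfl, ?_, ?_⟩
  · change Option.map g.symm d.rem = some ω
    rw [h, Option.map_some, Option.some_inj, g.symm_apply_eq]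
    exact hfω.symm
  have hne : ∀ x, x ≠ ω → f x ≠ ω₀ := fun x hx hfx => hx (hf.1.injective (hfx.trans hfω.symm))
  refine ⟨fun x => Φ ⟨f x.1, hne x.1 x.2⟩, hΦ.comp ⟨fun x y hxy => ?_, fun y => ?_⟩,
    fun a b => hΦd ⟨f a.1, hne a.1 a.2⟩ ⟨f b.1, hne b.1 b.2⟩⟩
  · exact Subtype.ext (hf.1.injective (congrArg Punct.val hxy))
  · obtain ⟨x, hx⟩ := hf.1.surjective y.val
    exact ⟨⟨x, fun hxω => y.ne (by rw [← hx, hxω, hfω])⟩, Punct.ext' hx⟩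

end Mobius
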